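/- Under condition [A], the following local theorem in the regions of normal and moderate deviations holds: if x = x_n ∈ ℕ∪{0} and lim_{n→∞} x/n = a, then P(R(n) = x) = (1/(σ√(2πn))) e^{−n D(x/n)} (1 + o(1)) as n → ∞. -/

import Mathlib

noncomputable section

/-- A chain with unbounded variable length memory over the binary alphabet `{0,1}`,
with memory parameter `v ≥ 1`.  For `k ∈ ℕ ∪ {0}` (the distance from the current
position to the nearest `1`) and a word `w` of `v - 1` letters (the letters standing
to the left of that `1`), `p k w` is the probability of appending the character `1`.
The structure records the sample space, the appended characters `X n = r_n(n)`,
the full configuration `cfg`, the position `mpos ω n` of the rightmost `1` among the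
coordinates `≤ n`, and the Markov transition rule `htrans`. -/
structure VLMC (v : ℕ) (p : ℕ → (Fin (v - 1) → Bool) → ℝ) where
  /-- the sample space -/
  Ω : Type
  [mΩ : MeasurableSpace Ω]
  /-- the underlying probability measure -/
  P : MeasureTheory.Measure Ω
  hprob : MeasureTheory.IsProbabilityMeasure P
  hv : 0 < v
  /-- the (fixed) initial configuration; only the coordinates `i ≤ 0` are relevant -/
  r0 : ℤ → Bool
  /-- `X n` is the random character appended at step `n`, for `n ≥ 1` -/
  X : ℕ → Ω → Bool
  hXmeas : ∀ n, Measurable (X n)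
  /-- the full configuration (it does not change in time: at time `n` only the
  coordinates `≤ n` are relevant) -/
  cfg : Ω → ℤ → Bool
  hcfg : ∀ ω i, cfg ω i = if i ≤ 0 then r0 i else X i.toNat ω
  /-- `mpos ω n` is the position of the rightmost `1` among the coordinates `≤ n` -/
  mpos : Ω → ℕ → ℤ
  hmpos : ∀ ω n, mpos ω n ≤ (n : ℤ) ∧ cfg ω (mpos ω n) = true ∧
    ∀ i : ℤ, mpos ω n < i → i ≤ (n : ℤ) → cfg ω i = false
  /-- the transition rule: on any cylinder (in the appended characters) on which the
  distance from `n` to the nearest `1` equals `k` and the word of the `v - 1` letters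
  standing to the left of that `1` equals `w`, the conditional probability that the
  character appended at step `n + 1` equals `1` is `p k w`. -/
  htrans : ∀ (n : ℕ) (b : Fin n → Bool) (k : ℕ) (w : Fin (v - 1) → Bool),
    (∀ ω, (∀ i : Fin n, X (i.1 + 1) ω = b i) →
      ((n : ℤ) - mpos ω n = (k : ℤ) ∧
        ∀ j : Fin (v - 1), cfg ω (mpos ω n - ((v : ℤ) - 1) + (j.1 : ℤ)) = w j)) →
    P {ω | (∀ i : Fin n, X (i.1 + 1) ω = b i) ∧ X (n + 1) ω = true}
      = ENNReal.ofReal (p k w) * P {ω | ∀ i : Fin n, X (i.1 + 1) ω = b i}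

open MeasureTheory Filter

namespace VLMC

variable {v : ℕ} {p : ℕ → (Fin (v - 1) → Bool) → ℝ}

/-- Condition [A]: the initial configuration contains at least one `1`, and all the
transition probabilities lie between `δ2` and `δ1`, where `0 < δ2 < δ1 < 1`. -/
def CondA (S : VLMC v p) (δ1 δ2 : ℝ) : Prop :=
  (∃ i : ℤ, i ≤ 0 ∧ S.r0 i = true) ∧
  0 < δ2 ∧ δ2 < δ1 ∧ δ1 < 1 ∧
  ∀ (k : ℕ) (w : Fin (v - 1) → Bool), δ2 ≤ p k w ∧ p k w ≤ δ1

/-- `R n`, the number of `1`s appended during the first `n` steps -/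
def R (S : VLMC v p) (n : ℕ) (ω : S.Ω) : ℕ :=
  ∑ k ∈ Finset.Icc 1 n, (S.X k ω).toNat

/-- `Y(n) = y₀ = (0,(0,…,0,1))`, i.e. the character at position `n` is `1` and the
`v - 1` letters to its left are all `0` -/
def hitY0 (S : VLMC v p) (ω : S.Ω) (n : ℕ) : Prop :=
  S.mpos ω n = (n : ℤ) ∧
    ∀ j : Fin (v - 1), S.cfg ω ((n : ℤ) - ((v : ℤ) - 1) + (j.1 : ℤ)) = false

/-- `T k`, the time of the `k`-th visit of the chain `Y` to the state `y₀`
(`T 0 = 0`) -/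
def T (S : VLMC v p) : ℕ → S.Ω → ℕ
  | 0, _ => 0
  | k + 1, ω => sInf {n | T S k ω < n ∧ S.hitY0 ω n}

/-- `τ_k = T_k - T_{k-1}`, the spacings between consecutive visits to `y₀` -/
def tau (S : VLMC v p) (k : ℕ) (ω : S.Ω) : ℕ := S.T k ω - S.T (k - 1) ω

/-- `ζ_k`, the number of `1`s appended at the times `n ∈ (T_{k-1}, T_k]` -/
def zeta (S : VLMC v p) (k : ℕ) (ω : S.Ω) : ℕ :=
  ∑ n ∈ Finset.Ioc (S.T (k - 1) ω) (S.T k ω), (S.X n ω).toNat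

/-- `ν(n) = max {k ≥ 0 : T_k < n}` -/
def nu (S : VLMC v p) (n : ℕ) (ω : S.Ω) : ℕ := sSup {k | S.T k ω < n}

/-- the generalized renewal process `Z(n) = Σ_{k=0}^{ν(n)} ζ_k` (with `ζ_0 = 0`) -/
def Z (S : VLMC v p) (n : ℕ) (ω : S.Ω) : ℕ :=
  ∑ k ∈ Finset.range (S.nu n ω + 1), S.zeta k ω

/-- `a = E ζ / E τ`, where `(τ, ζ) = (τ_2, ζ_2)` has the common distribution of the
regeneration vectors `ξ_k = (τ_k, ζ_k)`, `k ≥ 2` -/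
def a (S : VLMC v p) : ℝ :=
  (∫ ω, (S.zeta 2 ω : ℝ) ∂S.P) / (∫ ω, (S.tau 2 ω : ℝ) ∂S.P)

/-- `σ² = E (ζ - aτ)² / E τ` -/
def sigma2 (S : VLMC v p) : ℝ :=
  (∫ ω, ((S.zeta 2 ω : ℝ) - S.a * (S.tau 2 ω : ℝ)) ^ 2 ∂S.P) /
    (∫ ω, (S.tau 2 ω : ℝ) ∂S.P)

/-- `ψ(λ,μ) = E e^{λτ + μζ}` (as an extended nonnegative real number) -/
def psi (S : VLMC v p) (l m : ℝ) : ENNReal :=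
  ∫⁻ ω, ENNReal.ofReal (Real.exp (l * S.tau 2 ω + m * S.zeta 2 ω)) ∂S.P

/-- `ψ₁(λ,μ) = E e^{λτ₁ + μζ₁}` -/
def psi1 (S : VLMC v p) (l m : ℝ) : ℝ :=
  ∫ ω, Real.exp (l * S.tau 1 ω + m * S.zeta 1 ω) ∂S.P

/-- the deviation function `D(θ,α) = sup {λθ + μα : A(λ,μ) ≤ 0}` where `A = ln ψ`,
so that `A(λ,μ) ≤ 0 ↔ ψ(λ,μ) ≤ 1` -/
def D2 (S : VLMC v p) (θ α : ℝ) : ℝ :=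
  sSup {x | ∃ l m : ℝ, S.psi l m ≤ 1 ∧ x = l * θ + m * α}

/-- `D(α) = D(1,α)` -/
def D (S : VLMC v p) (α : ℝ) : ℝ := S.D2 1 α

/-- the chain starts from the state `y₀ = (0,(0,…,0,1))`, i.e. `Y(0) = y₀`: the
initial configuration has a `1` at position `0` preceded by `v - 1` zeros -/
def StartsAtY0 (S : VLMC v p) : Prop :=
  S.r0 0 = true ∧ ∀ i : ℤ, 1 - (v : ℤ) ≤ i → i < 0 → S.r0 i = false

end VLMC

/-- A pair of integer-valued random variables: a positive span `τ` with an exponential moment,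
and a reward `ζ ≤ τ`, charging two neighbouring points `(m, 1)` and `(m + 1, 1)`. -/
structure RewardedSpan {Ω : Type} [MeasurableSpace Ω] (P : Measure Ω) where
  τ : Ω → ℕ
  ζ : Ω → ℕ
  measurable_τ : Measurable τ
  measurable_ζ : Measurable ζ
  ζ_le : ∀ ω, ζ ω ≤ τ ω
  τ_pos : ∀ᵐ ω ∂P, 0 < τ ω
  s : ℝ
  s_pos : 0 < s
  s_le_one : s ≤ 1
  integrable_exp : Integrable (fun ω => Real.exp (s * τ ω)) P
  m : ℕ
  pos_m : P {ω | τ ω = m ∧ ζ ω = 1} ≠ 0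
  pos_m_succ : P {ω | τ ω = m + 1 ∧ ζ ω = 1} ≠ 0

namespace RewardedSpan

variable {Ω : Type} [MeasurableSpace Ω] {P : Measure Ω} (M : RewardedSpan P)

/-- The exponential weight `e^{lτ + uζ}`. -/
def weight (l u : ℂ) (ω : Ω) : ℂ := Complex.exp (l * M.τ ω + u * M.ζ ω)

lemma measurable_weight (l u : ℂ) : Measurable (M.weight l u) := by
  have h1 : Measurable fun ω => (M.τ ω : ℂ) := measurable_from_nat.comp M.measurable_τ
  have h2 : Measurable fun ω => (M.ζ ω : ℂ) := measurable_from_nat.comp M.measurable_ζ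
  unfold weight
  fun_prop

lemma norm_weight_le {l u : ℂ} {t : ℝ} (h : |l.re| + |u.re| ≤ t) (ω : Ω) :
    ‖M.weight l u ω‖ ≤ Real.exp (t * M.τ ω) := by
  have h1 : (M.ζ ω : ℝ) ≤ M.τ ω := by exact_mod_cast M.ζ_le ω
  have h2 : (0 : ℝ) ≤ M.ζ ω := Nat.cast_nonneg _
  rw [weight, Complex.norm_exp]
  apply Real.exp_le_exp.2
  simp only [Complex.add_re, Complex.mul_re, Complex.natCast_re, Complex.natCast_im, mul_zero,
    sub_zero]
  have h3 : l.re * M.τ ω ≤ |l.re| * M.τ ω := by gcongr; exact le_abs_self _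
  have h4 : u.re * M.ζ ω ≤ |u.re| * M.τ ω :=
    (mul_le_mul_of_nonneg_right (le_abs_self _) h2).trans
      (mul_le_mul_of_nonneg_left h1 (abs_nonneg _))
  nlinarith [(Nat.cast_nonneg (M.τ ω) : (0 : ℝ) ≤ M.τ ω)]

lemma integrable_pow_mul_exp (j : ℕ) {t : ℝ} (ht : t < M.s) :
    Integrable (fun ω => (M.τ ω : ℝ) ^ j * Real.exp (t * M.τ ω)) P := by
  have h1 : Measurable fun ω => (M.τ ω : ℝ) := measurable_from_nat.comp M.measurable_τ
  refine (M.integrable_exp.const_mul (j.factorial / (M.s - t) ^ j)).mono' (by fun_prop) ?_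
  refine Eventually.of_forall fun ω => ?_
  have hs : 0 < M.s - t := by linarith
  rw [Real.norm_of_nonneg (by positivity)]
  have h2 := Real.pow_div_factorial_le_exp ((M.s - t) * M.τ ω) (by positivity) j
  rw [div_le_iff₀ (by positivity), mul_pow] at h2
  have h3 : (M.τ ω : ℝ) ^ j ≤ j.factorial / (M.s - t) ^ j * Real.exp ((M.s - t) * M.τ ω) := by
    rw [div_mul_eq_mul_div, le_div_iff₀ (by positivity)]
    linarith
  calc (M.τ ω : ℝ) ^ j * Real.exp (t * M.τ ω)
      ≤ j.factorial / (M.s - t) ^ j * Real.exp ((M.s - t) * M.τ ω) * Real.exp (t * M.τ ω) := by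
        gcongr
    _ = _ := by rw [mul_assoc, ← Real.exp_add]; ring_nf

lemma integrable_of_norm_le {F : Ω → ℂ} (hF : Measurable F) (C : ℝ) (j : ℕ)
    {l u : ℂ} (h : |l.re| + |u.re| < M.s) (hb : ∀ ω, ‖F ω‖ ≤ C * (M.τ ω : ℝ) ^ j) :
    Integrable (fun ω => F ω * M.weight l u ω) P := by
  refine ((M.integrable_pow_mul_exp j h).const_mul C).mono'
    (hF.mul (M.measurable_weight l u)).aestronglyMeasurable (Eventually.of_forall fun ω => ?_)
  rw [norm_mul, ← mul_assoc]
  exact mul_le_mul (hb ω) (M.norm_weight_le le_rfl ω) (norm_nonneg _)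
    ((norm_nonneg _).trans (hb ω))

/-- The moment generating function `E e^{lτ + uζ}`. -/
def mgf (l u : ℂ) : ℂ := ∫ ω, M.weight l u ω ∂P

lemma mgf_zero [IsProbabilityMeasure P] : M.mgf 0 0 = 1 := by simp [mgf, weight]

lemma integrable_weight {l u : ℂ} (h : |l.re| + |u.re| < M.s) : Integrable (M.weight l u) P := by
  simpa using M.integrable_of_norm_le (F := fun _ => 1) measurable_const 1 0 h (by simp)

/-- The mean span `E τ`. -/
def meanτ : ℝ := ∫ ω, (M.τ ω : ℝ) ∂P

/-- The mean reward `E ζ`. -/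
def meanζ : ℝ := ∫ ω, (M.ζ ω : ℝ) ∂P

lemma integrable_τ : Integrable (fun ω => (M.τ ω : ℝ)) P := by
  simpa using M.integrable_pow_mul_exp 1 M.s_pos

lemma integrable_ζ : Integrable (fun ω => (M.ζ ω : ℝ)) P := by
  refine M.integrable_τ.mono' (measurable_from_nat.comp M.measurable_ζ).aestronglyMeasurable ?_
  refine Eventually.of_forall fun ω => ?_
  simpa using M.ζ_le ω

lemma meanτ_pos [NeZero P] : 0 < M.meanτ := by
  rw [meanτ, integral_pos_iff_support_of_nonneg (fun ω => Nat.cast_nonneg _) M.integrable_τ]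
  have : (Function.support fun ω => (M.τ ω : ℝ)) =ᵐ[P] Set.univ := by
    filter_upwards [M.τ_pos] with ω hω
    exact propext ⟨fun _ => trivial, fun _ =>
      Function.mem_support.2 ((Nat.cast_ne_zero (R := ℝ)).2 hω.ne')⟩
  rw [measure_congr this]
  exact Measure.measure_univ_pos.2 (NeZero.ne P)

/-- Derivative of the weight in `(u, l)`. -/
def weightDeriv (x : ℂ × ℂ) (ω : Ω) : ℂ × ℂ →L[ℂ] ℂ :=
  M.weight x.2 x.1 ω • ((M.ζ ω : ℂ) • ContinuousLinearMap.fst ℂ ℂ ℂ +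
    (M.τ ω : ℂ) • ContinuousLinearMap.snd ℂ ℂ ℂ)

lemma hasFDerivAt_weight (x : ℂ × ℂ) (ω : Ω) :
    HasFDerivAt (fun x : ℂ × ℂ => M.weight x.2 x.1 ω) (M.weightDeriv x ω) x := by
  have h : HasFDerivAt (fun x : ℂ × ℂ => x.2 * (M.τ ω : ℂ) + x.1 * (M.ζ ω : ℂ))
      ((M.ζ ω : ℂ) • ContinuousLinearMap.fst ℂ ℂ ℂ +
        (M.τ ω : ℂ) • ContinuousLinearMap.snd ℂ ℂ ℂ) x := by
    rw [add_comm]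
    exact (hasFDerivAt_snd.mul_const _).add (hasFDerivAt_fst.mul_const _)
  exact h.cexp

lemma norm_weightDeriv_le {x : ℂ × ℂ} {t : ℝ} (h : |x.2.re| + |x.1.re| ≤ t) (ω : Ω) :
    ‖M.weightDeriv x ω‖ ≤ 2 * ((M.τ ω : ℝ) ^ 1 * Real.exp (t * M.τ ω)) := by
  have h1 : (M.ζ ω : ℝ) ≤ M.τ ω := by exact_mod_cast M.ζ_le ω
  rw [weightDeriv, norm_smul]
  have h2 : ‖(M.ζ ω : ℂ) • ContinuousLinearMap.fst ℂ ℂ ℂ +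
      (M.τ ω : ℂ) • ContinuousLinearMap.snd ℂ ℂ ℂ‖ ≤ 2 * M.τ ω := by
    refine (norm_add_le _ _).trans ?_
    rw [norm_smul, norm_smul]
    have a1 := ContinuousLinearMap.norm_fst_le (𝕜 := ℂ) (E := ℂ) (F := ℂ)
    have a2 := ContinuousLinearMap.norm_snd_le (𝕜 := ℂ) (E := ℂ) (F := ℂ)
    simp only [Complex.norm_natCast]
    nlinarith [(Nat.cast_nonneg (M.τ ω) : (0 : ℝ) ≤ M.τ ω),
      (Nat.cast_nonneg (M.ζ ω) : (0 : ℝ) ≤ M.ζ ω)]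
  have := mul_le_mul (M.norm_weight_le h ω) h2 (norm_nonneg _) (Real.exp_nonneg _)
  linarith

lemma measurable_weightDeriv (x : ℂ × ℂ) : Measurable (M.weightDeriv x) := by
  have h1 : Measurable fun ω => (M.τ ω : ℂ) := measurable_from_nat.comp M.measurable_τ
  have h2 : Measurable fun ω => (M.ζ ω : ℂ) := measurable_from_nat.comp M.measurable_ζ
  exact (M.measurable_weight _ _).smul ((h2.smul_const _).add (h1.smul_const _))

/-- The strip on which the moment generating function is controlled. -/
def strip : Set (ℂ × ℂ) := {x | |x.2.re| + |x.1.re| < M.s / 2}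

lemma isOpen_strip : IsOpen M.strip := by
  refine isOpen_lt ?_ continuous_const
  exact ((Complex.continuous_re.comp continuous_snd).abs).add
    ((Complex.continuous_re.comp continuous_fst).abs)

lemma zero_mem_strip : (0 : ℂ × ℂ) ∈ M.strip := by
  simp [strip, M.s_pos]

lemma hasFDerivAt_mgf {x : ℂ × ℂ} (hx : x ∈ M.strip) :
    HasFDerivAt (fun x : ℂ × ℂ => M.mgf x.2 x.1) (∫ ω, M.weightDeriv x ω ∂P) x := by
  have hs := M.s_pos
  refine hasFDerivAt_integral_of_dominated_of_fderiv_le (M.isOpen_strip.mem_nhds hx)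
    (Eventually.of_forall fun y => (M.measurable_weight _ _).aestronglyMeasurable)
    (M.integrable_weight (hx.trans (by linarith)))
    (M.measurable_weightDeriv x).aestronglyMeasurable
    (Eventually.of_forall fun ω y hy => M.norm_weightDeriv_le (le_of_lt hy) ω)
    ((M.integrable_pow_mul_exp 1 (by linarith)).const_mul 2)
    (Eventually.of_forall fun ω y _ => M.hasFDerivAt_weight y ω)

lemma continuousOn_integral_weightDeriv :
    ContinuousOn (fun x => ∫ ω, M.weightDeriv x ω ∂P) M.strip := by
  have hs := M.s_pos
  refine continuousOn_of_dominated (bound := fun ω =>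
      2 * ((M.τ ω : ℝ) ^ 1 * Real.exp (M.s / 2 * M.τ ω)))
    (fun x _ => (M.measurable_weightDeriv x).aestronglyMeasurable)
    (fun x hx => Eventually.of_forall fun ω => M.norm_weightDeriv_le (le_of_lt hx) ω)
    ((M.integrable_pow_mul_exp 1 (by linarith)).const_mul 2)
    (Eventually.of_forall fun ω => Continuous.continuousOn ?_)
  unfold weightDeriv weight
  fun_prop

lemma contDiffAt_mgf : ContDiffAt ℂ 1 (fun x : ℂ × ℂ => M.mgf x.2 x.1) (0, 0) :=
  contDiffAt_one_iff.2 ⟨_, M.strip, M.isOpen_strip.mem_nhds M.zero_mem_strip,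
    M.continuousOn_integral_weightDeriv, fun _ hx => M.hasFDerivAt_mgf hx⟩

lemma mgf_conj (l u : ℂ) :
    M.mgf (starRingEnd ℂ l) (starRingEnd ℂ u) = starRingEnd ℂ (M.mgf l u) := by
  rw [mgf, mgf, ← integral_conj]
  congr 1
  ext ω
  simp [weight, ← Complex.exp_conj]

lemma isInvertible_fderiv_mgf [IsProbabilityMeasure P] :
    (fderiv ℂ (fun x : ℂ × ℂ => M.mgf x.2 x.1) (0, 0) ∘L
      ContinuousLinearMap.inr ℂ ℂ ℂ).IsInvertible := by
  have hs := M.s_pos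
  have h0 := (M.hasFDerivAt_mgf M.zero_mem_strip).fderiv
  have hInt : Integrable (M.weightDeriv 0) P :=
    ((M.integrable_pow_mul_exp 1 (t := M.s / 2) (by linarith)).const_mul 2).mono'
      (M.measurable_weightDeriv _).aestronglyMeasurable
      (Eventually.of_forall fun ω => M.norm_weightDeriv_le (le_of_lt M.zero_mem_strip) ω)
  have h1 : fderiv ℂ (fun x : ℂ × ℂ => M.mgf x.2 x.1) (0, 0) ∘L
      ContinuousLinearMap.inr ℂ ℂ ℂ = (M.meanτ : ℂ) • ContinuousLinearMap.id ℂ ℂ := by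
    change fderiv ℂ (fun x : ℂ × ℂ => M.mgf x.2 x.1) 0 ∘L _ = _
    rw [h0]
    ext
    simp only [ContinuousLinearMap.comp_apply, ContinuousLinearMap.inr_apply]
    rw [ContinuousLinearMap.integral_apply hInt]
    simp [weightDeriv, weight, meanτ, ← integral_complex_ofReal]
  have hne : (M.meanτ : ℂ) ≠ 0 := by exact_mod_cast M.meanτ_pos.ne'
  rw [h1]
  exact ⟨ContinuousLinearEquiv.unitsEquivAut ℂ (Units.mk0 _ hne), by ext; simp⟩

/-- The analytic branch `l = λ(u)` of the solutions of `E e^{lτ + uζ} = 1` near the origin. -/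
lemma exists_branch [IsProbabilityMeasure P] : ∃ lam : ℂ → ℂ, AnalyticAt ℂ lam 0 ∧ lam 0 = 0 ∧
    (∀ᶠ u in nhds 0, M.mgf (lam u) u = 1) ∧
    (∀ᶠ μ : ℝ in nhds 0, (lam μ).im = 0) := by
  have hc := M.contDiffAt_mgf
  have hi := M.isInvertible_fderiv_mgf
  let lam := hc.implicitFunction one_ne_zero hi
  have hcd : ContDiffAt ℂ 1 lam 0 := hc.contDiffAt_implicitFunction one_ne_zero hi
  have h0 : lam 0 = 0 := hc.implicitFunction_apply_self one_ne_zero hi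
  have h1 : ∀ᶠ u in nhds 0, M.mgf (lam u) u = 1 := by
    have := hc.eventually_apply_implicitFunction one_ne_zero hi
    simpa [M.mgf_zero] using this
  refine ⟨lam, ?_, h0, h1, ?_⟩
  · have := (hcd.eventually (by simp)).mono fun u hu => hu.differentiableAt one_ne_zero
    exact Complex.analyticAt_iff_eventually_differentiableAt.2 this
  · have h2 := hc.eventually_apply_eq_iff_implicitFunction one_ne_zero hi
    have ht : Tendsto (fun μ : ℝ => ((μ : ℂ), starRingEnd ℂ (lam μ))) (nhds 0)
        (nhds ((0 : ℂ), (0 : ℂ))) := by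
      have hcont : ContinuousAt (fun μ : ℝ => ((μ : ℂ), starRingEnd ℂ (lam μ))) 0 := by
        have hl : ContinuousAt lam ((0 : ℝ) : ℂ) := by simpa using hcd.continuousAt
        have hr : ContinuousAt (fun μ : ℝ => (μ : ℂ)) 0 :=
          Complex.continuous_ofReal.continuousAt
        exact hr.prodMk (Complex.continuous_conj.continuousAt.comp
          (ContinuousAt.comp (f := fun μ : ℝ => (μ : ℂ)) hl hr))
      have := hcont.tendsto
      simpa [h0] using this
    have hr : Tendsto (fun μ : ℝ => (μ : ℂ)) (nhds 0) (nhds 0) := by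
      simpa using (Complex.continuous_ofReal.tendsto 0)
    filter_upwards [ht.eventually h2, hr.eventually h1] with μ hμ hμ1
    simp only [M.mgf_zero] at hμ
    have h3 := M.mgf_conj (lam μ) μ
    rw [hμ1, Complex.conj_ofReal, map_one] at h3
    exact Complex.conj_eq_iff_im.1 (hμ.1 h3).symm

/-- The mean reward per unit of time, `E ζ / E τ`. -/
def drift : ℝ := M.meanζ / M.meanτ

/-- The asymptotic variance `E (ζ - aτ)² / E τ`. -/
def variance : ℝ := (∫ ω, ((M.ζ ω : ℝ) - M.drift * M.τ ω) ^ 2 ∂P) / M.meanτ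

/-- The first order coefficient `bτ + ζ`. -/
def slope (b : ℂ) (ω : Ω) : ℂ := b * M.τ ω + M.ζ ω

lemma measurable_slope (b : ℂ) : Measurable (M.slope b) := by
  have h1 : Measurable fun ω => (M.τ ω : ℂ) := measurable_from_nat.comp M.measurable_τ
  have h2 : Measurable fun ω => (M.ζ ω : ℂ) := measurable_from_nat.comp M.measurable_ζ
  unfold slope
  fun_prop

lemma norm_slope_le {b : ℂ} {C : ℝ} (hb : ‖b‖ ≤ C) (ω : Ω) :
    ‖M.slope b ω‖ ≤ (C + 1) * M.τ ω := by
  have h1 : (M.ζ ω : ℝ) ≤ M.τ ω := by exact_mod_cast M.ζ_le ω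
  refine (norm_add_le _ _).trans ?_
  rw [norm_mul, Complex.norm_natCast, Complex.norm_natCast]
  nlinarith [(Nat.cast_nonneg (M.τ ω) : (0 : ℝ) ≤ M.τ ω)]

lemma integrable_sq_sub :
    Integrable (fun ω => ((M.ζ ω : ℝ) - M.drift * M.τ ω) ^ 2) P := by
  have m1 : Measurable fun ω => (M.τ ω : ℝ) := measurable_from_nat.comp M.measurable_τ
  have m2 : Measurable fun ω => (M.ζ ω : ℝ) := measurable_from_nat.comp M.measurable_ζ
  have := (M.integrable_pow_mul_exp 2 M.s_pos).const_mul ((1 + |M.drift|) ^ 2)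
  refine this.mono' (by fun_prop) (Eventually.of_forall fun ω => ?_)
  have h5 : (M.ζ ω : ℝ) ≤ M.τ ω := by exact_mod_cast M.ζ_le ω
  have h6 : |(M.ζ ω : ℝ) - M.drift * M.τ ω| ≤ (1 + |M.drift|) * M.τ ω := by
    refine (abs_sub _ _).trans ?_
    rw [abs_mul, Nat.abs_cast, Nat.abs_cast]
    linarith
  rw [norm_pow, Real.norm_eq_abs]
  simpa [mul_pow] using pow_le_pow_left₀ (abs_nonneg _) h6 2

section

variable {lam : ℂ → ℂ}

lemma hasDerivAt_weight_comp {u : ℂ} (h : DifferentiableAt ℂ lam u) (ω : Ω) :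
    HasDerivAt (fun u => M.weight (lam u) u ω)
      (M.slope (deriv lam u) ω * M.weight (lam u) u ω) u := by
  have h1 : HasDerivAt (fun u => lam u * (M.τ ω : ℂ) + u * (M.ζ ω : ℂ))
      (M.slope (deriv lam u) ω) u := by
    exact ((h.hasDerivAt.mul_const (M.τ ω : ℂ)).fun_add
      ((hasDerivAt_id u).mul_const (M.ζ ω : ℂ))).congr_deriv (by simp [slope])
  have := h1.cexp
  rwa [mul_comm] at this

lemma hasDerivAt_slope_mul_weight {u : ℂ} (h : DifferentiableAt ℂ lam u)
    (h' : DifferentiableAt ℂ (deriv lam) u) (ω : Ω) :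
    HasDerivAt (fun u => M.slope (deriv lam u) ω * M.weight (lam u) u ω)
      ((deriv (deriv lam) u * M.τ ω + M.slope (deriv lam u) ω ^ 2) * M.weight (lam u) u ω) u := by
  have h1 : HasDerivAt (fun u => M.slope (deriv lam u) ω) (deriv (deriv lam) u * M.τ ω) u := by
    simpa [slope] using (h'.hasDerivAt.mul_const (M.τ ω : ℂ)).add_const (M.ζ ω : ℂ)
  exact (h1.fun_mul (M.hasDerivAt_weight_comp h ω)).congr_deriv (by ring)

/-- Along the branch, the weights and their first derivatives are controlled near the origin. -/
lemma eventually_branch_bounds (ha : AnalyticAt ℂ lam 0) (h0 : lam 0 = 0) :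
    ∃ C : ℝ, 0 ≤ C ∧ ∀ᶠ u in nhds (0 : ℂ), DifferentiableAt ℂ lam u ∧
      DifferentiableAt ℂ (deriv lam) u ∧ ‖deriv lam u‖ ≤ C ∧ ‖deriv (deriv lam) u‖ ≤ C ∧
      |(lam u).re| + |u.re| ≤ M.s / 2 := by
  refine ⟨max ‖deriv lam 0‖ ‖deriv (deriv lam) 0‖ + 1, by positivity, ?_⟩
  have h1 := ha.eventually_analyticAt.mono fun u hu => hu.differentiableAt
  have h2 := ha.deriv.eventually_analyticAt.mono fun u hu => hu.differentiableAt
  have h3 : ∀ᶠ u in nhds (0 : ℂ), ‖deriv lam u‖ < max ‖deriv lam 0‖ ‖deriv (deriv lam) 0‖ + 1 :=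
    ha.deriv.continuousAt.norm.eventually_lt_const
      (lt_of_le_of_lt (le_max_left _ _) (lt_add_one _))
  have h4 : ∀ᶠ u in nhds (0 : ℂ),
      ‖deriv (deriv lam) u‖ < max ‖deriv lam 0‖ ‖deriv (deriv lam) 0‖ + 1 :=
    ha.deriv.deriv.continuousAt.norm.eventually_lt_const
      (lt_of_le_of_lt (le_max_right _ _) (lt_add_one _))
  have h5 : ∀ᶠ u in nhds (0 : ℂ), |(lam u).re| + |u.re| < M.s / 2 := by
    have hc : ContinuousAt (fun u => |(lam u).re| + |u.re|) 0 :=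
      ((Complex.continuous_re.continuousAt.comp ha.continuousAt).abs).add
        (Complex.continuous_re.continuousAt.abs)
    refine hc.eventually_lt_const ?_
    simpa [h0] using M.s_pos
  filter_upwards [h1, h2, h3, h4, h5] with u a b c d e
  exact ⟨a, b, c.le, d.le, e.le⟩

lemma eventually_integral_slope_eq_zero (ha : AnalyticAt ℂ lam 0) (h0 : lam 0 = 0)
    (h1 : ∀ᶠ u in nhds 0, M.mgf (lam u) u = 1) :
    ∀ᶠ u in nhds 0, ∫ ω, M.slope (deriv lam u) ω * M.weight (lam u) u ω ∂P = 0 := by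
  obtain ⟨C, hC, hb⟩ := M.eventually_branch_bounds ha h0
  have hs := M.s_pos
  filter_upwards [hb.eventually_nhds, h1.eventually_nhds] with u hu hu1
  have hder := (hasDerivAt_integral_of_dominated_loc_of_deriv_le (μ := P) (x₀ := u) hu
    (F := fun u ω => M.weight (lam u) u ω)
    (F' := fun u ω => M.slope (deriv lam u) ω * M.weight (lam u) u ω)
    (bound := fun ω => (C + 1) * ((M.τ ω : ℝ) ^ 1 * Real.exp (M.s / 2 * M.τ ω)))
    (Eventually.of_forall fun y => (M.measurable_weight _ _).aestronglyMeasurable)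
    (M.integrable_weight (by linarith [hu.self_of_nhds.2.2.2.2]))
    ((M.measurable_slope _).mul (M.measurable_weight _ _)).aestronglyMeasurable
    (Eventually.of_forall fun ω y hy => ?_)
    ((M.integrable_pow_mul_exp 1 (by linarith)).const_mul _)
    (Eventually.of_forall fun ω y hy => M.hasDerivAt_weight_comp hy.1 ω)).2
  · have hconst : HasDerivAt (fun u => ∫ ω, M.weight (lam u) u ω ∂P) 0 u :=
      (hasDerivAt_const u (1 : ℂ)).congr_of_eventuallyEq hu1
    exact hder.unique hconst
  · obtain ⟨-, -, h3, -, h5⟩ := hy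
    rw [norm_mul, pow_one, ← mul_assoc]
    exact mul_le_mul (M.norm_slope_le h3 ω) (M.norm_weight_le h5 ω) (norm_nonneg _) (by positivity)

lemma deriv_branch_zero [NeZero P] (ha : AnalyticAt ℂ lam 0) (h0 : lam 0 = 0)
    (h1 : ∀ᶠ u in nhds 0, M.mgf (lam u) u = 1) : deriv lam 0 = -(M.drift : ℂ) := by
  have h2 := (M.eventually_integral_slope_eq_zero ha h0 h1).self_of_nhds
  have hne : (M.meanτ : ℂ) ≠ 0 := by exact_mod_cast M.meanτ_pos.ne'
  have h3 : ∫ ω, M.slope (deriv lam 0) ω ∂P = deriv lam 0 * M.meanτ + M.meanζ := by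
    unfold slope meanτ meanζ
    rw [integral_add (M.integrable_τ.ofReal.const_mul _) (M.integrable_ζ.ofReal),
      integral_const_mul, ← integral_complex_ofReal, ← integral_complex_ofReal]
    rfl
  have h4 : ∀ ω, M.weight (lam 0) 0 ω = 1 := fun ω => by simp [weight, h0]
  simp only [h4, mul_one, h3] at h2
  rw [drift]
  push_cast
  field_simp
  linear_combination h2

lemma deriv_deriv_branch_zero [NeZero P] (ha : AnalyticAt ℂ lam 0) (h0 : lam 0 = 0)
    (h1 : ∀ᶠ u in nhds 0, M.mgf (lam u) u = 1) :
    deriv (deriv lam) 0 = -(M.variance : ℂ) := by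
  obtain ⟨C, hC, hb⟩ := M.eventually_branch_bounds ha h0
  have hs := M.s_pos
  have mτ : Measurable fun ω => (M.τ ω : ℂ) := measurable_from_nat.comp M.measurable_τ
  have hInt : Integrable (fun ω => M.slope (deriv lam 0) ω * M.weight (lam 0) 0 ω) P :=
    M.integrable_of_norm_le (M.measurable_slope _) (C + 1) 1
      (by linarith [hb.self_of_nhds.2.2.2.2])
      (fun ω => by simpa using M.norm_slope_le hb.self_of_nhds.2.2.1 ω)
  obtain ⟨-, hder⟩ := hasDerivAt_integral_of_dominated_loc_of_deriv_le (μ := P) (x₀ := (0 : ℂ)) hb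
    (F := fun u ω => M.slope (deriv lam u) ω * M.weight (lam u) u ω)
    (F' := fun u ω =>
      (deriv (deriv lam) u * M.τ ω + M.slope (deriv lam u) ω ^ 2) * M.weight (lam u) u ω)
    (bound := fun ω => C * ((M.τ ω : ℝ) ^ 1 * Real.exp (M.s / 2 * M.τ ω)) +
      (C + 1) ^ 2 * ((M.τ ω : ℝ) ^ 2 * Real.exp (M.s / 2 * M.τ ω)))
    (Eventually.of_forall fun y =>
      ((M.measurable_slope _).mul (M.measurable_weight _ _)).aestronglyMeasurable)
    hInt
    (((mτ.const_mul _).add ((M.measurable_slope _).pow_const 2)).mul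
      (M.measurable_weight _ _)).aestronglyMeasurable
    (Eventually.of_forall fun ω y hy => by
      obtain ⟨-, -, h3, h4, h5⟩ := hy
      have e1 := M.norm_slope_le h3 ω
      have e2 := M.norm_weight_le h5 ω
      have e3 : ‖deriv (deriv lam) y * M.τ ω + M.slope (deriv lam y) ω ^ 2‖ ≤
          C * M.τ ω + ((C + 1) * M.τ ω) ^ 2 := by
        refine (norm_add_le _ _).trans ?_
        rw [norm_mul, norm_pow, Complex.norm_natCast]
        gcongr
      rw [norm_mul]
      refine (mul_le_mul e3 e2 (norm_nonneg _) (by positivity)).trans (le_of_eq ?_)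
      ring)
    (((M.integrable_pow_mul_exp 1 (by linarith)).const_mul _).add
      ((M.integrable_pow_mul_exp 2 (by linarith)).const_mul _))
    (Eventually.of_forall fun ω y hy => M.hasDerivAt_slope_mul_weight hy.1 hy.2.1 ω)
  have hconst : HasDerivAt
      (fun u => ∫ ω, M.slope (deriv lam u) ω * M.weight (lam u) u ω ∂P) 0 0 :=
    (hasDerivAt_const (0 : ℂ) (0 : ℂ)).congr_of_eventuallyEq
      (M.eventually_integral_slope_eq_zero ha h0 h1)
  have h2 := hder.unique hconst
  have h4 : ∀ ω, M.weight (lam 0) 0 ω = 1 := fun ω => by simp [weight, h0]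
  have hsq := M.integrable_sq_sub
  have h5 : ∀ ω, M.slope (deriv lam 0) ω ^ 2 =
      (((M.ζ ω : ℝ) - M.drift * M.τ ω) ^ 2 : ℝ) := fun ω => by
    rw [M.deriv_branch_zero ha h0 h1, slope]; push_cast; ring
  have hne : (M.meanτ : ℂ) ≠ 0 := by exact_mod_cast M.meanτ_pos.ne'
  simp only [h4, mul_one, h5] at h2
  rw [integral_add (M.integrable_τ.ofReal.const_mul _) hsq.ofReal, integral_const_mul] at h2
  erw [integral_complex_ofReal, integral_complex_ofReal] at h2
  rw [variance]
  change _ * (M.meanτ : ℂ) + _ = 0 at h2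
  push_cast at h2 ⊢
  field_simp
  linear_combination h2

lemma eventually_deriv_branch_im {lam : ℂ → ℂ} (ha : AnalyticAt ℂ lam 0)
    (hr : ∀ᶠ μ : ℝ in nhds 0, (lam μ).im = 0) :
    ∀ᶠ μ : ℝ in nhds 0, (deriv lam μ).im = 0 := by
  have ht : Tendsto (fun μ : ℝ => (μ : ℂ)) (nhds 0) (nhds 0) := by
    simpa using (Complex.continuous_ofReal.tendsto 0)
  filter_upwards [ht.eventually ha.eventually_analyticAt, hr.eventually_nhds] with μ hμ hμr
  have h1 : HasDerivAt (fun x : ℝ => lam x) (deriv lam μ) μ :=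
    hμ.differentiableAt.hasDerivAt.comp_ofReal
  have h2 : HasDerivAt (fun x : ℝ => (lam x).im) (deriv lam μ).im μ :=
    Complex.imCLM.hasFDerivAt.comp_hasDerivAt μ h1
  exact h2.unique ((hasDerivAt_const μ (0 : ℝ)).congr_of_eventuallyEq hμr)

end

lemma variance_pos [IsProbabilityMeasure P] : 0 < M.variance := by
  refine div_pos ?_ M.meanτ_pos
  have hnn : ∀ ω, 0 ≤ ((M.ζ ω : ℝ) - M.drift * M.τ ω) ^ 2 := fun ω => sq_nonneg _
  have hsq := M.integrable_sq_sub
  refine (integral_nonneg hnn).lt_of_ne fun h => ?_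
  have hz := (integral_eq_zero_iff_of_nonneg hnn hsq).1 h.symm
  have e1 : ∃ ω, (M.τ ω = M.m ∧ M.ζ ω = 1) ∧ ((M.ζ ω : ℝ) - M.drift * M.τ ω) ^ 2 = 0 := by
    by_contra! hcon
    exact M.pos_m (measure_mono_null (fun ω hω => hcon ω hω) hz)
  have e2 : ∃ ω, (M.τ ω = M.m + 1 ∧ M.ζ ω = 1) ∧ ((M.ζ ω : ℝ) - M.drift * M.τ ω) ^ 2 = 0 := by
    by_contra! hcon
    exact M.pos_m_succ (measure_mono_null (fun ω hω => hcon ω hω) hz)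
  obtain ⟨ω, ⟨h1, h2⟩, h3⟩ := e1
  obtain ⟨ω', ⟨h1', h2'⟩, h3'⟩ := e2
  rw [h1, h2] at h3
  rw [h1', h2'] at h3'
  have h4 := pow_eq_zero_iff two_ne_zero |>.1 h3
  have h5 := pow_eq_zero_iff two_ne_zero |>.1 h3'
  push_cast at h4 h5
  have h6 : M.drift = 0 := by linarith
  rw [h6] at h4
  norm_num at h4

/-- The real exponential weight `e^{lτ + mζ}`. -/
def realWeight (l m : ℝ) (ω : Ω) : ℝ := Real.exp (l * M.τ ω + m * M.ζ ω)

lemma weight_ofReal (l m : ℝ) (ω : Ω) : M.weight l m ω = (M.realWeight l m ω : ℂ) := by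
  simp [weight, realWeight]

lemma measurable_realWeight (l m : ℝ) : Measurable (M.realWeight l m) := by
  have h1 : Measurable fun ω => (M.τ ω : ℝ) := measurable_from_nat.comp M.measurable_τ
  have h2 : Measurable fun ω => (M.ζ ω : ℝ) := measurable_from_nat.comp M.measurable_ζ
  unfold realWeight
  fun_prop

lemma norm_realWeight_le (l m : ℝ) (ω : Ω) :
    ‖M.realWeight l m ω‖ ≤ Real.exp ((|l| + |m|) * M.τ ω) := by
  have := M.norm_weight_le (l := l) (u := m) (t := |l| + |m|) le_rfl ω
  rwa [weight_ofReal, Complex.norm_real] at this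

/-- The deviation function `sup {lθ + mα : E e^{lτ + mζ} ≤ 1}` at `θ = 1`. -/
def deviation (α : ℝ) : ℝ :=
  sSup {x | ∃ l m : ℝ, ∫⁻ ω, ENNReal.ofReal (M.realWeight l m ω) ∂P ≤ 1 ∧ x = l * 1 + m * α}

lemma deviation_eq [IsProbabilityMeasure P] {l m b : ℝ} (hlm : |l| + |m| < M.s)
    (h1 : ∫ ω, M.realWeight l m ω ∂P = 1)
    (h2 : ∫ ω, (b * M.τ ω + M.ζ ω) * M.realWeight l m ω ∂P = 0) :
    M.deviation (-b) = l - m * b := by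
  have m1 : Measurable fun ω => (M.τ ω : ℝ) := measurable_from_nat.comp M.measurable_τ
  have m2 : Measurable fun ω => (M.ζ ω : ℝ) := measurable_from_nat.comp M.measurable_ζ
  have m3 := M.measurable_realWeight l m
  have hw : Integrable (M.realWeight l m) P := by
    refine (M.integrable_pow_mul_exp 0 hlm).mono' m3.aestronglyMeasurable
      (Eventually.of_forall fun ω => ?_)
    simpa using M.norm_realWeight_le l m ω
  have hτw : Integrable (fun ω => (M.τ ω : ℝ) * M.realWeight l m ω) P := by
    refine (M.integrable_pow_mul_exp 1 hlm).mono' (m1.mul m3).aestronglyMeasurable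
      (Eventually.of_forall fun ω => ?_)
    rw [norm_mul, pow_one, Real.norm_natCast]
    gcongr
    exact M.norm_realWeight_le l m ω
  have hζw : Integrable (fun ω => (M.ζ ω : ℝ) * M.realWeight l m ω) P := by
    refine hτw.mono' (m2.mul m3).aestronglyMeasurable (Eventually.of_forall fun ω => ?_)
    have h5 : (M.ζ ω : ℝ) ≤ M.τ ω := by exact_mod_cast M.ζ_le ω
    have h6 : 0 ≤ M.realWeight l m ω := (Real.exp_pos _).le
    rw [norm_mul, Real.norm_natCast, Real.norm_of_nonneg h6]
    gcongr
  have hpos : 0 < ∫ ω, (M.τ ω : ℝ) * M.realWeight l m ω ∂P := by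
    have hnn : ∀ ω, 0 ≤ (M.τ ω : ℝ) * M.realWeight l m ω := fun ω =>
      mul_nonneg (Nat.cast_nonneg _) (Real.exp_pos _).le
    refine (integral_nonneg hnn).lt_of_ne fun h => ?_
    have hz := (integral_eq_zero_iff_of_nonneg hnn hτw).1 h.symm
    obtain ⟨ω, h3, h4⟩ := (hz.and M.τ_pos).exists
    exact (mul_pos (Nat.cast_pos.2 h4) (Real.exp_pos (l * M.τ ω + m * M.ζ ω))).ne' h3
  refine IsGreatest.csSup_eq ⟨⟨l, m, ?_, by ring⟩, ?_⟩
  · rw [← ofReal_integral_eq_lintegral_ofReal hw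
      (Eventually.of_forall fun ω => (Real.exp_pos _).le), h1]
    simp
  · rintro x ⟨l', m', hle, rfl⟩
    have hw' : Integrable (M.realWeight l' m') P := by
      refine ⟨(M.measurable_realWeight l' m').aestronglyMeasurable, ?_⟩
      have hnn : 0 ≤ᵐ[P] M.realWeight l' m' := Eventually.of_forall fun ω => (Real.exp_pos _).le
      rw [hasFiniteIntegral_iff_ofReal hnn]
      exact hle.trans_lt ENNReal.one_lt_top
    have hle' : ∫ ω, M.realWeight l' m' ω ∂P ≤ 1 := by
      rw [← ofReal_integral_eq_lintegral_ofReal hw'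
        (Eventually.of_forall fun ω => (Real.exp_pos _).le)] at hle
      simpa using hle
    have hsl : Integrable (fun ω => (b * M.τ ω + M.ζ ω) * M.realWeight l m ω) P := by
      have := (hτw.const_mul b).add hζw
      refine this.congr (Eventually.of_forall fun ω => ?_)
      simp only [Pi.add_apply]
      ring
    have hcomp : ∫ ω, (M.realWeight l m ω +
        ((m' - m) * ((b * M.τ ω + M.ζ ω) * M.realWeight l m ω) +
        (l' - l - b * (m' - m)) * (M.τ ω * M.realWeight l m ω))) ∂P ≤
        ∫ ω, M.realWeight l' m' ω ∂P := by
      refine integral_mono (hw.add ((hsl.const_mul _).add (hτw.const_mul _))) hw' fun ω => ?_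
      have h3 : M.realWeight l' m' ω = M.realWeight l m ω *
          Real.exp ((l' - l) * M.τ ω + (m' - m) * M.ζ ω) := by
        rw [realWeight, realWeight, ← Real.exp_add]; ring_nf
      have h4 := Real.add_one_le_exp ((l' - l) * M.τ ω + (m' - m) * M.ζ ω)
      have h5 := mul_le_mul_of_nonneg_left h4 (Real.exp_pos (l * M.τ ω + m * M.ζ ω)).le
      change _ ≤ M.realWeight l' m' ω
      rw [h3]
      refine le_trans (le_of_eq ?_) h5
      change _ = M.realWeight l m ω * _
      ring
    rw [integral_add hw ((hsl.const_mul _).fun_add (hτw.const_mul _)),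
      integral_add (hsl.const_mul _) (hτw.const_mul _), integral_const_mul, integral_const_mul,
      h1, h2] at hcomp
    have h6 : l' - l - b * (m' - m) ≤ 0 := by
      by_contra! hcon
      have := mul_pos hcon hpos
      linarith
    linarith

/-- Along the branch the deviation function is the Legendre transform of `-λ`. -/
lemma eventually_deviation_eq [IsProbabilityMeasure P] {lam : ℂ → ℂ} (ha : AnalyticAt ℂ lam 0)
    (h0 : lam 0 = 0) (h1 : ∀ᶠ u in nhds 0, M.mgf (lam u) u = 1)
    (hr : ∀ᶠ μ : ℝ in nhds 0, (lam μ).im = 0) :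
    ∀ᶠ μ : ℝ in nhds 0,
      M.deviation (-(deriv lam μ).re) = (lam μ).re - μ * (deriv lam μ).re := by
  have ht : Tendsto (fun μ : ℝ => (μ : ℂ)) (nhds 0) (nhds 0) := by
    simpa using (Complex.continuous_ofReal.tendsto 0)
  obtain ⟨C, hC, hb⟩ := M.eventually_branch_bounds ha h0
  have hs := M.s_pos
  filter_upwards [ht.eventually hb, ht.eventually h1, hr, eventually_deriv_branch_im ha hr,
    ht.eventually (M.eventually_integral_slope_eq_zero ha h0 h1)] with μ hμ hμ1 hμ2 hμ3 hμ4
  have e1 : lam μ = ((lam μ).re : ℂ) := Complex.ext rfl (by simpa using hμ2)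
  have e2 : deriv lam μ = ((deriv lam μ).re : ℂ) := Complex.ext rfl (by simpa using hμ3)
  obtain ⟨-, -, -, -, h5⟩ := hμ
  refine M.deviation_eq (lt_of_le_of_lt (by simpa using h5) (by linarith)) ?_ ?_
  · rw [e1, mgf] at hμ1
    simp only [weight_ofReal] at hμ1
    rw [integral_complex_ofReal] at hμ1
    exact_mod_cast hμ1
  · rw [e1, e2] at hμ4
    have : ∀ ω, M.slope ((deriv lam μ).re : ℂ) ω * M.weight ((lam μ).re : ℂ) μ ω =
        ((((deriv lam μ).re * M.τ ω + M.ζ ω) * M.realWeight (lam μ).re μ ω : ℝ) : ℂ) := fun ω => by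
      rw [weight_ofReal, slope]; push_cast; ring
    simp only [this] at hμ4
    rw [integral_complex_ofReal] at hμ4
    exact_mod_cast hμ4

end RewardedSpan

lemma hasSum_of_forall_eq {f g : ℕ → ℂ} {c : ℂ} (h : HasSum g c) (e : ∀ n, f n = g n) :
    HasSum f c := by
  rwa [funext e]

/-- Cauchy's estimate for the coefficients of a power series. -/
lemma norm_coeff_le_of_hasSum {a : ℕ → ℂ} {F : ℂ → ℂ} {ρ K : ℝ} (hρ : 0 < ρ)
    (hF : DiffContOnCl ℂ F (Metric.ball 0 ρ)) (hK : ∀ z ∈ Metric.sphere (0 : ℂ) ρ, ‖F z‖ ≤ K)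
    (hs : ∀ᶠ z in nhds (0 : ℂ), HasSum (fun n => a n * z ^ n) (F z)) (n : ℕ) :
    ‖a n‖ ≤ K / ρ ^ n := by
  have h1 : HasFPowerSeriesAt F (FormalMultilinearSeries.ofScalars ℂ a) 0 := by
    rw [hasFPowerSeriesAt_iff]
    filter_upwards [hs] with z hz
    simpa [FormalMultilinearSeries.coeff_ofScalars, mul_comm] using hz
  have h2 : AnalyticAt ℂ F 0 :=
    hF.differentiableOn.analyticAt (Metric.ball_mem_nhds 0 hρ)
  have h3 := h1.eq_formalMultilinearSeries h2.hasFPowerSeriesAt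
  have h4 := congrArg (fun p : FormalMultilinearSeries ℂ ℂ ℂ => p.coeff n) h3
  simp only [FormalMultilinearSeries.coeff_ofScalars] at h4
  have h5 := Complex.norm_iteratedDeriv_le_of_forall_mem_sphere_norm_le n hρ hF hK
  have h6 : (0 : ℝ) < n.factorial := by exact_mod_cast n.factorial_pos
  rw [h4, norm_div, Complex.norm_natCast, div_le_iff₀ h6]
  refine h5.trans (le_of_eq ?_)
  ring

/-- The generating function of a sequence. -/
def genFun (a : ℕ → ℂ) (z : ℂ) : ℂ := ∑' n, a n * z ^ n

section genFun

variable {a : ℕ → ℂ} {B R ρ : ℝ}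

lemma norm_mul_pow_le (ha : ∀ n, ‖a n‖ ≤ B / R ^ n) {z : ℂ} (hz : ‖z‖ ≤ ρ) (n : ℕ) :
    ‖a n * z ^ n‖ ≤ B * (ρ / R) ^ n := by
  rw [norm_mul, norm_pow]
  calc ‖a n‖ * ‖z‖ ^ n ≤ B / R ^ n * ρ ^ n := by
        gcongr
        · exact (norm_nonneg _).trans (ha n)
        · exact ha n
    _ = B * (ρ / R) ^ n := by rw [div_pow]; ring

lemma summable_geometric_ratio (hR : 0 < R) (h0 : 0 ≤ ρ) (h1 : ρ < R) :
    Summable fun n => B * (ρ / R) ^ n :=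
  (summable_geometric_of_lt_one (by positivity) ((div_lt_one hR).2 h1)).mul_left B

lemma summable_norm_mul_pow (hR : 0 < R) (ha : ∀ n, ‖a n‖ ≤ B / R ^ n) {z : ℂ} (hz : ‖z‖ < R) :
    Summable fun n => ‖a n * z ^ n‖ :=
  (summable_geometric_ratio hR (norm_nonneg z) hz).of_nonneg_of_le (fun _ => norm_nonneg _)
    fun n => norm_mul_pow_le ha le_rfl n

lemma hasSum_genFun (hR : 0 < R) (ha : ∀ n, ‖a n‖ ≤ B / R ^ n) {z : ℂ} (hz : ‖z‖ < R) :
    HasSum (fun n => a n * z ^ n) (genFun a z) :=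
  (summable_norm_mul_pow hR ha hz).of_norm.hasSum

lemma norm_genFun_le (hR : 0 < R) (ha : ∀ n, ‖a n‖ ≤ B / R ^ n) (hρ : ρ < R) {z : ℂ}
    (hz : ‖z‖ ≤ ρ) : ‖genFun a z‖ ≤ B * (1 - ρ / R)⁻¹ := by
  have h0 : 0 ≤ ρ := (norm_nonneg z).trans hz
  have h := (hasSum_geometric_of_lt_one (by positivity) ((div_lt_one hR).2 hρ)).mul_left B
  exact tsum_of_norm_bounded h fun n => norm_mul_pow_le ha hz n

lemma differentiableOn_genFun (hR : 0 < R) (ha : ∀ n, ‖a n‖ ≤ B / R ^ n) :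
    DifferentiableOn ℂ (genFun a) (Metric.ball 0 R) := by
  intro z hz
  rw [mem_ball_zero_iff] at hz
  obtain ⟨ρ, h1, h2⟩ := exists_between hz
  refine DifferentiableAt.differentiableWithinAt ?_
  have h0 : 0 ≤ ρ := (norm_nonneg z).trans h1.le
  refine (Complex.differentiableOn_tsum_of_summable_norm
      (summable_geometric_ratio (B := B) hR h0 h2)
    (fun n => ?_) Metric.isOpen_ball (U := Metric.ball 0 ρ) fun n w hw => ?_).differentiableAt
      (Metric.isOpen_ball.mem_nhds (by simpa using h1))
  · fun_prop
  · exact norm_mul_pow_le ha (mem_ball_zero_iff.1 hw).le n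

end genFun

/-- A pair of renewal equations with exponentially small forcing terms and increments. -/
structure IsDelayedRenewal (B R : ℝ) (g g₀ h h₀ f₁ f : ℕ → ℂ) : Prop where
  norm_g_le : ∀ n, ‖g n‖ ≤ 1 / R⁻¹ ^ n
  norm_g₀_le : ∀ n, ‖g₀ n‖ ≤ 1 / R⁻¹ ^ n
  norm_h_le : ∀ n, ‖h n‖ ≤ B / R ^ n
  norm_h₀_le : ∀ n, ‖h₀ n‖ ≤ B / R ^ n
  norm_f₁_le : ∀ n, ‖f₁ n‖ ≤ B / R ^ n
  norm_f_le : ∀ n, ‖f n‖ ≤ B / R ^ n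
  g_eq : ∀ n, g n = h n + ∑ ij ∈ Finset.HasAntidiagonal.antidiagonal n, f₁ ij.1 * g₀ ij.2
  g₀_eq : ∀ n, g₀ n = h₀ n + ∑ ij ∈ Finset.HasAntidiagonal.antidiagonal n, f ij.1 * g₀ ij.2

namespace IsDelayedRenewal

variable {B R : ℝ} {g g₀ h h₀ f₁ f : ℕ → ℂ}

lemma genFun_conv {a b : ℕ → ℂ} {z : ℂ} (ha : Summable fun n => ‖a n * z ^ n‖)
    (hb : Summable fun n => ‖b n * z ^ n‖) :
    HasSum (fun n => (∑ ij ∈ Finset.HasAntidiagonal.antidiagonal n, a ij.1 * b ij.2) * z ^ n)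
      (genFun a z * genFun b z) := by
  have h1 := tsum_mul_tsum_eq_tsum_sum_antidiagonal_of_summable_norm ha hb
  have h2 := (summable_norm_sum_mul_antidiagonal_of_summable_norm ha hb).of_norm.hasSum
  rw [← h1] at h2
  refine hasSum_of_forall_eq h2 fun n => ?_
  rw [Finset.sum_mul]
  refine Finset.sum_congr rfl fun ij hij => ?_
  rw [← Finset.HasAntidiagonal.mem_antidiagonal.1 hij, pow_add]
  ring

/-- If `1 - f(z) = (e₀ + e₁ z) q(z)` with `q` bounded below on a disc of radius `ρ`, then the
combination `e₀ g (n+1) + e₁ g n` decays like `ρ^{-n}`. -/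
lemma norm_combination_le (D : IsDelayedRenewal B R g g₀ h h₀ f₁ f) (hB : 0 ≤ B) (hR : 1 < R)
    {ρ r c : ℝ} (hρ : 0 < ρ) (hρr : ρ < r) (hrR : r ≤ R) (hc : 0 < c) {e₀ e₁ : ℂ} {q : ℂ → ℂ}
    (hq : DifferentiableOn ℂ q (Metric.ball 0 r))
    (hqc : ∀ z, ‖z‖ ≤ ρ → c ≤ ‖q z‖)
    (hfq : ∀ z, ‖z‖ < r → 1 - genFun f z = (e₀ + e₁ * z) * q z) (n : ℕ) :
    ‖e₀ * g (n + 1) + e₁ * g n‖ ≤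
      ((‖e₀‖ + ‖e₁‖ * ρ) * (B * (1 - ρ / R)⁻¹) + (B * (1 - ρ / R)⁻¹) ^ 2 / c) / ρ ^ (n + 1) := by
  have hR0 : 0 < R := by linarith
  have hρR : ρ < R := hρr.trans_le hrR
  set F : ℂ → ℂ := fun z => (e₀ + e₁ * z) * genFun h z + genFun f₁ z * genFun h₀ z / q z
  set b : ℕ → ℂ := fun n => e₀ * g n + e₁ * (if n = 0 then 0 else g (n - 1))
  have hsub' : Metric.closedBall (0 : ℂ) ρ ⊆ Metric.ball 0 r := Metric.closedBall_subset_ball hρr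
  have hsub : Metric.closedBall (0 : ℂ) ρ ⊆ Metric.ball 0 R :=
    Metric.closedBall_subset_ball hρR
  have hq0 : ∀ z, ‖z‖ ≤ ρ → q z ≠ 0 := fun z hz h => by
    have := hqc z hz; rw [h, norm_zero] at this; linarith
  have hdF : DifferentiableOn ℂ F (Metric.closedBall 0 ρ) := by
    have d1 := (differentiableOn_genFun hR0 D.norm_h_le).mono hsub
    have d2 := (differentiableOn_genFun hR0 D.norm_h₀_le).mono hsub
    have d3 := (differentiableOn_genFun hR0 D.norm_f₁_le).mono hsub
    have d4 := hq.mono hsub'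
    exact (DifferentiableOn.mul (by fun_prop) d1).fun_add
      ((d3.mul d2).div d4 fun z hz => hq0 z (mem_closedBall_zero_iff.1 hz))
  have hdc : DiffContOnCl ℂ F (Metric.ball 0 ρ) := by
    refine ⟨hdF.mono Metric.ball_subset_closedBall, ?_⟩
    rw [closure_ball _ hρ.ne']
    exact hdF.continuousOn
  have hbd : ∀ z ∈ Metric.sphere (0 : ℂ) ρ, ‖F z‖ ≤
      (‖e₀‖ + ‖e₁‖ * ρ) * (B * (1 - ρ / R)⁻¹) + (B * (1 - ρ / R)⁻¹) ^ 2 / c := fun z hz => by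
    have hz' : ‖z‖ = ρ := mem_sphere_zero_iff_norm.1 hz
    refine (norm_add_le _ _).trans (add_le_add ?_ ?_)
    · rw [norm_mul]
      gcongr
      · exact (norm_add_le _ _).trans (by rw [norm_mul, hz'])
      · exact norm_genFun_le hR0 D.norm_h_le hρR hz'.le
    · rw [norm_div, norm_mul, sq]
      have := sub_pos.2 ((div_lt_one hR0).2 hρR)
      gcongr
      · exact norm_genFun_le hR0 D.norm_f₁_le hρR hz'.le
      · exact norm_genFun_le hR0 D.norm_h₀_le hρR hz'.le
      · exact hqc z hz'.le
  have hev : ∀ᶠ z in nhds (0 : ℂ), HasSum (fun n => b n * z ^ n) (F z) := by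
    have hR1 : 0 < R⁻¹ := inv_pos.2 hR0
    have hR2 : R⁻¹ < R := (inv_lt_one_of_one_lt₀ hR).trans hR
    filter_upwards [Metric.ball_mem_nhds (0 : ℂ) hR1, Metric.ball_mem_nhds (0 : ℂ) hρ]
      with z hz hzρ
    rw [mem_ball_zero_iff] at hz hzρ
    have sg := hasSum_genFun hR1 D.norm_g_le hz
    have sh := hasSum_genFun hR0 D.norm_h_le (hz.trans hR2)
    have sh₀ := hasSum_genFun hR0 D.norm_h₀_le (hz.trans hR2)
    have n0 := summable_norm_mul_pow hR1 D.norm_g₀_le hz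
    have sg₀ := hasSum_genFun hR1 D.norm_g₀_le hz
    have c1 := genFun_conv (summable_norm_mul_pow hR0 D.norm_f₁_le (hz.trans hR2)) n0
    have c2 := genFun_conv (summable_norm_mul_pow hR0 D.norm_f_le (hz.trans hR2)) n0
    have i1 : genFun g z = genFun h z + genFun f₁ z * genFun g₀ z := by
      refine sg.unique ?_
      refine hasSum_of_forall_eq (sh.add c1) fun n => ?_
      rw [D.g_eq, add_mul]
    have i2 : genFun g₀ z = genFun h₀ z + genFun f z * genFun g₀ z := by
      refine sg₀.unique ?_
      refine hasSum_of_forall_eq (sh₀.add c2) fun n => ?_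
      rw [D.g₀_eq, add_mul]
    have i3 : (e₀ + e₁ * z) * genFun g z = F z := by
      have h3 := hfq z (hzρ.trans hρr)
      have h4 := hq0 z hzρ.le
      have h5 : (e₀ + e₁ * z) * genFun g₀ z = genFun h₀ z / q z := by
        rw [eq_div_iff h4]
        linear_combination i2 - genFun g₀ z * h3
      simp only [F]
      rw [i1]
      linear_combination genFun f₁ z * h5
    rw [← i3, add_mul]
    have s1 : HasSum (fun n => (if n = 0 then 0 else g (n - 1)) * z ^ n) (z * genFun g z) := by
      rw [hasSum_nat_add_iff' 1 |>.symm]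
      simp only [Finset.range_one, Finset.sum_singleton, if_pos, zero_mul, sub_zero]
      refine hasSum_of_forall_eq (sg.mul_left z) fun n => ?_
      rw [if_neg n.succ_ne_zero, Nat.add_sub_cancel, pow_succ]
      ring
    have := (sg.mul_left e₀).add (s1.mul_left e₁)
    rw [← mul_assoc] at this
    refine hasSum_of_forall_eq this fun n => ?_
    simp only [b]
    ring
  simpa [b] using norm_coeff_le_of_hasSum hρ hdc hbd hev (n + 1)

end IsDelayedRenewal

/-- A continuous function without zeros on the unit disc over a compact set `A` of parameters is
bounded below on a larger disc over a neighbourhood of `A`. -/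
lemma exists_lower_bound_near {X : Type} [PseudoMetricSpace X] {S A : Set X} {r : ℝ} (hr : 1 < r)
    (hS : IsCompact S) (hA : IsCompact A) (hAS : A ⊆ S) {q : ℂ × X → ℂ}
    (hq : ContinuousOn q (Metric.closedBall 0 r ×ˢ S))
    (hq0 : ∀ z, ‖z‖ ≤ 1 → ∀ x ∈ A, q (z, x) ≠ 0) :
    ∃ ρ δ c : ℝ, 1 < ρ ∧ ρ < r ∧ 0 < δ ∧ 0 < c ∧
      ∀ z, ‖z‖ ≤ ρ → ∀ x ∈ S, ∀ y ∈ A, dist x y < δ → c ≤ ‖q (z, x)‖ := by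
  have hK : IsCompact (Metric.closedBall (0 : ℂ) r ×ˢ S) := (isCompact_closedBall 0 r).prod hS
  have hK1 : IsCompact (Metric.closedBall (0 : ℂ) 1 ×ˢ A) := (isCompact_closedBall 0 1).prod hA
  have hsub : Metric.closedBall (0 : ℂ) 1 ×ˢ A ⊆ Metric.closedBall (0 : ℂ) r ×ˢ S :=
    Set.prod_mono (Metric.closedBall_subset_closedBall hr.le) hAS
  obtain ⟨m, hm, hmin⟩ : ∃ m > 0, ∀ p ∈ Metric.closedBall (0 : ℂ) 1 ×ˢ A, m ≤ ‖q p‖ := by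
    refine hK1.exists_forall_le' (hq.mono hsub).norm (a := 0) fun p hp => ?_
    exact norm_pos_iff.2 (hq0 p.1 (mem_closedBall_zero_iff.1 hp.1) p.2 hp.2)
  obtain ⟨δ, hδ, hunif⟩ := Metric.uniformContinuousOn_iff.1
    (hK.uniformContinuousOn_of_continuous hq) (m / 2) (by positivity)
  refine ⟨1 + min (δ / 2) ((r - 1) / 2), δ, m / 2, ?_, ?_, hδ, by positivity, ?_⟩
  · have : 0 < min (δ / 2) ((r - 1) / 2) := lt_min (by linarith) (by linarith)
    linarith
  · linarith [min_le_right (δ / 2) ((r - 1) / 2)]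
  · intro z hz x hx y hy hxy
    have h1 : 1 ≤ max 1 ‖z‖ := le_max_left _ _
    set z' : ℂ := z / (max 1 ‖z‖ : ℝ)
    have hz' : ‖z'‖ ≤ 1 := by
      rw [norm_div, Complex.norm_real, Real.norm_of_nonneg (by linarith)]
      exact (div_le_one (by linarith)).2 (le_max_right _ _)
    have hzz : dist z z' < δ := by
      have e : z - z' = z' * ((max 1 ‖z‖ - 1 : ℝ) : ℂ) := by
        have : ((max 1 ‖z‖ : ℝ) : ℂ) ≠ 0 := by
          exact_mod_cast (by linarith : (0:ℝ) < max 1 ‖z‖).ne'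
        simp only [z']
        push_cast at this ⊢
        field_simp
      rw [dist_eq_norm, e, norm_mul, Complex.norm_real, Real.norm_of_nonneg (by linarith)]
      have h2 : max 1 ‖z‖ - 1 ≤ δ / 2 := by
        have := min_le_left (δ / 2) ((r - 1) / 2)
        have : max 1 ‖z‖ ≤ 1 + δ / 2 := max_le (by linarith) (by linarith)
        linarith
      nlinarith [norm_nonneg z']
    have hzr : ‖z‖ ≤ r := by linarith [min_le_right (δ / 2) ((r - 1) / 2)]
    have h3 := hunif (z, x) ⟨mem_closedBall_zero_iff.2 hzr, hx⟩ (z', y)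
      ⟨mem_closedBall_zero_iff.2 (hz'.trans hr.le), hAS hy⟩
      (by simpa [Prod.dist_eq] using ⟨hzz, hxy⟩)
    have h4 := hmin (z', y) ⟨mem_closedBall_zero_iff.2 hz', hy⟩
    have h5 := norm_sub_norm_le (q (z', y)) (q (z, x))
    rw [dist_comm, dist_eq_norm] at h3
    linarith

namespace RewardedSpan

variable {Ω : Type} [MeasurableSpace Ω] {P : Measure Ω} (M : RewardedSpan P)

lemma measurableSet_τ_eq (k : ℕ) : MeasurableSet {ω | M.τ ω = k} :=
  M.measurable_τ (measurableSet_singleton k)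

lemma hasSum_setIntegral_τ {F : Ω → ℂ} (hF : Integrable F P) :
    HasSum (fun k : ℕ => ∫ ω in {ω | M.τ ω = k}, F ω ∂P) (∫ ω, F ω ∂P) := by
  have hU : ⋃ k : ℕ, {ω | M.τ ω = k} = Set.univ := by
    ext ω; simp
  have := hasSum_integral_iUnion (μ := P) (f := F) (s := fun k : ℕ => {ω | M.τ ω = k})
    M.measurableSet_τ_eq (fun i j hij => Set.disjoint_left.2 fun ω h1 h2 => hij (h1.symm.trans h2))
    (by rw [hU]; exact hF.integrableOn)
  rwa [hU, setIntegral_univ] at this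

/-- The coefficient `E[e^{uζ}; τ = k]`. -/
def coeff (k : ℕ) (u : ℂ) : ℂ := ∫ ω in {ω | M.τ ω = k}, Complex.exp (u * M.ζ ω) ∂P

lemma measurable_exp_ζ (u : ℂ) : Measurable fun ω => Complex.exp (u * M.ζ ω) := by
  have h2 : Measurable fun ω => (M.ζ ω : ℂ) := measurable_from_nat.comp M.measurable_ζ
  fun_prop

lemma norm_exp_ζ_le {k : ℕ} {ω : Ω} (h : M.τ ω = k) (u : ℂ) :
    ‖Complex.exp (u * M.ζ ω)‖ ≤ Real.exp (k * |u.re|) := by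
  have h1 : (M.ζ ω : ℝ) ≤ k := by exact_mod_cast h ▸ M.ζ_le ω
  rw [Complex.norm_exp]
  refine Real.exp_le_exp.2 ?_
  have : (u * M.ζ ω).re = u.re * M.ζ ω := by simp
  rw [this]
  have h2 : (0 : ℝ) ≤ M.ζ ω := Nat.cast_nonneg _
  nlinarith [le_abs_self u.re, abs_nonneg u.re]

lemma continuous_coeff [IsFiniteMeasure P] (k : ℕ) : Continuous (M.coeff k) := by
  refine continuous_iff_continuousAt.2 fun u₀ => ?_
  refine continuousAt_of_dominated (bound := fun _ => Real.exp (k * (|u₀.re| + 1)))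
    (Eventually.of_forall fun u => (M.measurable_exp_ζ u).aestronglyMeasurable) ?_
    (integrable_const _) (Eventually.of_forall fun ω => by fun_prop)
  have h1 : ∀ᶠ u : ℂ in nhds u₀, |u.re| < |u₀.re| + 1 := by
    have : ContinuousAt (fun u : ℂ => |u.re|) u₀ := by fun_prop
    exact this.eventually (Iio_mem_nhds (by simp))
  filter_upwards [h1] with u hu
  filter_upwards [ae_restrict_mem (M.measurableSet_τ_eq k)] with ω hω
  exact (M.norm_exp_ζ_le hω u).trans (Real.exp_le_exp.2 (by gcongr))

/-- The exponential moment of the span. -/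
def expMoment : ℝ := ∫ ω, Real.exp (M.s * M.τ ω) ∂P

lemma norm_coeff_le [IsFiniteMeasure P] (k : ℕ) (u : ℂ) :
    ‖M.coeff k u‖ ≤ M.expMoment * Real.exp (-(M.s * k)) * Real.exp (k * |u.re|) := by
  have h1 : ‖M.coeff k u‖ ≤ ∫ ω in {ω | M.τ ω = k},
      Real.exp (-(M.s * k)) * Real.exp (k * |u.re|) * Real.exp (M.s * M.τ ω) ∂P := by
    refine norm_integral_le_of_norm_le (M.integrable_exp.const_mul _).integrableOn ?_
    filter_upwards [ae_restrict_mem (M.measurableSet_τ_eq k)] with ω hω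
    refine (M.norm_exp_ζ_le hω u).trans (le_of_eq ?_)
    rw [show M.τ ω = k from hω, mul_right_comm, ← Real.exp_add]
    simp
  refine h1.trans ?_
  rw [integral_const_mul, mul_assoc M.expMoment, mul_comm M.expMoment]
  refine mul_le_mul_of_nonneg_left ?_ (mul_pos (Real.exp_pos _) (Real.exp_pos _)).le
  exact setIntegral_le_integral M.integrable_exp (Eventually.of_forall fun ω => (Real.exp_pos _).le)

lemma hasSum_coeff_exp {l u : ℂ} (h : |l.re| + |u.re| < M.s) :
    HasSum (fun k : ℕ => Complex.exp (l * k) * M.coeff k u) (M.mgf l u) := by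
  refine hasSum_of_forall_eq (M.hasSum_setIntegral_τ (M.integrable_weight h)) fun k => ?_
  rw [coeff, ← integral_const_mul]
  refine setIntegral_congr_fun (M.measurableSet_τ_eq k) fun ω hω => ?_
  simp only [weight]
  rw [show M.τ ω = k from hω, Complex.exp_add]

lemma integrable_pow_τ_mul [IsFiniteMeasure P] {z u : ℂ} (hz : ‖z‖ ≤ 1) (hu : u.re = 0) :
    Integrable (fun ω => z ^ M.τ ω * Complex.exp (u * M.ζ ω)) P := by
  refine (integrable_const (1 : ℝ)).mono' ?_ (Eventually.of_forall fun ω => ?_)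
  · have : Measurable fun ω => z ^ M.τ ω :=
      (measurable_from_nat (f := fun n => z ^ n)).comp M.measurable_τ
    exact (this.mul (M.measurable_exp_ζ u)).aestronglyMeasurable
  · rw [norm_mul, norm_pow, Complex.norm_exp]
    simpa [hu] using pow_le_one₀ (norm_nonneg z) hz

lemma genFun_coeff [IsFiniteMeasure P] {z u : ℂ} (hz : ‖z‖ ≤ 1) (hu : u.re = 0) :
    genFun (fun k => M.coeff k u) z = ∫ ω, z ^ M.τ ω * Complex.exp (u * M.ζ ω) ∂P := by
  refine HasSum.tsum_eq (hasSum_of_forall_eq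
    (M.hasSum_setIntegral_τ (M.integrable_pow_τ_mul hz hu)) fun k => ?_)
  change M.coeff k u * z ^ k = _
  rw [mul_comm, coeff, ← integral_const_mul]
  refine setIntegral_congr_fun (M.measurableSet_τ_eq k) fun ω hω => ?_
  change z ^ k * _ = z ^ M.τ ω * _
  rw [show M.τ ω = k from hω]

/-- The generating function takes the value one on the unit disc only at the trivial point. -/
lemma eq_one_of_genFun_coeff_eq_one [IsProbabilityMeasure P] {z u : ℂ} (hz : ‖z‖ ≤ 1)
    (hu : u.re = 0) (h : genFun (fun k => M.coeff k u) z = 1) : z = 1 ∧ Complex.exp u = 1 := by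
  rw [M.genFun_coeff hz hu] at h
  set F : Ω → ℂ := fun ω => z ^ M.τ ω * Complex.exp (u * M.ζ ω)
  have hF : Integrable F P := M.integrable_pow_τ_mul hz hu
  have hn : ∀ ω, ‖F ω‖ ≤ 1 := fun ω => by
    rw [norm_mul, norm_pow, Complex.norm_exp]
    simpa [hu] using pow_le_one₀ (norm_nonneg z) hz
  have hre : ∫ ω, (1 - (F ω).re) ∂P = 0 := by
    have h3 : ∫ ω, (F ω).re ∂P = (∫ ω, F ω ∂P).re := integral_re hF
    have h4 : Integrable (fun ω => (F ω).re) P := hF.re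
    rw [integral_sub (integrable_const _) h4, h3, h]
    simp
  have hz := (integral_eq_zero_iff_of_nonneg
    (fun ω => sub_nonneg.2 ((Complex.re_le_norm _).trans (hn ω)))
    ((integrable_const _).sub hF.re)).1 hre
  have hone : ∀ᵐ ω ∂P, F ω = 1 := by
    filter_upwards [hz] with ω hω
    have h1 : (F ω).re = 1 := by
      have : 1 - (F ω).re = 0 := hω
      linarith
    have h2 := hn ω
    have h3 : (F ω).im = 0 := by
      have h4 : ‖F ω‖ ^ 2 ≤ 1 := pow_le_one₀ (norm_nonneg _) h2
      rw [Complex.sq_norm, Complex.normSq_apply, h1] at h4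
      nlinarith
    exact Complex.ext (by simpa using h1) (by simpa using h3)
  have e1 : ∃ ω, (M.τ ω = M.m ∧ M.ζ ω = 1) ∧ F ω = 1 := by
    by_contra! hcon
    exact M.pos_m (measure_mono_null (fun ω hω => hcon ω hω) (ae_iff.1 hone))
  have e2 : ∃ ω, (M.τ ω = M.m + 1 ∧ M.ζ ω = 1) ∧ F ω = 1 := by
    by_contra! hcon
    exact M.pos_m_succ (measure_mono_null (fun ω hω => hcon ω hω) (ae_iff.1 hone))
  obtain ⟨ω, ⟨a1, a2⟩, a3⟩ := e1
  obtain ⟨ω', ⟨b1, b2⟩, b3⟩ := e2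
  simp only [F, a1, a2, b1, b2, Nat.cast_one, mul_one] at a3 b3
  have hz1 : z = 1 := by
    rw [pow_succ] at b3
    linear_combination b3 - z * a3
  refine ⟨hz1, ?_⟩
  rwa [hz1, one_pow, one_mul] at a3

end RewardedSpan

/-- Moment generating functions `G n u` of a counting process which regenerates along the spans
of `M`, together with the data of the two renewal equations that they satisfy. -/
structure RenewalFamily {Ω : Type} [MeasurableSpace Ω] {P : Measure Ω} (M : RewardedSpan P) where
  /-- the distribution of the counting process at time `n` -/
  prob : ℕ → ℕ → ℝ
  sum_prob : ∀ n, ∑ j ∈ Finset.range (n + 1), prob n j = 1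
  prob_nonneg : ∀ n j, 0 ≤ prob n j
  prob_eq_zero : ∀ n j, n < j → prob n j = 0
  G₀ : ℕ → ℂ → ℂ
  H : ℕ → ℂ → ℂ
  H₀ : ℕ → ℂ → ℂ
  F₁ : ℕ → ℂ → ℂ
  C : ℝ
  norm_G₀_le : ∀ n u, ‖G₀ n u‖ ≤ Real.exp (n * |u.re|)
  norm_H_le : ∀ n u, ‖H n u‖ ≤ C * Real.exp (-(M.s * n)) * Real.exp (n * |u.re|)
  norm_H₀_le : ∀ n u, ‖H₀ n u‖ ≤ C * Real.exp (-(M.s * n)) * Real.exp (n * |u.re|)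
  norm_F₁_le : ∀ n u, ‖F₁ n u‖ ≤ C * Real.exp (-(M.s * n)) * Real.exp (n * |u.re|)
  G_eq : ∀ n u, ∑ j ∈ Finset.range (n + 1), prob n j * Complex.exp (u * j) = H n u +
    ∑ ij ∈ Finset.HasAntidiagonal.antidiagonal n, F₁ ij.1 u * G₀ ij.2 u
  G₀_eq : ∀ n u, G₀ n u = H₀ n u +
    ∑ ij ∈ Finset.HasAntidiagonal.antidiagonal n, M.coeff ij.1 u * G₀ ij.2 u

namespace RenewalFamily

variable {Ω : Type} [MeasurableSpace Ω] {P : Measure Ω} {M : RewardedSpan P} (N : RenewalFamily M)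

/-- The moment generating function of the counting process. -/
def G (n : ℕ) (u : ℂ) : ℂ := ∑ j ∈ Finset.range (n + 1), N.prob n j * Complex.exp (u * j)

lemma continuous_G (n : ℕ) : Continuous (N.G n) := by
  unfold G; fun_prop

lemma G_zero (n : ℕ) : N.G n 0 = 1 := by
  simp only [G, zero_mul, Complex.exp_zero, mul_one]
  exact_mod_cast N.sum_prob n

lemma norm_G_le (n : ℕ) (u : ℂ) : ‖N.G n u‖ ≤ Real.exp (n * |u.re|) := by
  rw [← one_mul (Real.exp _), ← N.sum_prob n, Finset.sum_mul]
  refine norm_sum_le_of_le _ fun j hj => ?_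
  rw [norm_mul, Complex.norm_real, Real.norm_of_nonneg (N.prob_nonneg n j), Complex.norm_exp]
  refine mul_le_mul_of_nonneg_left (Real.exp_le_exp.2 ?_) (N.prob_nonneg n j)
  have h1 : (j : ℝ) ≤ n := by exact_mod_cast Nat.lt_succ_iff.1 (Finset.mem_range.1 hj)
  have : (u * j).re = u.re * j := by simp
  rw [this]
  have h2 : (0 : ℝ) ≤ j := Nat.cast_nonneg _
  nlinarith [le_abs_self u.re, abs_nonneg u.re]

/-- A common constant in the exponential bounds. -/
def bound : ℝ := max N.C M.expMoment

lemma bound_nonneg : 0 ≤ N.bound :=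
  le_max_of_le_right (integral_nonneg fun _ => (Real.exp_pos _).le)

lemma norm_exp_mul_le {l u : ℂ} (h : |l.re| + |u.re| ≤ M.s / 2) {n : ℕ} {w : ℂ} {c : ℝ}
    (hc : c ≤ N.bound) (hw : ‖w‖ ≤ c * Real.exp (-(M.s * n)) * Real.exp (n * |u.re|)) :
    ‖Complex.exp (l * n) * w‖ ≤ N.bound / Real.exp (M.s / 2) ^ n := by
  rw [norm_mul, Complex.norm_exp]
  have e1 : (l * n).re ≤ n * |l.re| := by
    have : (l * n).re = n * l.re := by simp [mul_comm]
    rw [this]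
    gcongr
    exact le_abs_self _
  have e2 : N.bound / Real.exp (M.s / 2) ^ n = N.bound * Real.exp (-(n * (M.s / 2))) := by
    rw [← Real.exp_nat_mul, Real.exp_neg]; rfl
  calc Real.exp (l * n).re * ‖w‖
      ≤ Real.exp (n * |l.re|) * (N.bound * Real.exp (-(M.s * n)) * Real.exp (n * |u.re|)) := by
        gcongr
        exact hw.trans (by gcongr)
    _ = N.bound * Real.exp (n * |l.re| + (-(M.s * n)) + n * |u.re|) := by
        rw [Real.exp_add, Real.exp_add]; ring
    _ ≤ N.bound * Real.exp (-(n * (M.s / 2))) := by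
        have := N.bound_nonneg
        gcongr
        have h3 : (0 : ℝ) ≤ n := Nat.cast_nonneg _
        nlinarith
    _ = _ := e2.symm

lemma norm_exp_mul_le_of_le_exp {l u : ℂ} (h : |l.re| + |u.re| ≤ M.s / 2) {n : ℕ} {w : ℂ}
    (hw : ‖w‖ ≤ Real.exp (n * |u.re|)) :
    ‖Complex.exp (l * n) * w‖ ≤ 1 / (Real.exp (M.s / 2))⁻¹ ^ n := by
  rw [norm_mul, Complex.norm_exp, inv_pow, one_div, inv_inv, ← Real.exp_nat_mul]
  have e1 : (l * n).re ≤ n * |l.re| := by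
    have : (l * n).re = n * l.re := by simp [mul_comm]
    rw [this]
    gcongr
    exact le_abs_self _
  calc Real.exp (l * n).re * ‖w‖ ≤ Real.exp (n * |l.re|) * Real.exp (n * |u.re|) := by gcongr
    _ = Real.exp (n * (|l.re| + |u.re|)) := by rw [← Real.exp_add]; ring_nf
    _ ≤ _ := by gcongr

lemma exp_mul_sum_antidiagonal (l : ℂ) (x y : ℕ → ℂ) (n : ℕ) :
    Complex.exp (l * n) * ∑ ij ∈ Finset.HasAntidiagonal.antidiagonal n, x ij.1 * y ij.2 =
    ∑ ij ∈ Finset.HasAntidiagonal.antidiagonal n,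
      (Complex.exp (l * (ij.1 : ℕ)) * x ij.1) * (Complex.exp (l * (ij.2 : ℕ)) * y ij.2) := by
  rw [Finset.mul_sum]
  refine Finset.sum_congr rfl fun ij hij => ?_
  rw [← Finset.HasAntidiagonal.mem_antidiagonal.1 hij]
  push_cast
  rw [mul_add, Complex.exp_add]
  ring

lemma isDelayedRenewal [IsFiniteMeasure P] {l u : ℂ} (h : |l.re| + |u.re| ≤ M.s / 2) :
    IsDelayedRenewal N.bound (Real.exp (M.s / 2)) (fun n => Complex.exp (l * n) * N.G n u)
      (fun n => Complex.exp (l * n) * N.G₀ n u) (fun n => Complex.exp (l * n) * N.H n u)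
      (fun n => Complex.exp (l * n) * N.H₀ n u) (fun n => Complex.exp (l * n) * N.F₁ n u)
      (fun n => Complex.exp (l * n) * M.coeff n u) where
  norm_g_le n := norm_exp_mul_le_of_le_exp h (N.norm_G_le n u)
  norm_g₀_le n := norm_exp_mul_le_of_le_exp h (N.norm_G₀_le n u)
  norm_h_le n := N.norm_exp_mul_le h (le_max_left _ _) (N.norm_H_le n u)
  norm_h₀_le n := N.norm_exp_mul_le h (le_max_left _ _) (N.norm_H₀_le n u)
  norm_f₁_le n := N.norm_exp_mul_le h (le_max_left _ _) (N.norm_F₁_le n u)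
  norm_f_le n := N.norm_exp_mul_le h (le_max_right _ _) (M.norm_coeff_le n u)
  g_eq n := by
    rw [G, N.G_eq, mul_add, exp_mul_sum_antidiagonal l (fun i => N.F₁ i u) (fun i => N.G₀ i u)]
  g₀_eq n := by
    rw [N.G₀_eq, mul_add, exp_mul_sum_antidiagonal l (fun i => M.coeff i u) (fun i => N.G₀ i u)]

lemma one_lt_exp_half : 1 < Real.exp (M.s / 2) := by
  have := M.s_pos
  rw [Real.one_lt_exp_iff]; linarith

/-- Away from the origin the moment generating functions decay exponentially. -/
lemma exists_norm_G_le [IsProbabilityMeasure P] {θ₀ : ℝ} (hθ : 0 < θ₀) :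
    ∃ μ₀ κ K : ℝ, 0 < μ₀ ∧ 0 < κ ∧ κ < 1 ∧ ∀ u : ℂ, |u.re| ≤ μ₀ → θ₀ ≤ |u.im| → |u.im| ≤ Real.pi →
      ∀ n, ‖N.G (n + 1) u‖ ≤ K * κ ^ (n + 1) := by
  have hs := M.s_pos
  set R := Real.exp (M.s / 2) with hRdef
  have hR : 1 < R := one_lt_exp_half
  obtain ⟨r, hr1, hrR⟩ := exists_between hR
  set S : Set ℂ := Set.Icc (-(M.s / 2)) (M.s / 2) ×ℂ (Set.Icc (-Real.pi) Real.pi ∩ {y | θ₀ ≤ |y|})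
  set A : Set ℂ := {0} ×ℂ (Set.Icc (-Real.pi) Real.pi ∩ {y | θ₀ ≤ |y|})
  have hI : IsCompact (Set.Icc (-Real.pi) Real.pi ∩ {y | θ₀ ≤ |y|}) :=
    isCompact_Icc.inter_right (isClosed_le continuous_const continuous_abs)
  have hS : IsCompact S := isCompact_Icc.reProdIm hI
  have hA : IsCompact A := isCompact_singleton.reProdIm hI
  have hAS : A ⊆ S := fun u hu => ⟨by
    have : u.re = 0 := hu.1
    simp only [Set.mem_preimage, this]
    constructor <;> linarith, hu.2⟩
  have hSb : ∀ u ∈ S, |(0 : ℂ).re| + |u.re| ≤ M.s / 2 := fun u hu => by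
    simpa using abs_le.2 hu.1
  have hcoef : ∀ u ∈ S, ∀ k, ‖M.coeff k u‖ ≤ N.bound / R ^ k := fun u hu k => by
    simpa using (N.isDelayedRenewal (hSb u hu)).norm_f_le k
  have hcont : ContinuousOn (fun x : ℂ × ℂ => 1 - genFun (fun k => M.coeff k x.2) x.1)
      (Metric.closedBall 0 r ×ˢ S) := by
    refine continuousOn_const.sub (continuousOn_tsum (fun k => ?_)
      (summable_geometric_ratio (B := N.bound) (by linarith) (by linarith) hrR)
      fun k x hx => norm_mul_pow_le (hcoef x.2 hx.2) (mem_closedBall_zero_iff.1 hx.1) k)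
    have := M.continuous_coeff k
    fun_prop
  obtain ⟨ρ, δ, c, hρ1, hρr, hδ, hc, hlow⟩ := exists_lower_bound_near hr1 hS hA hAS hcont
    (fun z hz u hu h => by
      obtain ⟨hu0, ⟨hu1, hu2⟩, hu3⟩ := hu
      obtain ⟨-, he⟩ := M.eq_one_of_genFun_coeff_eq_one hz hu0 (sub_eq_zero.1 h).symm
      obtain ⟨n, hn⟩ := Complex.exp_eq_one_iff.1 he
      have him := congrArg Complex.im hn
      simp at him
      have h3 : θ₀ ≤ |u.im| := hu3
      have h4 : |u.im| ≤ Real.pi := abs_le.2 ⟨hu1, hu2⟩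
      rw [him, abs_mul, abs_of_pos Real.two_pi_pos] at h3 h4
      have hn0 : n ≠ 0 := by rintro rfl; simp at h3; linarith
      have h5 : (1 : ℝ) ≤ |(n : ℝ)| := by exact_mod_cast Int.one_le_abs hn0
      nlinarith [Real.pi_pos])
  have hρ0 : 0 < ρ := by linarith
  refine ⟨min (δ / 2) (M.s / 2), ρ⁻¹,
    N.bound * (1 - ρ / R)⁻¹ + (N.bound * (1 - ρ / R)⁻¹) ^ 2 / c, lt_min (by linarith) (by linarith),
    by positivity,
    inv_lt_one_of_one_lt₀ hρ1, fun u hu1 hu2 hu3 n => ?_⟩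
  have huS : u ∈ S := ⟨abs_le.1 (hu1.trans (min_le_right _ _)), abs_le.1 hu3, hu2⟩
  have huA : (u.im : ℂ) * Complex.I ∈ A := by
    refine ⟨?_, ?_⟩
    · simp
    · simpa using ⟨abs_le.1 hu3, hu2⟩
  have hdist : dist u ((u.im : ℂ) * Complex.I) < δ := by
    have : u - (u.im : ℂ) * Complex.I = (u.re : ℂ) := by
      rw [sub_eq_iff_eq_add, Complex.re_add_im]
    rw [dist_eq_norm, this, Complex.norm_real]
    exact (hu1.trans (min_le_left _ _)).trans_lt (by linarith)
  have hgf : (fun k : ℕ => Complex.exp (0 * k) * M.coeff k u) = fun k => M.coeff k u := by simp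
  have := (N.isDelayedRenewal (hSb u huS)).norm_combination_le N.bound_nonneg hR hρ0 hρr hrR.le hc
    (e₀ := 1) (e₁ := 0) (q := fun z => 1 - genFun (fun k => M.coeff k u) z)
    ((differentiableOn_const 1).sub ((differentiableOn_genFun (by linarith) (hcoef u huS)).mono
      (Metric.ball_subset_ball hrR.le)))
    (fun z hz => hlow z hz u huS _ huA hdist)
    (fun z _ => by rw [hgf]; ring) n
  rw [inv_pow, ← div_eq_mul_inv]
  simpa using this

end RenewalFamily

/-- The quotient `(genFun a 1 - genFun a z) / (1 - z)` as a series. -/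
def genQuot (a : ℕ → ℂ) (z : ℂ) : ℂ := ∑' k, a k * ∑ i ∈ Finset.range k, z ^ i

section genQuot

variable {a : ℕ → ℂ} {B R r : ℝ}

lemma norm_mul_geom_sum_le (hr : 1 ≤ r) (ha : ∀ n, ‖a n‖ ≤ B / R ^ n) {z : ℂ} (hz : ‖z‖ ≤ r)
    (k : ℕ) : ‖a k * ∑ i ∈ Finset.range k, z ^ i‖ ≤ B * (k ^ 1 * (r / R) ^ k) := by
  have h1 : ‖∑ i ∈ Finset.range k, z ^ i‖ ≤ k * r ^ k := by
    have : ∑ i ∈ Finset.range k, r ^ k = k * r ^ k := by simp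
    rw [← this]
    refine norm_sum_le_of_le _ fun i hi => ?_
    rw [norm_pow]
    exact (pow_le_pow_left₀ (norm_nonneg z) hz i).trans
      (pow_le_pow_right₀ hr (Finset.mem_range.1 hi).le)
  rw [norm_mul]
  calc ‖a k‖ * ‖∑ i ∈ Finset.range k, z ^ i‖ ≤ B / R ^ k * (k * r ^ k) :=
        mul_le_mul (ha k) h1 (norm_nonneg _) ((norm_nonneg _).trans (ha k))
    _ = B * (k ^ 1 * (r / R) ^ k) := by rw [div_pow]; ring

lemma summable_mul_geometric_ratio (hr : 1 ≤ r) (hrR : r < R) :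
    Summable fun k : ℕ => B * ((k : ℝ) ^ 1 * (r / R) ^ k) := by
  refine (summable_pow_mul_geometric_of_norm_lt_one 1 ?_).mul_left B
  have hR : 0 < R := by linarith
  rw [Real.norm_of_nonneg (by positivity)]
  exact (div_lt_one hR).2 hrR

lemma differentiableOn_genQuot (hr : 1 ≤ r) (hrR : r < R) (ha : ∀ n, ‖a n‖ ≤ B / R ^ n) :
    DifferentiableOn ℂ (genQuot a) (Metric.ball 0 r) :=
  Complex.differentiableOn_tsum_of_summable_norm (summable_mul_geometric_ratio (B := B) hr hrR)
    (fun n => by fun_prop) Metric.isOpen_ball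
    fun n w hw => norm_mul_geom_sum_le hr ha (mem_ball_zero_iff.1 hw).le n

lemma genFun_one_sub_genFun (hr : 1 ≤ r) (hrR : r < R) (ha : ∀ n, ‖a n‖ ≤ B / R ^ n) {z : ℂ}
    (hz : ‖z‖ ≤ r) : genFun a 1 - genFun a z = (1 - z) * genQuot a z := by
  have hR : 0 < R := by linarith
  have s1 := hasSum_genFun hR ha (z := 1) (by simpa using hr.trans_lt hrR)
  have s2 := hasSum_genFun hR ha (hz.trans_lt hrR)
  have s3 : HasSum (fun k => a k * ∑ i ∈ Finset.range k, z ^ i) (genQuot a z) :=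
    ((summable_mul_geometric_ratio (B := B) hr hrR).of_norm_bounded
      fun k => norm_mul_geom_sum_le hr ha hz k).hasSum
  refine (s1.sub s2).unique (hasSum_of_forall_eq (s3.mul_left (1 - z)) fun k => ?_)
  have := mul_neg_geom_sum z k
  rw [one_pow]
  linear_combination -(a k) * this

end genQuot

namespace RenewalFamily

variable {Ω : Type} [MeasurableSpace Ω] {P : Measure Ω} {M : RewardedSpan P} (N : RenewalFamily M)

lemma genQuot_coeff_one : genQuot (fun k => M.coeff k 0) 1 = M.meanτ := by
  have h := M.hasSum_setIntegral_τ (F := fun ω => (M.τ ω : ℂ)) (by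
    simpa using M.integrable_τ.ofReal (𝕜 := ℂ))
  have e : ∫ ω, (M.τ ω : ℂ) ∂P = M.meanτ := by
    rw [RewardedSpan.meanτ, ← integral_complex_ofReal]
    simp
  rw [e] at h
  refine HasSum.tsum_eq (hasSum_of_forall_eq h fun k => ?_)
  have : ∫ ω in {ω | M.τ ω = k}, (M.τ ω : ℂ) ∂P = ∫ ω in {ω | M.τ ω = k}, (k : ℂ) ∂P :=
    setIntegral_congr_fun (M.measurableSet_τ_eq k) fun ω hω => by
      rw [show M.τ ω = k from hω]
  rw [this]
  simp [RewardedSpan.coeff, mul_comm]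

/-- Near the origin, consecutive tilted moment generating functions are exponentially close. -/
lemma exists_norm_tilted_sub_le [IsProbabilityMeasure P] {lam : ℂ → ℂ} (ha : AnalyticAt ℂ lam 0)
    (h0 : lam 0 = 0) (h1 : ∀ᶠ u in nhds 0, M.mgf (lam u) u = 1) :
    ∃ κ K : ℝ, 0 < κ ∧ κ < 1 ∧ ∀ᶠ u in nhds 0, ∀ n : ℕ,
      ‖Complex.exp (lam u * (n + 1 : ℕ)) * N.G (n + 1) u - Complex.exp (lam u * n) * N.G n u‖ ≤
        K * κ ^ (n + 1) := by
  have hs := M.s_pos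
  obtain ⟨C, -, hb⟩ := M.eventually_branch_bounds ha h0
  obtain ⟨δ₀, hδ₀, hball⟩ := Metric.eventually_nhds_iff.1 (hb.and h1)
  set R := Real.exp (M.s / 2) with hRdef
  have hR : 1 < R := one_lt_exp_half
  obtain ⟨r, hr1, hrR⟩ := exists_between hR
  set S : Set ℂ := Metric.closedBall 0 (δ₀ / 2)
  have hSb : ∀ u ∈ S, DifferentiableAt ℂ lam u ∧ |(lam u).re| + |u.re| ≤ M.s / 2 ∧
      M.mgf (lam u) u = 1 := fun u hu => by
    have := hball (y := u) (lt_of_le_of_lt hu (by linarith))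
    exact ⟨this.1.1, this.1.2.2.2.2, this.2⟩
  set f : ℂ → ℕ → ℂ := fun u n => Complex.exp (lam u * n) * M.coeff n u
  have hcoef : ∀ u ∈ S, ∀ k, ‖f u k‖ ≤ N.bound / R ^ k := fun u hu k =>
    (N.isDelayedRenewal (hSb u hu).2.1).norm_f_le k
  have hf1 : ∀ u ∈ S, genFun (f u) 1 = 1 := fun u hu => by
    obtain ⟨-, h2, h3⟩ := hSb u hu
    refine Eq.trans ?_ h3
    refine HasSum.tsum_eq (hasSum_of_forall_eq (M.hasSum_coeff_exp (h2.trans_lt (by linarith)))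
      fun k => ?_)
    rw [one_pow, mul_one]
  have hlamc : ContinuousOn lam S := fun u hu => (hSb u hu).1.continuousAt.continuousWithinAt
  have hcont : ContinuousOn (fun x : ℂ × ℂ => genQuot (f x.2) x.1)
      (Metric.closedBall 0 r ×ˢ S) := by
    refine continuousOn_tsum (fun k => ?_) (summable_mul_geometric_ratio (B := N.bound) hr1.le hrR)
      fun k x hx => norm_mul_geom_sum_le hr1.le (hcoef x.2 hx.2) (mem_closedBall_zero_iff.1 hx.1) k
    have c1 := M.continuous_coeff k
    have c2 : ContinuousOn (fun x : ℂ × ℂ => lam x.2) (Metric.closedBall 0 r ×ˢ S) :=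
      hlamc.comp continuousOn_snd fun x hx => hx.2
    have c3 : ContinuousOn (fun x : ℂ × ℂ => Complex.exp (lam x.2 * k) * M.coeff k x.2)
        (Metric.closedBall 0 r ×ˢ S) :=
      (Complex.continuous_exp.comp_continuousOn (c2.mul continuousOn_const)).mul
        (c1.comp continuous_snd).continuousOn
    exact c3.mul (by fun_prop)
  have hS0 : (0 : ℂ) ∈ S := Metric.mem_closedBall_self (by linarith)
  have hf0 : f 0 = fun k => M.coeff k 0 := by
    funext k; simp [f, h0]
  obtain ⟨ρ, δ, c, hρ1, hρr, hδ, hc, hlow⟩ := exists_lower_bound_near hr1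
    (isCompact_closedBall 0 _) (isCompact_singleton (x := (0 : ℂ)))
    (Set.singleton_subset_iff.2 hS0) hcont (fun z hz u hu h => by
      rw [Set.mem_singleton_iff] at hu
      subst hu
      simp only [] at h
      have h4 := genFun_one_sub_genFun hr1.le hrR (hcoef 0 hS0) (hz.trans hr1.le)
      rw [hf1 0 hS0, h, mul_zero, hf0] at h4
      obtain ⟨hz1, -⟩ := M.eq_one_of_genFun_coeff_eq_one hz rfl (sub_eq_zero.1 h4).symm
      rw [hz1, hf0, genQuot_coeff_one] at h
      exact M.meanτ_pos.ne' (by exact_mod_cast h))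
  have hρ0 : 0 < ρ := by linarith
  refine ⟨ρ⁻¹, (1 + 1 * ρ) * (N.bound * (1 - ρ / R)⁻¹) + (N.bound * (1 - ρ / R)⁻¹) ^ 2 / c,
    by positivity, inv_lt_one_of_one_lt₀ hρ1, ?_⟩
  filter_upwards [Metric.ball_mem_nhds (0 : ℂ) (lt_min hδ (half_pos hδ₀))] with u hu n
  rw [Metric.mem_ball] at hu
  have huS : u ∈ S := (hu.trans_le (min_le_right _ _)).le
  have := (N.isDelayedRenewal (hSb u huS).2.1).norm_combination_le N.bound_nonneg hR hρ0 hρr hrR.le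
    hc (e₀ := 1) (e₁ := -1) (q := genQuot (f u))
    (differentiableOn_genQuot hr1.le hrR (hcoef u huS))
    (fun z hz => hlow z hz u huS 0 rfl (hu.trans_le (min_le_left _ _)))
    (fun z hz => by
      have h5 := genFun_one_sub_genFun hr1.le hrR (hcoef u huS) hz.le
      rw [hf1 u huS] at h5
      change 1 - genFun (f u) z = _
      rw [h5]; ring) n
  rw [inv_pow, ← div_eq_mul_inv]
  simpa [sub_eq_add_neg] using this

end RenewalFamily

/-- Laplace asymptotics: a sequence of kernels with Gaussian scaling limit. -/
lemma tendsto_sqrt_mul_intervalIntegral {Φ : ℕ → ℝ → ℂ} (hΦ : ∀ n, Continuous (Φ n)) {c C V : ℝ}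
    (hc : 0 < c)
    (hb : ∀ᶠ n : ℕ in atTop, ∀ θ, |θ| ≤ Real.pi → ‖Φ n θ‖ ≤ C * Real.exp (-(c * (n * θ ^ 2))))
    (hlim : ∀ t : ℝ, Tendsto (fun n : ℕ => Φ n (t / √(n : ℝ))) atTop
      (nhds (Real.exp (-(V / 2) * t ^ 2) : ℝ))) :
    Tendsto (fun n : ℕ => (√(n : ℝ) : ℂ) * ∫ θ in -Real.pi..Real.pi, Φ n θ) atTop
      (nhds (√(Real.pi / (V / 2)) : ℝ)) := by
  set F : ℕ → ℝ → ℂ := fun n => (Set.Ioc (-Real.pi * √(n : ℝ)) (Real.pi * √(n : ℝ))).indicator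
    fun t => Φ n (t / √(n : ℝ)) with hF
  have e : ∀ n : ℕ, 0 < n → ∫ t, F n t = (√(n : ℝ) : ℂ) * ∫ θ in -Real.pi..Real.pi, Φ n θ := by
    intro n hn
    have hn' : (0 : ℝ) < √(n : ℝ) := Real.sqrt_pos.2 (by exact_mod_cast hn)
    rw [hF, integral_indicator measurableSet_Ioc, ← intervalIntegral.integral_of_le (by
      nlinarith [Real.pi_pos]), intervalIntegral.integral_comp_div (f := Φ n) hn'.ne',
      mul_div_cancel_right₀ _ hn'.ne', mul_div_cancel_right₀ _ hn'.ne', Complex.real_smul]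
  have g : ∫ t : ℝ, ((Real.exp (-(V / 2) * t ^ 2) : ℝ) : ℂ) = (√(Real.pi / (V / 2)) : ℝ) := by
    rw [integral_complex_ofReal, integral_gaussian]
  rw [← g]
  refine Tendsto.congr' (f₁ := fun n => ∫ t, F n t)
    ((eventually_gt_atTop 0).mono fun n hn => e n hn) ?_
  refine tendsto_integral_filter_of_dominated_convergence
    (fun t => |C| * Real.exp (-c * t ^ 2)) ?_ ?_ ((integrable_exp_neg_mul_sq hc).const_mul _) ?_
  · exact Eventually.of_forall fun n => (((hΦ n).comp (by fun_prop)).measurable.indicator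
      measurableSet_Ioc).aestronglyMeasurable
  · filter_upwards [hb, eventually_gt_atTop 0] with n hn hn0
    have hn' : (0 : ℝ) < √(n : ℝ) := Real.sqrt_pos.2 (by exact_mod_cast hn0)
    refine Eventually.of_forall fun t => ?_
    by_cases ht : t ∈ Set.Ioc (-Real.pi * √(n : ℝ)) (Real.pi * √(n : ℝ))
    · simp only [hF, Set.indicator_of_mem ht]
      refine (hn _ ?_).trans ?_
      · rw [abs_div, abs_of_pos hn', div_le_iff₀ hn', abs_le]
        exact ⟨by linarith [ht.1], ht.2⟩
      · have : (n : ℝ) * (t / √(n : ℝ)) ^ 2 = t ^ 2 := by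
          rw [div_pow, Real.sq_sqrt (Nat.cast_nonneg n)]
          field_simp
        rw [this, neg_mul]
        gcongr
        exact le_abs_self C
    · simp only [hF, Set.indicator_of_notMem ht, norm_zero]
      positivity
  · refine Eventually.of_forall fun t => (hlim t).congr' ?_
    have h1 : Tendsto (fun n : ℕ => Real.pi * √(n : ℝ)) atTop atTop :=
      (Real.tendsto_sqrt_atTop.comp tendsto_natCast_atTop_atTop).const_mul_atTop Real.pi_pos
    filter_upwards [h1.eventually_gt_atTop |t|] with n hn
    have ht : t ∈ Set.Ioc (-Real.pi * √(n : ℝ)) (Real.pi * √(n : ℝ)) := by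
      rw [abs_lt] at hn
      exact ⟨by linarith [hn.1], hn.2.le⟩
    simp only [hF, Set.indicator_of_mem ht]

/-- Second order Taylor expansion, uniform in the base point, of an analytic function. -/
lemma AnalyticAt.exists_norm_taylor_two_le {lam : ℂ → ℂ} (ha : AnalyticAt ℂ lam 0) {ε : ℝ}
    (hε : 0 < ε) :
    ∃ δ > 0, ∀ u h : ℂ, ‖u‖ < δ → ‖h‖ < δ →
      ‖lam (u + h) - lam u - h * deriv lam u - h ^ 2 * (deriv (deriv lam) 0 / 2)‖ ≤
        ε * ‖h‖ ^ 2 := by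
  set D := deriv (deriv lam) 0
  have hs : HasStrictDerivAt (deriv lam) D 0 := ha.deriv.hasStrictDerivAt
  have h1 := hs.hasStrictFDerivAt.isLittleO.def hε
  have h2 : ∀ᶠ z in nhds (0 : ℂ), DifferentiableAt ℂ lam z :=
    ha.eventually_analyticAt.mono fun z hz => hz.differentiableAt
  obtain ⟨δ₁, hδ₁, H1⟩ := Metric.eventually_nhds_iff.1 h1
  obtain ⟨δ₂, hδ₂, H2⟩ := Metric.eventually_nhds_iff.1 h2
  refine ⟨min δ₁ δ₂ / 2, by positivity, fun u h hu hh => ?_⟩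
  have hmem : ∀ w ∈ Metric.closedBall (0 : ℂ) ‖h‖, ‖u + w‖ < min δ₁ δ₂ := fun w hw =>
    (norm_add_le _ _).trans_lt (by linarith [mem_closedBall_zero_iff.1 hw])
  set F : ℂ → ℂ := fun w => lam (u + w) - lam u - w * deriv lam u - w ^ 2 * (D / 2)
  have hF : ∀ w ∈ Metric.closedBall (0 : ℂ) ‖h‖, HasDerivWithinAt F
      (deriv lam (u + w) - deriv lam u - w * D) (Metric.closedBall 0 ‖h‖) w := fun w hw => by
    have d1 : DifferentiableAt ℂ lam (u + w) :=
      H2 (by simpa using (hmem w hw).trans_le (min_le_right _ _))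
    have d2 : HasDerivAt (fun w => lam (u + w)) (deriv lam (u + w)) w :=
      d1.hasDerivAt.comp_const_add u w
    have d3 := ((d2.sub_const (lam u)).sub ((hasDerivAt_id w).mul_const (deriv lam u))).sub
      ((hasDerivAt_pow 2 w).mul_const (D / 2))
    refine (d3.congr_deriv ?_).hasDerivWithinAt
    simp
    ring
  have hB : ∀ w ∈ Metric.closedBall (0 : ℂ) ‖h‖,
      ‖deriv lam (u + w) - deriv lam u - w * D‖ ≤ ε * ‖h‖ := fun w hw => by
    have := H1 (y := (u + w, u)) (by
      rw [Prod.dist_eq]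
      simp only [dist_zero_right]
      exact max_lt ((hmem w hw).trans_le (min_le_left _ _))
        (by linarith [min_le_left δ₁ δ₂, norm_nonneg u]))
    simp only [add_sub_cancel_left] at this
    exact this.trans (by gcongr; exact mem_closedBall_zero_iff.1 hw)
  have := (convex_closedBall (0 : ℂ) ‖h‖).norm_image_sub_le_of_norm_hasDerivWithin_le hF hB
    (x := 0) (y := h) (by simp) (by simp)
  simp only [F] at this
  simpa [pow_two, mul_assoc] using this

namespace RenewalFamily

variable {Ω : Type} [MeasurableSpace Ω] {P : Measure Ω} {M : RewardedSpan P} (N : RenewalFamily M)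

lemma tendsto_tilted [IsProbabilityMeasure P] {lam : ℂ → ℂ} (ha : AnalyticAt ℂ lam 0)
    (h0 : lam 0 = 0) (h1 : ∀ᶠ u in nhds 0, M.mgf (lam u) u = 1) :
    Tendsto (fun q : ℕ × ℂ => Complex.exp (lam q.2 * q.1) * N.G q.1 q.2)
      (atTop ×ˢ nhds 0) (nhds 1) := by
  obtain ⟨κ, K, hκ, hκ1, hb⟩ := N.exists_norm_tilted_sub_le ha h0 h1
  set c : ℕ → ℂ → ℂ := fun n u => Complex.exp (lam u * n) * N.G n u
  have hsum : ∀ u, (∀ n : ℕ, ‖c (n + 1) u - c n u‖ ≤ K * κ ^ (n + 1)) → ∀ n₀ m,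
      ‖c (n₀ + m) u - c n₀ u‖ ≤ K * κ ^ (n₀ + 1) * ((1 - κ ^ m) / (1 - κ)) := by
    intro u hu n₀ m
    induction m with
    | zero => simp
    | succ m ih =>
      have e : K * κ ^ (n₀ + 1) * ((1 - κ ^ (m + 1)) / (1 - κ)) =
          K * κ ^ (n₀ + m + 1) + K * κ ^ (n₀ + 1) * ((1 - κ ^ m) / (1 - κ)) := by
        have : 1 - κ ≠ 0 := by linarith
        field_simp
        ring
      rw [e, ← sub_add_sub_cancel (c (n₀ + (m + 1)) u) (c (n₀ + m) u)]
      exact (norm_add_le _ _).trans (add_le_add (hu (n₀ + m)) ih)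
  have hK : 0 ≤ K := by
    have := (norm_nonneg _).trans (hb.self_of_nhds 0)
    exact nonneg_of_mul_nonneg_left this (by positivity)
  rw [Metric.tendsto_nhds]
  intro ε hε
  have hlim : Tendsto (fun n : ℕ => K * κ ^ (n + 1) / (1 - κ)) atTop (nhds 0) := by
    simpa using (((tendsto_pow_atTop_nhds_zero_of_lt_one hκ.le hκ1).comp
      (tendsto_add_atTop_nat 1)).const_mul K).div_const (1 - κ)
  obtain ⟨n₀, hn₀⟩ := (hlim.eventually_lt_const (half_pos hε)).exists
  have hc : ContinuousAt (c n₀) 0 :=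
    (ha.continuousAt.mul_const _).cexp.mul (N.continuous_G n₀).continuousAt
  have hc0 : c n₀ 0 = 1 := by simp [c, h0, N.G_zero]
  have hc' := Metric.continuousAt_iff'.1 hc (ε / 2) (half_pos hε)
  rw [hc0] at hc'
  filter_upwards [(eventually_ge_atTop n₀).prod_mk (hb.and hc')] with q hq
  obtain ⟨hq1, hq2, hq3⟩ := hq
  obtain ⟨m, hm⟩ := Nat.exists_eq_add_of_le hq1
  have h4 := hsum q.2 hq2 n₀ m
  rw [← hm, ← dist_eq_norm] at h4
  have h5 : K * κ ^ (n₀ + 1) * ((1 - κ ^ m) / (1 - κ)) ≤ K * κ ^ (n₀ + 1) / (1 - κ) := by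
    rw [← mul_div_assoc]
    have h6 : 0 < 1 - κ := by linarith
    exact div_le_div_of_nonneg_right
      (mul_le_of_le_one_right (by positivity) (by linarith [pow_pos hκ m])) h6.le
  calc dist (c q.1 q.2) 1 ≤ dist (c q.1 q.2) (c n₀ q.2) + dist (c n₀ q.2) 1 := dist_triangle _ _ _
    _ < ε / 2 + ε / 2 := add_lt_add_of_le_of_lt (h4.trans (h5.trans hn₀.le)) hq3
    _ = ε := add_halves ε

/-- The moment generating function along a vertical line, normalized by the saddle point value. -/
def saddle (lam : ℂ → ℂ) (n : ℕ) (μ θ : ℝ) : ℂ :=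
  N.G n (μ + θ * Complex.I) *
    Complex.exp (n * (lam μ + θ * Complex.I * deriv lam μ))

lemma continuous_saddle (lam : ℂ → ℂ) (n : ℕ) (μ : ℝ) : Continuous (N.saddle lam n μ) := by
  have := N.continuous_G n
  unfold saddle
  fun_prop

lemma saddle_eq (lam : ℂ → ℂ) (n : ℕ) (μ θ : ℝ) :
    N.saddle lam n μ θ =
      (Complex.exp (lam (μ + θ * Complex.I) * n) * N.G n (μ + θ * Complex.I)) *
      Complex.exp (-n * (lam (μ + θ * Complex.I) - lam μ - θ * Complex.I * deriv lam μ)) := by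
  rw [saddle, mul_comm (Complex.exp _) (N.G n _), mul_assoc (N.G n _), ← Complex.exp_add]
  congr 2
  ring

lemma eventually_norm_saddle_le [IsProbabilityMeasure P] {lam : ℂ → ℂ} (ha : AnalyticAt ℂ lam 0)
    (h0 : lam 0 = 0) (h1 : ∀ᶠ u in nhds 0, M.mgf (lam u) u = 1)
    (hr : ∀ᶠ μ : ℝ in nhds 0, (lam μ).im = 0) {μ : ℕ → ℝ} (hμ : Tendsto μ atTop (nhds 0)) :
    ∃ c C : ℝ, 0 < c ∧ ∀ᶠ n : ℕ in atTop, ∀ θ, |θ| ≤ Real.pi →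
      ‖N.saddle lam n (μ n) θ‖ ≤ C * Real.exp (-(c * (n * θ ^ 2))) := by
  have hV := M.variance_pos
  obtain ⟨δ, hδ, hT⟩ := ha.exists_norm_taylor_two_le (ε := M.variance / 4) (by positivity)
  have hc := (N.tendsto_tilted ha h0 h1).norm.eventually_le_const (u := 2) (by simp)
  obtain ⟨pa, hpa, pb, hpb, hab⟩ := eventually_prod_iff.1 hc
  obtain ⟨δ', hδ', hball⟩ := Metric.eventually_nhds_iff.1 hpb
  obtain ⟨θ₀, hθ₀_eq⟩ : ∃ t, t = min δ δ' / 2 := ⟨_, rfl⟩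
  have hθ₀ : 0 < θ₀ := by rw [hθ₀_eq]; positivity
  obtain ⟨μ₀, κ, K, hμ₀, hκ, hκ1, hG⟩ := N.exists_norm_G_le hθ₀
  have hlog : Real.log κ < 0 := Real.log_neg hκ hκ1
  set c := min (M.variance / 4) (-Real.log κ / 2 / Real.pi ^ 2)
  have hcpos : 0 < c := lt_min (by positivity) (by have := Real.pi_pos; apply div_pos <;> nlinarith)
  have hlam : Tendsto (fun n => (lam (μ n)).re) atTop (nhds 0) := by
    have := (Complex.continuous_re.continuousAt.comp ha.continuousAt).tendsto.comp
      ((Complex.continuous_ofReal.tendsto' (0 : ℝ) (0 : ℂ) (by simp)).comp hμ)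
    simpa [Function.comp_def, h0] using this
  refine ⟨c, max 2 K, hcpos, ?_⟩
  have hμabs : Tendsto (fun n => |μ n|) atTop (nhds 0) := by simpa using hμ.abs
  filter_upwards [hpa, hμabs.eventually_lt_const hθ₀, hμabs.eventually_lt_const hμ₀,
    hlam.eventually_lt_const (show (0 : ℝ) < -Real.log κ / 2 by linarith),
    hμ.eventually (RewardedSpan.eventually_deriv_branch_im ha hr), eventually_gt_atTop 0]
    with n hn hn1 hn2 hn3 hn4 hn0 θ hθ
  rcases lt_or_ge |θ| θ₀ with hs | hs
  · have hθn : ‖(θ * Complex.I : ℂ)‖ = |θ| := by simp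
    have hμn : ‖(μ n : ℂ)‖ = |μ n| := by simp
    have m1 := min_le_left δ δ'
    have m2 := min_le_right δ δ'
    have hT' := hT (μ n) (θ * Complex.I) (by rw [hμn]; linarith) (by rw [hθn]; linarith)
    rw [M.deriv_deriv_branch_zero ha h0 h1, hθn, sq_abs] at hT'
    have hb2 := hab hn (hball (y := μ n + θ * Complex.I) (by
      rw [dist_zero_right]
      refine (norm_add_le _ _).trans_lt ?_
      rw [hθn, hμn]
      linarith))
    rw [saddle_eq, norm_mul]
    refine mul_le_mul (hb2.trans (le_max_left _ _)) ?_ (norm_nonneg _) (by positivity)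
    rw [Complex.norm_exp, Real.exp_le_exp]
    have hre := (Complex.abs_re_le_norm _).trans hT'
    set w := lam (μ n + θ * Complex.I) - lam (μ n) - θ * Complex.I * deriv lam (μ n)
    have e1 : (w - (θ * Complex.I) ^ 2 * (-(M.variance : ℂ) / 2)).re =
        w.re - θ ^ 2 * (M.variance / 2) := by
      have : (w - (θ * Complex.I) ^ 2 * (-(M.variance : ℂ) / 2)) =
          w - ((θ ^ 2 * (M.variance / 2) : ℝ) : ℂ) := by
        rw [mul_pow, Complex.I_sq]; push_cast; ring
      rw [this, Complex.sub_re, Complex.ofReal_re]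
    rw [e1, abs_le] at hre
    have e2 : (-(n : ℂ) * w).re = -(n * w.re) := by
      rw [show -(n : ℂ) * w = ((-n : ℝ) : ℂ) * w by push_cast; ring, Complex.re_ofReal_mul]; ring
    rw [e2, neg_le_neg_iff, mul_left_comm]
    refine mul_le_mul_of_nonneg_left ?_ (Nat.cast_nonneg n)
    have : c ≤ M.variance / 4 := min_le_left _ _
    nlinarith [hre.1, sq_nonneg θ]
  · obtain ⟨n, rfl⟩ := Nat.exists_eq_succ_of_ne_zero hn0.ne'
    rw [saddle, norm_mul]
    have g1 := hG (μ (n + 1) + θ * Complex.I) (by simpa using hn2.le) (by simpa using hs)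
      (by simpa using hθ) n
    have hK : 0 ≤ K := nonneg_of_mul_nonneg_left ((norm_nonneg _).trans g1) (by positivity)
    rw [Complex.norm_exp]
    have e3 : (((n + 1 : ℕ) : ℂ) * (lam (μ (n + 1)) +
        θ * Complex.I * deriv lam (μ (n + 1)))).re = (n + 1 : ℕ) * (lam (μ (n + 1))).re := by
      rw [← Complex.ofReal_natCast, Complex.re_ofReal_mul, Complex.add_re, mul_assoc,
        Complex.re_ofReal_mul, Complex.I_mul_re, hn4]
      simp
    rw [Nat.succ_eq_add_one, e3]
    calc ‖N.G (n + 1) (μ (n + 1) + θ * Complex.I)‖ *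
          Real.exp ((n + 1 : ℕ) * (lam (μ (n + 1))).re)
        ≤ K * κ ^ (n + 1) * Real.exp ((n + 1 : ℕ) * (-Real.log κ / 2)) := by
          gcongr
      _ = K * Real.exp (-((n + 1 : ℕ) * (-Real.log κ / 2))) := by
          rw [mul_assoc]
          congr 1
          rw [← Real.exp_log hκ, ← Real.exp_nat_mul, ← Real.exp_add, Real.exp_log hκ]
          congr 1
          ring
      _ ≤ max 2 K * Real.exp (-(c * ((n + 1 : ℕ) * θ ^ 2))) := by
          refine mul_le_mul (le_max_right _ _) (Real.exp_le_exp.2 (neg_le_neg ?_))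
            (Real.exp_pos _).le (by positivity)
          rw [mul_left_comm]
          refine mul_le_mul_of_nonneg_left ?_ (Nat.cast_nonneg _)
          have c2 : c ≤ -Real.log κ / 2 / Real.pi ^ 2 := min_le_right _ _
          have t2 : θ ^ 2 ≤ Real.pi ^ 2 := by
            rw [← sq_abs θ]; gcongr
          have l2 : 0 ≤ -Real.log κ / 2 / Real.pi ^ 2 := hcpos.le.trans c2
          calc c * θ ^ 2 ≤ -Real.log κ / 2 / Real.pi ^ 2 * Real.pi ^ 2 := by gcongr
            _ = -Real.log κ / 2 := by field_simp

lemma tendsto_saddle [IsProbabilityMeasure P] {lam : ℂ → ℂ} (ha : AnalyticAt ℂ lam 0)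
    (h0 : lam 0 = 0) (h1 : ∀ᶠ u in nhds 0, M.mgf (lam u) u = 1)
    {μ : ℕ → ℝ} (hμ : Tendsto μ atTop (nhds 0)) (t : ℝ) :
    Tendsto (fun n : ℕ => N.saddle lam n (μ n) (t / √(n : ℝ))) atTop
      (nhds (Real.exp (-(M.variance / 2) * t ^ 2) : ℝ)) := by
  have hθ : Tendsto (fun n : ℕ => t / √(n : ℝ)) atTop (nhds 0) :=
    (Real.tendsto_sqrt_atTop.comp tendsto_natCast_atTop_atTop).const_div_atTop t
  have hμc : Tendsto (fun n => (μ n : ℂ)) atTop (nhds 0) :=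
    (Complex.continuous_ofReal.tendsto' (0 : ℝ) (0 : ℂ) (by simp)).comp hμ
  have hθc : Tendsto (fun n : ℕ => ((t / √(n : ℝ) : ℝ) : ℂ) * Complex.I) atTop (nhds 0) := by
    simpa using ((Complex.continuous_ofReal.tendsto' (0 : ℝ) (0 : ℂ) (by simp)).comp
      hθ).mul_const Complex.I
  have hu := hμc.add hθc
  rw [add_zero] at hu
  have hc := (N.tendsto_tilted ha h0 h1).comp (tendsto_id.prodMk hu)
  simp only [saddle_eq]
  rw [← one_mul (((Real.exp (-(M.variance / 2) * t ^ 2) : ℝ)) : ℂ), Complex.ofReal_exp]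
  refine hc.mul (Complex.continuous_exp.continuousAt.tendsto.comp ?_)
  rw [Metric.tendsto_nhds]
  intro ε hε
  obtain ⟨δ, hδ, hT⟩ := ha.exists_norm_taylor_two_le (ε := ε / (t ^ 2 + 1)) (by positivity)
  filter_upwards [(Metric.tendsto_nhds.1 hμc) δ hδ, (Metric.tendsto_nhds.1 hθc) δ hδ,
    eventually_gt_atTop 0] with n hn1 hn2 hn0
  rw [dist_zero_right] at hn1 hn2
  have hn' : (0 : ℝ) < n := by exact_mod_cast hn0
  have hT' := hT _ _ hn1 hn2
  set h := ((t / √(n : ℝ) : ℝ) : ℂ) * Complex.I with hh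
  have hsq : (n : ℝ) * (t / √(n : ℝ)) ^ 2 = t ^ 2 := by
    rw [div_pow, Real.sq_sqrt (Nat.cast_nonneg n)]
    field_simp
  have hh2 : (n : ℂ) * h ^ 2 = -(t : ℂ) ^ 2 := by
    rw [hh, mul_pow, Complex.I_sq]
    rw [← mul_assoc]
    have : (n : ℂ) * ((t / √(n : ℝ) : ℝ) : ℂ) ^ 2 = (t : ℂ) ^ 2 := by exact_mod_cast hsq
    rw [this]; ring
  have hhn : (n : ℝ) * ‖h‖ ^ 2 = t ^ 2 := by
    rw [hh, norm_mul, Complex.norm_I, mul_one, Complex.norm_real, Real.norm_eq_abs, sq_abs, hsq]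
  rw [M.deriv_deriv_branch_zero ha h0 h1] at hT'
  clear_value h
  have e : -(n : ℂ) * (lam (μ n + h) - lam (μ n) - h * deriv lam (μ n)) -
      ((-(M.variance / 2) * t ^ 2 : ℝ) : ℂ) = -(n : ℂ) * (lam (μ n + h) - lam (μ n) -
        h * deriv lam (μ n) - h ^ 2 * (-(M.variance : ℂ) / 2)) := by
    push_cast
    linear_combination ((M.variance : ℂ) / 2) * hh2
  rw [dist_eq_norm, e, norm_mul, norm_neg, Complex.norm_natCast]
  calc (n : ℝ) * _ ≤ n * (ε / (t ^ 2 + 1) * ‖h‖ ^ 2) := by gcongr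
    _ = ε * (t ^ 2 / (t ^ 2 + 1)) := by rw [mul_left_comm, hhn]; ring
    _ < ε * 1 := by
      gcongr
      rw [div_lt_one (by positivity)]
      linarith
    _ = ε := mul_one ε

end RenewalFamily

lemma intervalIntegral_exp_int_mul (μ : ℝ) (k : ℤ) :
    ∫ θ in -Real.pi..Real.pi, Complex.exp ((μ + θ * Complex.I) * k) =
      if k = 0 then (2 * Real.pi : ℂ) else 0 := by
  split_ifs with hk
  · subst hk
    simp
    ring
  · have hc : (Complex.I * k : ℂ) ≠ 0 := mul_ne_zero Complex.I_ne_zero (by exact_mod_cast hk)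
    have e : ∀ θ : ℝ, Complex.exp ((μ + θ * Complex.I) * k) =
        Complex.exp (μ * k) * Complex.exp (Complex.I * k * θ) := fun θ => by
      rw [← Complex.exp_add]
      congr 1
      ring
    simp only [e]
    rw [intervalIntegral.integral_const_mul, integral_exp_mul_complex hc]
    have h2 : Complex.exp (Complex.I * k * (Real.pi : ℝ)) =
        Complex.exp (Complex.I * k * (-Real.pi : ℝ)) := by
      rw [Complex.exp_eq_exp_iff_exists_int]
      exact ⟨k, by push_cast; ring⟩
    rw [h2]
    simp

lemma RewardedSpan.exists_saddle_point {Ω : Type} [MeasurableSpace Ω] {P : Measure Ω}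
    (M : RewardedSpan P) [IsProbabilityMeasure P] {lam : ℂ → ℂ} (ha : AnalyticAt ℂ lam 0)
    (h0 : lam 0 = 0) (h1 : ∀ᶠ u in nhds 0, M.mgf (lam u) u = 1) {y : ℕ → ℝ}
    (hy : Tendsto y atTop (nhds M.drift)) :
    ∃ μ : ℕ → ℝ, Tendsto μ atTop (nhds 0) ∧ ∀ᶠ n in atTop, -(deriv lam (μ n)).re = y n := by
  have hs : HasStrictDerivAt (deriv lam) (deriv (deriv lam) 0) ((0 : ℝ) : ℂ) := by
    rw [Complex.ofReal_zero]
    exact ha.deriv.hasStrictDerivAt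
  have hq := hs.real_of_complex.neg
  rw [M.deriv_deriv_branch_zero ha h0 h1, ← Complex.ofReal_neg, Complex.ofReal_re, neg_neg] at hq
  have hq' := hq.hasStrictFDerivAt_equiv M.variance_pos.ne'
  have e0 : -(deriv lam ((0 : ℝ) : ℂ)).re = M.drift := by
    rw [Complex.ofReal_zero, M.deriv_branch_zero ha h0 h1]
    simp
  have hr := hq'.eventually_right_inverse
  have ht := hq'.localInverse_tendsto
  simp only [Pi.neg_apply, e0] at hr ht
  exact ⟨fun n => hq'.localInverse _ _ _ (y n), ht.comp hy, hy.eventually hr⟩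

namespace RenewalFamily

variable {Ω : Type} [MeasurableSpace Ω] {P : Measure Ω} {M : RewardedSpan P} (N : RenewalFamily M)

lemma intervalIntegral_G_mul_exp (n x : ℕ) (μ : ℝ) :
    ∫ θ in -Real.pi..Real.pi, N.G n (μ + θ * Complex.I) *
      Complex.exp (-((μ + θ * Complex.I) * x)) = 2 * Real.pi * N.prob n x := by
  have e : ∀ θ : ℝ, N.G n (μ + θ * Complex.I) * Complex.exp (-((μ + θ * Complex.I) * x)) =
      ∑ j ∈ Finset.range (n + 1), N.prob n j *
        Complex.exp ((μ + θ * Complex.I) * ((j - x : ℤ) : ℂ)) := fun θ => by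
    rw [G, Finset.sum_mul]
    refine Finset.sum_congr rfl fun j _ => ?_
    rw [mul_assoc, ← Complex.exp_add]
    congr 2
    push_cast
    ring
  simp only [e]
  rw [intervalIntegral.integral_finsetSum fun j _ =>
    Continuous.intervalIntegrable (by fun_prop) _ _]
  simp only [intervalIntegral.integral_const_mul, intervalIntegral_exp_int_mul, sub_eq_zero,
    Nat.cast_inj, mul_ite, mul_zero, Finset.sum_ite_eq', Finset.mem_range]
  split_ifs with h
  · ring
  · rw [N.prob_eq_zero n x (by omega)]
    simp

lemma intervalIntegral_saddle {lam : ℂ → ℂ} {n x : ℕ} (hn : 0 < n) {μ : ℝ}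
    (h1 : (lam μ).im = 0) (h2 : (deriv lam μ).im = 0) (h3 : -(deriv lam μ).re = x / n) :
    ∫ θ in -Real.pi..Real.pi, N.saddle lam n μ θ =
      ((2 * Real.pi * (N.prob n x * Real.exp (n * ((lam μ).re - μ * (deriv lam μ).re))) : ℝ) :
        ℂ) := by
  have hn' : (n : ℂ) ≠ 0 := by exact_mod_cast hn.ne'
  have e1 : lam μ = ((lam μ).re : ℂ) := Complex.ext (by simp) (by simp [h1])
  have e3 : (deriv lam μ).re = -(x / n : ℝ) := by rw [← h3, neg_neg]
  have e2 : deriv lam μ = -(x / n : ℂ) := by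
    rw [← Complex.re_add_im (deriv lam μ), h2, e3]
    push_cast
    ring
  have e : ∀ θ : ℝ, N.saddle lam n μ θ = Complex.exp (n * ((lam μ).re + μ * (x / n))) *
      (N.G n (μ + θ * Complex.I) * Complex.exp (-((μ + θ * Complex.I) * x))) := fun θ => by
    rw [saddle, e2, mul_left_comm, ← Complex.exp_add, e1, Complex.ofReal_re]
    congr 2
    field_simp
    ring
  simp only [e]
  rw [intervalIntegral.integral_const_mul, intervalIntegral_G_mul_exp, e3]
  push_cast
  rw [mul_neg, sub_neg_eq_add]
  ring

/-- Local limit theorem in the region of normal and moderate deviations. -/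
theorem tendsto_prob_div [IsProbabilityMeasure P] {x : ℕ → ℕ}
    (hx : Tendsto (fun n : ℕ => (x n : ℝ) / n) atTop (nhds M.drift)) :
    Tendsto (fun n : ℕ => N.prob n (x n) /
      (Real.exp (-(n : ℝ) * M.deviation ((x n : ℝ) / n)) /
        (√M.variance * √(2 * Real.pi * n)))) atTop (nhds 1) := by
  have hV := M.variance_pos
  have hpi := Real.pi_pos
  obtain ⟨lam, ha, h0, h1, hr⟩ := M.exists_branch
  obtain ⟨μ, hμ, hμx⟩ := M.exists_saddle_point ha h0 h1 hx
  obtain ⟨c, C, hc, hb⟩ := N.eventually_norm_saddle_le ha h0 h1 hr hμ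
  have hlim := tendsto_sqrt_mul_intervalIntegral (fun n => N.continuous_saddle lam n (μ n)) hc hb
    (N.tendsto_saddle ha h0 h1 hμ)
  have hlim' := (((Complex.continuous_re.tendsto _).comp hlim).mul_const
    (√M.variance * √(2 * Real.pi) / (2 * Real.pi)))
  have e1 : ((√(Real.pi / (M.variance / 2)) : ℝ) : ℂ).re *
      (√M.variance * √(2 * Real.pi) / (2 * Real.pi)) = 1 := by
    rw [Complex.ofReal_re, show Real.pi / (M.variance / 2) = 2 * Real.pi / M.variance by
      field_simp, Real.sqrt_div' _ hV.le]
    have h2 : √M.variance ≠ 0 := (Real.sqrt_pos.2 hV).ne'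
    have h3 := Real.mul_self_sqrt (show 0 ≤ 2 * Real.pi by positivity)
    field_simp
    linarith [h3]
  rw [e1] at hlim'
  refine hlim'.congr' ?_
  filter_upwards [hμx, hμ.eventually hr, hμ.eventually (RewardedSpan.eventually_deriv_branch_im
    ha hr), hμ.eventually (M.eventually_deviation_eq ha h0 h1 hr), eventually_gt_atTop 0]
    with n hn1 hn2 hn3 hn4 hn0
  rw [Function.comp_apply, N.intervalIntegral_saddle hn0 hn2 hn3 hn1, ← Complex.ofReal_mul,
    Complex.ofReal_re, ← hn4, hn1, Real.sqrt_mul (by positivity) (n : ℝ), neg_mul, Real.exp_neg]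
  have hn' : (0 : ℝ) < √(n : ℝ) := Real.sqrt_pos.2 (by exact_mod_cast hn0)
  field_simp

end RenewalFamily

/-- Infinite binary pasts; the letter with index `0` is the most recent one. -/
abbrev History := ℕ → Bool

namespace History

/-- Append a letter. -/
def push (b : Bool) (c : History) : History
  | 0 => b
  | i + 1 => c i

/-- Forget the `k` most recent letters. -/
def shift (k : ℕ) (c : History) : History := fun i => c (k + i)

@[simp] lemma push_zero (b : Bool) (c : History) : push b c 0 = b := rfl

@[simp] lemma push_succ (b : Bool) (c : History) (i : ℕ) : push b c (i + 1) = c i := rfl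

lemma shift_zero (c : History) : shift 0 c = c := by
  funext i
  simp [shift]

lemma shift_shift (k l : ℕ) (c : History) : shift k (shift l c) = shift (l + k) c := by
  funext i
  simp [shift, add_assoc]

lemma shift_succ (k : ℕ) (c : History) : shift (k + 1) c = shift 1 (shift k c) :=
  (shift_shift 1 k c).symm

lemma shift_one_push (b : Bool) (c : History) : shift 1 (push b c) = c := by
  funext i
  simp [shift, add_comm 1 i]

/-- The number of zeros following the last one. -/
def age (c : History) : ℕ := sInf {k | c k = true}

/-- The number of ones among the `n` most recent letters. -/
def count (n : ℕ) (c : History) : ℕ := ∑ i ∈ Finset.range n, (c i).toNat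

lemma count_add (m n : ℕ) (c : History) : count (m + n) c = count m c + count n (shift m c) := by
  simp [count, shift, Finset.sum_range_add]

lemma count_le (n : ℕ) (c : History) : count n c ≤ n := by
  refine (Finset.sum_le_card_nsmul _ _ 1 fun i _ => Bool.toNat_le _).trans ?_
  simp

/-- The two pasts coincide up to a one and the `v - 1` letters before it. -/
def Agree (v : ℕ) (c c' : History) : Prop := ∃ k, c k = true ∧ ∀ i < k + v, c i = c' i

lemma Agree.push {v : ℕ} {c c' : History} (h : Agree v c c') (b : Bool) :
    Agree v (push b c) (push b c') := by
  obtain ⟨k, hk, h⟩ := h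
  refine ⟨k + 1, hk, fun i hi => ?_⟩
  cases i with
  | zero => rfl
  | succ i => exact h i (by omega)

lemma Agree.age_eq {v : ℕ} (hv : 0 < v) {c c' : History} (h : Agree v c c') :
    age c = age c' ∧ ∀ i < age c + v, c i = c' i := by
  obtain ⟨k, hk, h⟩ := h
  have hk' : c' k = true := by rw [← h k (by omega), hk]
  have h1 : age c ≤ k := Nat.sInf_le hk
  have h2 : age c' ≤ k := Nat.sInf_le hk'
  have m1 : c (age c) = true := Nat.sInf_mem (s := {k | c k = true}) ⟨k, hk⟩
  have m2 : c' (age c') = true := Nat.sInf_mem (s := {k | c' k = true}) ⟨k, hk'⟩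
  refine ⟨le_antisymm (Nat.sInf_le ?_) (Nat.sInf_le ?_), fun i hi => h i (by omega)⟩
  · exact (h _ (by omega)).trans m2
  · exact (h _ (by omega)).symm.trans m1

/-- A one preceded by `v - 1` zeros. -/
def hit (v : ℕ) : Set History := {c | c 0 = true ∧ ∀ i, 0 < i → i < v → c i = false}

/-- No regeneration during the last `n` steps. -/
def noHit (v n : ℕ) : Set History := {c | ∀ i < n, shift i c ∉ hit v}

/-- The last `n` steps lead to a first regeneration. -/
def firstHit (v n : ℕ) : Set History :=
  {c | 0 < n ∧ c ∈ hit v ∧ ∀ i, 0 < i → i < n → shift i c ∉ hit v}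

/-- The reference regeneration state. -/
def base : History := fun i => decide (i = 0)

lemma base_mem_hit (v : ℕ) : base ∈ hit v := ⟨rfl, fun i hi _ => by simp [base, hi.ne']⟩

lemma agree_of_hit {v : ℕ} {c c' : History} (h : c ∈ hit v) (h' : c' ∈ hit v) :
    Agree v c c' := by
  refine ⟨0, h.1, fun i hi => ?_⟩
  rcases Nat.eq_zero_or_pos i with rfl | hi0
  · rw [h.1, h'.1]
  · rw [h.2 i hi0 (by omega), h'.2 i hi0 (by omega)]

lemma mem_hit_congr {v : ℕ} (hv : 0 < v) {c c' : History} (h : ∀ i < v, c i = c' i) :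
    c ∈ hit v ↔ c' ∈ hit v := by
  simp only [hit, Set.mem_ofPred_eq, h 0 hv]
  exact and_congr_right fun _ => forall_congr' fun i =>
    imp_congr_right fun _ => forall_congr' fun hi => by rw [h i hi]

lemma mem_firstHit_congr {v : ℕ} (hv : 0 < v) {n : ℕ} {c c' : History}
    (h : ∀ i < n + v, c i = c' i) : c ∈ firstHit v n ↔ c' ∈ firstHit v n := by
  refine and_congr_right fun _ => and_congr (mem_hit_congr hv fun j hj => h j (by omega)) ?_
  exact forall_congr' fun i => imp_congr_right fun _ => forall_congr' fun hi => not_congr <|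
    mem_hit_congr hv fun j hj => h (i + j) (by omega)

lemma mem_noHit_succ {v n : ℕ} {c : History} :
    c ∈ noHit v (n + 1) ↔ c ∉ hit v ∧ shift 1 c ∈ noHit v n := by
  constructor
  · intro h
    refine ⟨by simpa [shift_zero] using h 0 (by omega), fun i hi => ?_⟩
    rw [shift_shift]
    exact h _ (by omega)
  · rintro ⟨h1, h2⟩ i hi
    cases i with
    | zero => rwa [shift_zero]
    | succ i =>
      have := h2 i (by omega)
      rwa [shift_shift, add_comm] at this

lemma mem_firstHit_succ {v n : ℕ} {c : History} :
    c ∈ firstHit v (n + 1) ↔ c ∈ hit v ∧ shift 1 c ∈ noHit v n := by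
  constructor
  · rintro ⟨-, h1, h2⟩
    refine ⟨h1, fun i hi => ?_⟩
    rw [shift_shift]
    exact h2 _ (by omega) (by omega)
  · rintro ⟨h1, h2⟩
    refine ⟨by omega, h1, fun i h0 hi => ?_⟩
    have := h2 (i - 1) (by omega)
    rwa [shift_shift, show 1 + (i - 1) = i by omega] at this

lemma mem_noHit_add {v m n : ℕ} {c : History} :
    c ∈ noHit v (m + n) ↔ c ∈ noHit v m ∧ shift m c ∈ noHit v n := by
  induction m generalizing c with
  | zero => simp [shift_zero, noHit]
  | succ m ih => rw [Nat.add_right_comm, mem_noHit_succ, ih, mem_noHit_succ, shift_shift,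
      add_comm 1 m, and_assoc]

/-- Decomposition according to the time of the first regeneration. -/
lemma indicator_noHit_add_sum (v n : ℕ) (c : History) :
    (noHit v n).indicator (1 : History → ℝ) c +
      ∑ k ∈ Finset.range (n + 1), (firstHit v k).indicator 1 (shift (n - k) c) = 1 := by
  classical
  induction n generalizing c with
  | zero => simp [noHit, firstHit, Set.indicator_apply]
  | succ n ih =>
    rw [Finset.sum_range_succ, ← ih (shift 1 c), ← add_assoc, add_right_comm]
    congr 1
    · rw [Nat.sub_self, shift_zero]
      simp only [Set.indicator_apply, mem_noHit_succ, mem_firstHit_succ]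
      by_cases h1 : c ∈ hit v <;> simp [h1]
    · refine Finset.sum_congr rfl fun k hk => ?_
      rw [shift_shift, show n + 1 - k = 1 + (n - k) by
        have := Finset.mem_range.1 hk; omega]

end History

namespace History

variable {v : ℕ} (p : ℕ → (Fin (v - 1) → Bool) → ℝ)

/-- The probability that the next letter is a one. -/
def nextProb (c : History) : ℝ := p (age c) fun j => c (age c + (v - 1) - j)

lemma Agree.nextProb_eq (hv : 0 < v) {c c' : History} (h : Agree v c c') :
    nextProb p c = nextProb p c' := by
  obtain ⟨h1, h2⟩ := h.age_eq hv
  rw [nextProb, nextProb, ← h1]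
  congr 1
  funext j
  exact h2 _ (by omega)

/-- Expectation of a function of the past after `n` further steps of the chain. -/
def avg {𝕜 : Type*} [RCLike 𝕜] : ℕ → (History → 𝕜) → History → 𝕜
  | 0, φ, c => φ c
  | n + 1, φ, c => nextProb p c * avg n φ (push true c) +
      (1 - nextProb p c : ℝ) * avg n φ (push false c)

variable {𝕜 : Type*} [RCLike 𝕜]

@[simp] lemma avg_zero (φ : History → 𝕜) (c : History) : avg p 0 φ c = φ c := rfl

lemma avg_succ (n : ℕ) (φ : History → 𝕜) (c : History) : avg p (n + 1) φ c =
    nextProb p c * avg p n φ (push true c) +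
      (1 - nextProb p c : ℝ) * avg p n φ (push false c) := rfl

lemma avg_add_steps (m n : ℕ) (φ : History → 𝕜) (c : History) :
    avg p (m + n) φ c = avg p m (avg p n φ) c := by
  induction m generalizing c with
  | zero => simp
  | succ m ih => rw [Nat.add_right_comm, avg_succ, avg_succ, ih, ih]

lemma avg_congr {n : ℕ} {φ ψ : History → 𝕜} {c : History}
    (h : ∀ d, shift n d = c → φ d = ψ d) : avg p n φ c = avg p n ψ c := by
  induction n generalizing c with
  | zero => exact h c (shift_zero c)
  | succ n ih =>
    have hb : ∀ b, avg p n φ (push b c) = avg p n ψ (push b c) := fun b => ih fun d hd =>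
      h d (by rw [shift_succ, hd, shift_one_push])
    rw [avg_succ, avg_succ, hb, hb]

lemma avg_const (n : ℕ) (a : 𝕜) (c : History) : avg p n (fun _ => a) c = a := by
  induction n generalizing c with
  | zero => rfl
  | succ n ih =>
    rw [avg_succ, ih, ih, ← add_mul, ← RCLike.ofReal_add]
    simp

lemma avg_fun_add (n : ℕ) (φ ψ : History → 𝕜) (c : History) :
    avg p n (fun d => φ d + ψ d) c = avg p n φ c + avg p n ψ c := by
  induction n generalizing c with
  | zero => rfl
  | succ n ih =>
    simp only [avg_succ, ih]
    ring

lemma avg_fun_sum {ι : Type*} (s : Finset ι) (n : ℕ) (φ : ι → History → 𝕜) (c : History) :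
    avg p n (fun d => ∑ i ∈ s, φ i d) c = ∑ i ∈ s, avg p n (φ i) c := by
  classical
  induction s using Finset.induction_on with
  | empty => simpa using avg_const p n (0 : 𝕜) c
  | insert i s hi ih => simp only [Finset.sum_insert hi, avg_fun_add, ih]

lemma avg_const_mul (n : ℕ) (a : 𝕜) (φ : History → 𝕜) (c : History) :
    avg p n (fun d => a * φ d) c = a * avg p n φ c := by
  induction n generalizing c with
  | zero => rfl
  | succ n ih =>
    simp only [avg_succ, ih]
    ring

/-- Factors depending on the past before the `n` steps can be taken out. -/
lemma avg_shift_mul (n : ℕ) (ψ φ : History → 𝕜) (c : History) :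
    avg p n (fun d => ψ (shift n d) * φ d) c = ψ c * avg p n φ c := by
  rw [← avg_const_mul]
  exact avg_congr p fun d hd => by rw [hd]

lemma avg_eq_of_agree (hv : 0 < v) {n m : ℕ} {φ : History → 𝕜}
    (hφ : ∀ d d' : History, (∀ i < n + m, d i = d' i) → φ d = φ d') {c c' : History}
    (hc : ∀ i < m, c i = c' i) (h : Agree v c c') : avg p n φ c = avg p n φ c' := by
  induction n generalizing c c' m with
  | zero => exact hφ c c' fun i hi => hc i (by omega)
  | succ n ih =>
    have hb : ∀ b, avg p n φ (push b c) = avg p n φ (push b c') := fun b => by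
      refine ih (m := m + 1) (fun d d' hd => hφ d d' fun i hi => hd i (by omega))
        (fun i hi => ?_) (h.push b)
      cases i with
      | zero => rfl
      | succ i => exact hc i (by omega)
    rw [avg_succ, avg_succ, hb, hb, h.nextProb_eq p hv]

/-- Regeneration: expectations started from a regeneration state do not depend on the past. -/
lemma avg_eq_avg_base (hv : 0 < v) {n : ℕ} {φ : History → 𝕜}
    (hφ : ∀ d d' : History, (∀ i < n + v, d i = d' i) → φ d = φ d') {c : History}
    (hc : c ∈ hit v) : avg p n φ c = avg p n φ base := by
  have hb := base_mem_hit v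
  refine avg_eq_of_agree p hv hφ (fun i hi => ?_) (agree_of_hit hc hb)
  rcases Nat.eq_zero_or_pos i with rfl | hi0
  · rw [hc.1, hb.1]
  · rw [hc.2 i hi0 hi, hb.2 i hi0 hi]

variable {p}

lemma avg_mono (hp : ∀ k w, 0 ≤ p k w ∧ p k w ≤ 1) {n : ℕ} {φ ψ : History → ℝ}
    (h : ∀ d, φ d ≤ ψ d) (c : History) : avg p n φ c ≤ avg p n ψ c := by
  induction n generalizing c with
  | zero => exact h c
  | succ n ih =>
    have h1 : 0 ≤ nextProb p c := (hp _ _).1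
    have h2 : 0 ≤ 1 - nextProb p c := sub_nonneg.2 (hp _ _).2
    simp only [avg_succ, RCLike.ofReal_real_eq_id, id]
    gcongr
    · exact ih _
    · exact ih _

lemma avg_nonneg (hp : ∀ k w, 0 ≤ p k w ∧ p k w ≤ 1) {n : ℕ} {φ : History → ℝ}
    (h : ∀ d, 0 ≤ φ d) (c : History) : 0 ≤ avg p n φ c :=
  (avg_const p n (0 : ℝ) c).ge.trans (avg_mono hp h c)

lemma norm_avg_le (hp : ∀ k w, 0 ≤ p k w ∧ p k w ≤ 1) (n : ℕ) (φ : History → 𝕜) (c : History) :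
    ‖avg p n φ c‖ ≤ avg p n (fun d => ‖φ d‖) c := by
  induction n generalizing c with
  | zero => exact le_rfl
  | succ n ih =>
    have h1 : 0 ≤ nextProb p c := (hp _ _).1
    have h2 : 0 ≤ 1 - nextProb p c := sub_nonneg.2 (hp _ _).2
    rw [avg_succ, avg_succ]
    refine (norm_add_le _ _).trans ?_
    rw [norm_mul, norm_mul, RCLike.norm_ofReal, RCLike.norm_ofReal, abs_of_nonneg h1,
      abs_of_nonneg h2]
    simp only [RCLike.ofReal_real_eq_id, id]
    gcongr
    · exact ih _
    · exact ih _

lemma ofReal_avg (n : ℕ) (φ : History → ℝ) (c : History) :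
    ((avg p n φ c : ℝ) : 𝕜) = avg p n (fun d => (φ d : 𝕜)) c := by
  induction n generalizing c with
  | zero => rfl
  | succ n ih => simp [avg_succ, ← ih]

lemma le_avg_indicator_zeros {δ : ℝ} (hp : ∀ k w, 0 ≤ p k w ∧ p k w ≤ 1)
    (hδ : ∀ k w, p k w ≤ δ) (hδ1 : δ ≤ 1) (n : ℕ) (c : History) :
    (1 - δ) ^ n ≤ avg p n ({d | ∀ i < n, d i = false}.indicator 1) c := by
  classical
  induction n with
  | zero => simp
  | succ n ih =>
    rw [avg_add_steps, pow_succ']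
    refine (mul_le_mul_of_nonneg_left ih (by linarith)).trans ?_
    rw [← avg_const_mul]
    refine avg_mono hp (fun d => ?_) c
    have e : ∀ b, (push b d ∈ {d : History | ∀ i < n + 1, d i = false}) ↔
        b = false ∧ d ∈ {d : History | ∀ i < n, d i = false} := fun b =>
      ⟨fun h => ⟨h 0 (by omega), fun i hi => h (i + 1) (by omega)⟩, fun h i hi => by
        cases i with
        | zero => exact h.1
        | succ i => exact h.2 i (by omega)⟩
    simp only [avg_succ, avg_zero, Set.indicator_apply, e]
    have h1 : 1 - δ ≤ 1 - nextProb p d := sub_le_sub_left (hδ _ _) 1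
    clear hδ
    split_ifs <;> simp_all

lemma le_avg_indicator_hit {δ ε : ℝ} (hp : ∀ k w, 0 ≤ p k w ∧ p k w ≤ 1)
    (hδ : ∀ k w, p k w ≤ δ) (hδ1 : δ ≤ 1) (hε0 : 0 ≤ ε) (hε : ∀ k w, ε ≤ p k w) (n : ℕ)
    (c : History) :
    ε * (1 - δ) ^ n ≤ avg p (n + 1) ((hit (n + 1)).indicator 1) c := by
  classical
  rw [avg_add_steps]
  refine (mul_le_mul_of_nonneg_left (le_avg_indicator_zeros hp hδ hδ1 n c) hε0).trans ?_
  rw [← avg_const_mul]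
  refine avg_mono hp (fun d => ?_) c
  have e : ∀ b, (push b d ∈ hit (n + 1)) ↔
      b = true ∧ d ∈ {d : History | ∀ i < n, d i = false} := fun b =>
    ⟨fun h => ⟨h.1, fun i hi => h.2 (i + 1) (by omega) (by omega)⟩, fun h => ⟨h.1, fun i h0 hi => by
      cases i with
      | zero => omega
      | succ i => exact h.2 i (by omega)⟩⟩
  simp only [avg_succ, avg_zero, Set.indicator_apply, e]
  have h1 := hε (age d) fun j => d (age d + (v - 1) - j)
  split_ifs <;> simp_all [nextProb]

lemma hit_subset_firstHit {n : ℕ} (hn : 0 < n) (hvn : v ≤ n) :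
    hit n ⊆ {d | d ∈ firstHit v n ∧ count n d = 1} := by
  rintro d ⟨h0, h⟩
  refine ⟨⟨hn, ⟨h0, fun i hi hiv => h i hi (by omega)⟩, fun i hi hin hs => ?_⟩, ?_⟩
  · have := hs.1
    simp [shift, h i hi hin] at this
  · rw [count, Finset.sum_eq_single 0 (fun i hi h0 => by
      rw [h i (Nat.pos_of_ne_zero h0) (Finset.mem_range.1 hi)]; rfl)
      (fun h => absurd (Finset.mem_range.2 hn) h), h0]
    rfl

end History

namespace History

variable {v : ℕ} (p : ℕ → (Fin (v - 1) → Bool) → ℝ)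

lemma count_congr {n : ℕ} {c c' : History} (h : ∀ i < n, c i = c' i) : count n c = count n c' :=
  Finset.sum_congr rfl fun i hi => by rw [h i (Finset.mem_range.1 hi)]

/-- Regeneration at a first hit decouples the two parts of the trajectory. -/
lemma avg_indicator_firstHit_mul {𝕜 : Type*} [RCLike 𝕜] (hv : 0 < v) (k m : ℕ)
    (ψ : History → 𝕜) {φ : History → 𝕜}
    (hφ : ∀ d d' : History, (∀ i < m + v, d i = d' i) → φ d = φ d') (c : History) :
    avg p (k + m) (fun d => (firstHit v k).indicator ψ (shift m d) * φ d) c =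
      avg p k ((firstHit v k).indicator ψ) c * avg p m φ base := by
  rw [avg_add_steps, mul_comm (avg p k _ c), ← avg_const_mul]
  congr 1
  funext d
  rw [avg_shift_mul, mul_comm]
  by_cases hd : d ∈ firstHit v k
  · rw [avg_eq_avg_base p hv hφ hd.2.1]
  · simp [hd]

/-- The moment generating function of the number of ones after `n` steps. -/
def gen (n : ℕ) (u : ℂ) (c : History) : ℂ := avg p n (fun d => Complex.exp (u * count n d)) c

/-- The part of `gen` coming from trajectories without regeneration. -/
def rest (n : ℕ) (u : ℂ) (c : History) : ℂ :=
  avg p n ((noHit v n).indicator fun d => Complex.exp (u * count n d)) c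

/-- The part of `gen` coming from trajectories with a first regeneration at the final step. -/
def first (n : ℕ) (u : ℂ) (c : History) : ℂ :=
  avg p n ((firstHit v n).indicator fun d => Complex.exp (u * count n d)) c

lemma gen_eq (hv : 0 < v) (n : ℕ) (u : ℂ) (c : History) :
    gen p n u c = rest p n u c + ∑ ij ∈ Finset.HasAntidiagonal.antidiagonal n,
      first p ij.1 u c * gen p ij.2 u base := by
  classical
  have h1 : ∀ d : History, Complex.exp (u * count n d) =
      (noHit v n).indicator (fun d => Complex.exp (u * count n d)) d +
      ∑ k ∈ Finset.range (n + 1), (firstHit v k).indicator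
        (fun d => Complex.exp (u * count k d)) (shift (n - k) d) *
          Complex.exp (u * count (n - k) d) := fun d => by
    have e := congrArg (fun x : ℝ => (x : ℂ) * Complex.exp (u * count n d))
      (indicator_noHit_add_sum v n d)
    simp only [Complex.ofReal_one, one_mul, Complex.ofReal_add, add_mul, Complex.ofReal_sum,
      Finset.sum_mul] at e
    rw [← e]
    congr 1
    · by_cases hd : d ∈ noHit v n <;> simp [hd]
    · refine Finset.sum_congr rfl fun k hk => ?_
      by_cases hd : shift (n - k) d ∈ firstHit v k
      · simp only [hd, Set.indicator_of_mem, Pi.one_apply, Complex.ofReal_one, one_mul]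
        rw [← Complex.exp_add, ← mul_add, ← Nat.cast_add, add_comm (count k _), ← count_add,
          Nat.sub_add_cancel (Nat.lt_succ_iff.1 (Finset.mem_range.1 hk))]
      · simp [hd]
  rw [gen, funext h1, avg_fun_add, avg_fun_sum, Finset.Nat.sum_antidiagonal_eq_sum_range_succ
    fun i j => first p i u c * gen p j u base]
  refine congrArg₂ _ rfl (Finset.sum_congr rfl fun k hk => ?_)
  have hk' : k + (n - k) = n := Nat.add_sub_cancel' (Nat.lt_succ_iff.1 (Finset.mem_range.1 hk))
  have := avg_indicator_firstHit_mul p hv k (n - k) (fun d => Complex.exp (u * count k d))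
    (φ := fun d => Complex.exp (u * count (n - k) d))
    (fun d d' h => by rw [count_congr fun i hi => h i (by omega)]) c
  rwa [hk'] at this

/-- The probability of no regeneration during `n` steps. -/
def survival (n : ℕ) (c : History) : ℝ := avg p n ((noHit v n).indicator 1) c

/-- The distribution of the first regeneration time. -/
def firstMass (n : ℕ) (c : History) : ℝ := avg p n ((firstHit v n).indicator 1) c

lemma survival_add_sum (n : ℕ) (c : History) :
    survival p n c + ∑ k ∈ Finset.range (n + 1), firstMass p k c = 1 := by
  have h := avg_const p n (1 : ℝ) c
  rw [← funext (indicator_noHit_add_sum v n), avg_fun_add, avg_fun_sum] at h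
  rw [← h]
  refine congrArg₂ _ rfl (Finset.sum_congr rfl fun k hk => ?_)
  have hk' : k + (n - k) = n := Nat.add_sub_cancel' (Nat.lt_succ_iff.1 (Finset.mem_range.1 hk))
  conv_rhs => rw [← hk', avg_add_steps]
  rw [firstMass]
  congr 1
  funext d
  have := avg_shift_mul p (n - k) ((firstHit v k).indicator 1) (fun _ => (1 : ℝ)) d
  simp only [mul_one, avg_const] at this
  rw [add_tsub_cancel_left, this]

variable {p}

lemma firstMass_nonneg (hp : ∀ k w, 0 ≤ p k w ∧ p k w ≤ 1) (n : ℕ) (c : History) :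
    0 ≤ firstMass p n c :=
  avg_nonneg hp (fun _ => Set.indicator_nonneg (fun _ _ => zero_le_one) _) c

lemma survival_le_one (hp : ∀ k w, 0 ≤ p k w ∧ p k w ≤ 1) (n : ℕ) (c : History) :
    survival p n c ≤ 1 := by
  have := survival_add_sum p n c
  linarith [Finset.sum_nonneg fun k (_ : k ∈ Finset.range (n + 1)) => firstMass_nonneg hp k c]

lemma firstMass_zero (c : History) : firstMass p 0 c = 0 := by
  simp [firstMass, firstHit]

lemma firstMass_succ_le (hp : ∀ k w, 0 ≤ p k w ∧ p k w ≤ 1) (n : ℕ) (c : History) :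
    firstMass p (n + 1) c ≤ survival p n c := by
  have h0 : 0 ≤ survival p (n + 1) c :=
    avg_nonneg hp (fun _ => Set.indicator_nonneg (fun _ _ => zero_le_one) _) c
  have h1 := survival_add_sum p (n + 1) c
  rw [Finset.sum_range_succ] at h1
  linarith [survival_add_sum p n c]

lemma survival_add_le {η : ℝ} (hp : ∀ k w, 0 ≤ p k w ∧ p k w ≤ 1)
    (hη : ∀ c, η ≤ avg p v ((hit v).indicator 1) c) (hv : 0 < v) (n : ℕ) (c : History) :
    survival p (n + v) c ≤ (1 - η) * survival p n c := by
  classical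
  rw [survival, survival, avg_add_steps, ← avg_const_mul]
  refine avg_mono hp (fun d => ?_) c
  have e : ((noHit v (n + v)).indicator 1 : History → ℝ) = fun d =>
      (noHit v n).indicator 1 (shift v d) * (noHit v v).indicator 1 d := funext fun d => by
    simp only [Set.indicator_apply, add_comm n v, mem_noHit_add]
    by_cases h1 : d ∈ noHit v v <;> by_cases h2 : shift v d ∈ noHit v n <;> simp [h1, h2]
  rw [e, avg_shift_mul, mul_comm]
  refine mul_le_mul_of_nonneg_right ?_ (Set.indicator_nonneg (fun _ _ => zero_le_one) _)
  have h2 : avg p v ((noHit v v).indicator 1) d + avg p v ((hit v).indicator 1) d ≤ (1 : ℝ) := by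
    rw [← avg_fun_add]
    refine (avg_mono hp (ψ := fun _ => 1) (fun d => ?_) d).trans (avg_const p v (1 : ℝ) d).le
    by_cases h1 : d ∈ noHit v v
    · have h3 : d ∉ hit v := by simpa [shift_zero] using h1 0 hv
      simp [h1, h3]
    · simp only [Set.indicator_apply, h1, if_false, zero_add]
      split_ifs <;> simp
  linarith [hη d]

lemma survival_le_exp {η : ℝ} (hp : ∀ k w, 0 ≤ p k w ∧ p k w ≤ 1) (hη0 : 0 ≤ η)
    (hη : ∀ c, η ≤ avg p v ((hit v).indicator 1) c) (hv : 0 < v) (n : ℕ) (c : History) :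
    survival p n c ≤ Real.exp η * Real.exp (-(η / v * n)) := by
  have hv' : (0 : ℝ) < v := by exact_mod_cast hv
  rw [← Real.exp_add]
  induction n using Nat.strong_induction_on with
  | _ n ih =>
    rcases lt_or_ge n v with hn | hn
    · refine (survival_le_one hp n c).trans (Real.one_le_exp ?_)
      have : (n : ℝ) ≤ v := by exact_mod_cast hn.le
      have : η / v * n ≤ η / v * v := by gcongr
      rw [div_mul_cancel₀ _ hv'.ne'] at this
      linarith
    · obtain ⟨m, rfl⟩ := Nat.exists_eq_add_of_le' hn
      have h1 : 1 - η ≤ Real.exp (-η) := by linarith [Real.add_one_le_exp (-η)]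
      have h0 : 0 ≤ survival p m c :=
        avg_nonneg hp (fun _ => Set.indicator_nonneg (fun _ _ => zero_le_one) _) c
      calc survival p (m + v) c ≤ (1 - η) * survival p m c := survival_add_le hp hη hv m c
        _ ≤ Real.exp (-η) * Real.exp (η + -(η / v * m)) := by
          gcongr
          exact ih m (by omega)
        _ = Real.exp (η + -(η / v * (m + v : ℕ))) := by
          rw [← Real.exp_add]
          congr 1
          push_cast
          field_simp
          ring

lemma firstMass_le_exp {η : ℝ} (hp : ∀ k w, 0 ≤ p k w ∧ p k w ≤ 1) (hη0 : 0 ≤ η)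
    (hη : ∀ c, η ≤ avg p v ((hit v).indicator 1) c) (hv : 0 < v) (n : ℕ) (c : History) :
    firstMass p n c ≤ Real.exp (2 * η) * Real.exp (-(η / v * n)) := by
  cases n with
  | zero => rw [firstMass_zero]; positivity
  | succ n =>
    refine (firstMass_succ_le hp n c).trans ((survival_le_exp hp hη0 hη hv n c).trans ?_)
    rw [← Real.exp_add, ← Real.exp_add, Real.exp_le_exp]
    have : η / v ≤ η := div_le_self hη0 (by exact_mod_cast hv)
    push_cast
    linarith

lemma hasSum_firstMass {η : ℝ} (hp : ∀ k w, 0 ≤ p k w ∧ p k w ≤ 1) (hη0 : 0 < η)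
    (hη : ∀ c, η ≤ avg p v ((hit v).indicator 1) c) (hv : 0 < v) (c : History) :
    HasSum (fun k => firstMass p k c) 1 := by
  have hv' : (0 : ℝ) < v := by exact_mod_cast hv
  rw [hasSum_iff_tendsto_nat_of_nonneg fun k => firstMass_nonneg hp k c,
    ← tendsto_add_atTop_iff_nat 1]
  have h0 : Tendsto (fun n => survival p n c) atTop (nhds 0) := by
    refine squeeze_zero (fun n => avg_nonneg hp
      (fun _ => Set.indicator_nonneg (fun _ _ => zero_le_one) _) c)
      (fun n => survival_le_exp hp hη0.le hη hv n c) ?_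
    rw [← mul_zero (Real.exp η)]
    refine Tendsto.const_mul _ (Real.tendsto_exp_neg_atTop_nhds_zero.comp ?_)
    exact tendsto_natCast_atTop_atTop.const_mul_atTop (by positivity)
  have := h0.const_sub 1
  rw [sub_zero] at this
  refine this.congr fun n => ?_
  linarith [survival_add_sum p n c]

lemma norm_avg_indicator_exp_le (hp : ∀ k w, 0 ≤ p k w ∧ p k w ≤ 1) (n : ℕ) (u : ℂ)
    (A : Set History) (c : History) :
    ‖avg p n (A.indicator fun d => Complex.exp (u * count n d)) c‖ ≤
      avg p n (A.indicator 1) c * Real.exp (n * |u.re|) := by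
  rw [mul_comm, ← avg_const_mul]
  refine (norm_avg_le hp n _ c).trans (avg_mono hp (fun d => ?_) c)
  by_cases hd : d ∈ A
  · simp only [Set.indicator_of_mem hd, Pi.one_apply, mul_one, Complex.norm_exp, Real.exp_le_exp]
    rw [← Complex.ofReal_natCast, mul_comm, Complex.re_ofReal_mul]
    have : (count n d : ℝ) ≤ n := by exact_mod_cast count_le n d
    calc (count n d : ℝ) * u.re ≤ count n d * |u.re| := by
          gcongr
          exact le_abs_self _
      _ ≤ n * |u.re| := by gcongr
  · simp [hd]

lemma norm_gen_le (hp : ∀ k w, 0 ≤ p k w ∧ p k w ≤ 1) (n : ℕ) (u : ℂ) (c : History) :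
    ‖gen p n u c‖ ≤ Real.exp (n * |u.re|) := by
  have := norm_avg_indicator_exp_le hp n u Set.univ c
  rw [Set.indicator_univ, Set.indicator_univ] at this
  refine this.trans (le_of_eq ?_)
  rw [show (1 : History → ℝ) = fun _ => 1 from rfl, avg_const, one_mul]

end History

attribute [instance] VLMC.mΩ VLMC.hprob

namespace VLMC

variable {v : ℕ} {p : ℕ → (Fin (v - 1) → Bool) → ℝ} (S : VLMC v p)

/-- The past of the chain seen at time `n`. -/
def hist (n : ℕ) (ω : S.Ω) : History := fun i => S.cfg ω (n - i)

/-- The initial past of the chain. -/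
def start : History := fun i => S.r0 (-i)

lemma cfg_natCast (ω : S.Ω) {n : ℕ} (hn : 0 < n) : S.cfg ω n = S.X n ω := by
  rw [S.hcfg, if_neg (by omega), Int.toNat_natCast]

lemma hist_zero (ω : S.Ω) : S.hist 0 ω = S.start := by
  funext i
  rw [hist, start, S.hcfg, if_pos (by omega)]
  simp

lemma hist_succ (n : ℕ) (ω : S.Ω) :
    S.hist (n + 1) ω = History.push (S.X (n + 1) ω) (S.hist n ω) := by
  funext i
  cases i with
  | zero => simpa [hist] using S.cfg_natCast ω (Nat.succ_pos n)
  | succ i => simp [hist]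

lemma shift_hist (n k : ℕ) (ω : S.Ω) : History.shift k (S.hist (n + k) ω) = S.hist n ω := by
  funext i
  simp only [History.shift, hist]
  congr 1
  push_cast
  ring

lemma age_hist (n : ℕ) (ω : S.Ω) : (History.age (S.hist n ω) : ℤ) = n - S.mpos ω n := by
  obtain ⟨h1, h2, h3⟩ := S.hmpos ω n
  obtain ⟨k, hk⟩ := Int.eq_ofNat_of_zero_le (sub_nonneg.2 h1)
  have hmem : S.hist n ω k = true := by
    rw [hist, show (n : ℤ) - (k : ℕ) = S.mpos ω n by omega, h2]
  rw [hk]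
  congr 1
  refine le_antisymm (Nat.sInf_le hmem) (le_csInf ⟨k, hmem⟩ fun j hj => ?_)
  by_contra hjk
  have := h3 (n - j) (by omega) (by omega)
  rw [show S.cfg ω (n - j) = true from hj] at this
  cases this

lemma measurable_comp_hist {E : Type*} [MeasurableSpace E] (φ : History → E) (n : ℕ) :
    Measurable fun ω => φ (S.hist n ω) := by
  induction n generalizing φ with
  | zero => simp only [hist_zero, measurable_const]
  | succ n ih =>
    have e : (fun ω => φ (S.hist (n + 1) ω)) = fun ω => if S.X (n + 1) ω = true then
        φ (History.push true (S.hist n ω)) else φ (History.push false (S.hist n ω)) := by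
      funext ω
      rw [hist_succ]
      cases S.X (n + 1) ω <;> simp
    rw [e]
    exact Measurable.ite (S.hXmeas (n + 1) (measurableSet_singleton true))
      (ih fun c => φ (History.push true c)) (ih fun c => φ (History.push false c))

lemma measurableSet_hist (A : Set History) (n : ℕ) : MeasurableSet {ω | S.hist n ω ∈ A} :=
  measurableSet_setOfPred.2 (S.measurable_comp_hist (· ∈ A) n)

/-- The letters appended during the first `n` steps. -/
def path (n : ℕ) (ω : S.Ω) : Fin n → Bool := fun i => S.X (i + 1) ω

lemma measurable_path (n : ℕ) : Measurable (S.path n) :=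
  measurable_pi_lambda _ fun i => S.hXmeas (i + 1)

lemma exists_hist_eq (n : ℕ) :
    ∃ e : (Fin n → Bool) → History, ∀ ω, S.hist n ω = e (S.path n ω) := by
  refine ⟨fun b i => if h : i < n then b ⟨n - 1 - i, by omega⟩ else S.start (i - n),
    fun ω => funext fun i => ?_⟩
  dsimp only
  split_ifs with h
  · rw [hist, path, ← Nat.cast_sub h.le, S.cfg_natCast ω (by omega)]
    congr 1
    change n - i = n - 1 - i + 1
    omega
  · rw [hist, start, S.hcfg, if_pos (by omega)]
    congr 1
    omega

lemma integral_comp_eq_sum {α : Type*} [Fintype α] [MeasurableSpace α] [MeasurableSingletonClass α]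
    {𝕜 : Type*} [RCLike 𝕜] {Z : S.Ω → α} (hZ : Measurable Z) (F : α → 𝕜) :
    ∫ ω, F (Z ω) ∂S.P = ∑ b, (S.P.real (Z ⁻¹' {b}) : 𝕜) * F b := by
  have hp : IsProbabilityMeasure (S.P.map Z) := Measure.isProbabilityMeasure_map hZ.aemeasurable
  rw [← integral_map (φ := Z) hZ.aemeasurable (Measurable.of_discrete).aestronglyMeasurable,
    integral_fintype (Integrable.of_finite)]
  refine Finset.sum_congr rfl fun b _ => ?_
  rw [map_measureReal_apply hZ (measurableSet_singleton b), RCLike.real_smul_eq_coe_mul]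

lemma real_path_and_next (hp : ∀ k w, 0 ≤ p k w) {n : ℕ} {e : (Fin n → Bool) → History}
    (he : ∀ ω, S.hist n ω = e (S.path n ω)) (b : Fin n → Bool) :
    S.P.real {ω | S.path n ω = b ∧ S.X (n + 1) ω = true} =
      History.nextProb p (e b) * S.P.real {ω | S.path n ω = b} := by
  have h := S.htrans n b (History.age (e b))
    (fun j => e b (History.age (e b) + (v - 1) - j)) fun ω hω => by
      have hb : S.hist n ω = e b := by rw [he, show S.path n ω = b from funext hω]
      rw [← hb, S.age_hist]
      refine ⟨rfl, fun j => ?_⟩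
      rw [hist]
      congr 1
      have := S.age_hist n ω
      have := j.2
      omega
  have e1 : {ω | S.path n ω = b} = {ω | ∀ i : Fin n, S.X (i.1 + 1) ω = b i} := by
    ext ω
    exact funext_iff
  have e2 : {ω | S.path n ω = b ∧ S.X (n + 1) ω = true} =
      {ω | (∀ i : Fin n, S.X (i.1 + 1) ω = b i) ∧ S.X (n + 1) ω = true} := by
    ext ω
    exact and_congr_left' funext_iff
  rw [e1, e2, Measure.real, h, ENNReal.toReal_mul, ENNReal.toReal_ofReal (hp _ _)]
  rfl

/-- The law of the chain is given by iterating its one-step transition. -/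
lemma integral_comp_hist (hp : ∀ k w, 0 ≤ p k w) {𝕜 : Type*} [RCLike 𝕜] (φ : History → 𝕜)
    (n : ℕ) : ∫ ω, φ (S.hist n ω) ∂S.P = History.avg p n φ S.start := by
  induction n generalizing φ with
  | zero => simp [hist_zero]
  | succ n ih =>
    rw [History.avg_add_steps, ← ih]
    obtain ⟨e, he⟩ := S.exists_hist_eq n
    have hZ : Measurable fun ω => (S.path n ω, S.X (n + 1) ω) :=
      (S.measurable_path n).prodMk (S.hXmeas (n + 1))
    have h1 := S.integral_comp_eq_sum hZ fun z => φ (History.push z.2 (e z.1))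
    have h2 := S.integral_comp_eq_sum (S.measurable_path n) fun b => History.avg p 1 φ (e b)
    simp only [hist_succ, he]
    rw [h1, h2, Fintype.sum_prod_type]
    refine Finset.sum_congr rfl fun b _ => ?_
    have t : S.P.real ((fun ω => (S.path n ω, S.X (n + 1) ω)) ⁻¹' {(b, true)}) =
        History.nextProb p (e b) * S.P.real (S.path n ⁻¹' {b}) := by
      refine Eq.trans ?_ (S.real_path_and_next hp he b)
      congr 1
      ext ω
      simp
    have f : S.P.real ((fun ω => (S.path n ω, S.X (n + 1) ω)) ⁻¹' {(b, false)}) =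
        (1 - History.nextProb p (e b)) * S.P.real (S.path n ⁻¹' {b}) := by
      rw [sub_mul, one_mul, ← t, eq_sub_iff_add_eq, ← measureReal_union _
        (hZ (measurableSet_singleton _))]
      · congr 1
        ext ω
        cases h : S.X (n + 1) ω <;> simp [h]
      · exact Disjoint.preimage _ (by simp)
    rw [Fintype.sum_bool, t, f, History.avg_succ]
    simp only [History.avg_zero, RCLike.ofReal_mul]
    ring

end VLMC

lemma measurable_sInf_nat {Ω : Type*} [MeasurableSpace Ω] {A : ℕ → Ω → Prop}
    (hA : ∀ n, MeasurableSet {ω | A n ω}) : Measurable fun ω => sInf {n | A n ω} := by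
  refine measurable_to_countable' fun n => ?_
  have e : (fun ω => sInf {n | A n ω}) ⁻¹' {n} =
      ({ω | A n ω} ∩ ⋂ m : Fin n, {ω | A m ω}ᶜ) ∪ ({ω | n = 0} ∩ ⋂ m, {ω | A m ω}ᶜ) := by
    ext ω
    simp only [Set.mem_preimage, Set.mem_singleton_iff, Set.mem_union, Set.mem_inter_iff,
      Set.mem_ofPred_eq, Set.mem_iInter, Set.mem_compl_iff]
    constructor
    · rintro rfl
      rcases Set.eq_empty_or_nonempty {n | A n ω} with h | h
      · exact Or.inr ⟨by rw [h, Nat.sInf_empty], fun m hm => Set.notMem_empty m (h ▸ hm)⟩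
      · exact Or.inl ⟨Nat.sInf_mem h, fun m hm => Nat.notMem_of_lt_sInf m.2 hm⟩
    · rintro (⟨h1, h2⟩ | ⟨rfl, h2⟩)
      · exact le_antisymm (Nat.sInf_le h1) (le_csInf ⟨n, h1⟩ fun m hm => not_lt.1 fun hlt =>
          h2 ⟨m, hlt⟩ hm)
      · rw [show {n | A n ω} = ∅ from Set.eq_empty_of_forall_notMem h2, Nat.sInf_empty]
  rw [e]
  exact ((hA n).inter (MeasurableSet.iInter fun m : Fin n => (hA m).compl)).union
    ((MeasurableSet.const (n = 0)).inter (MeasurableSet.iInter fun m : ℕ => (hA m).compl))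

namespace VLMC

variable {v : ℕ} {p : ℕ → (Fin (v - 1) → Bool) → ℝ} (S : VLMC v p)

lemma hitY0_iff (ω : S.Ω) (n : ℕ) : S.hitY0 ω n ↔ S.hist n ω ∈ History.hit v := by
  obtain ⟨h1, h2, h3⟩ := S.hmpos ω n
  have hv := S.hv
  refine and_congr ⟨fun h => ?_, fun h => ?_⟩ ⟨fun h i hi hiv => ?_, fun h j => ?_⟩
  · simp only [hist, Nat.cast_zero, sub_zero]
    rw [← h, h2]
  · by_contra hne
    have h4 := h3 n (lt_of_le_of_ne h1 hne) le_rfl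
    simp only [hist, Nat.cast_zero, sub_zero] at h
    rw [h] at h4
    cases h4
  · have := h ⟨v - 1 - i, by omega⟩
    rw [hist, ← this]
    congr 1
    push_cast [show i ≤ v - 1 by omega, show 1 ≤ v by omega]
    ring
  · have h5 := h (v - 1 - j) (by omega) (by omega)
    rw [← h5, hist]
    congr 1
    have := j.2
    omega

lemma sum_Ioc_eq_count (t k : ℕ) (ω : S.Ω) :
    ∑ n ∈ Finset.Ioc t (t + k), (S.X n ω).toNat = History.count k (S.hist (t + k) ω) := by
  induction k with
  | zero => simp [History.count]
  | succ k ih =>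
    rw [← add_assoc, Finset.sum_Ioc_succ_top (by omega), ih, hist_succ, History.count,
      History.count, Finset.sum_range_succ']
    rfl

lemma R_eq_count (n : ℕ) (ω : S.Ω) : S.R n ω = History.count n (S.hist n ω) := by
  have := S.sum_Ioc_eq_count 0 n ω
  rw [zero_add] at this
  exact this

lemma measurable_T (k : ℕ) : Measurable (S.T k) := by
  induction k with
  | zero => exact measurable_const
  | succ k ih =>
    refine measurable_sInf_nat (A := fun n ω => S.T k ω < n ∧ S.hitY0 ω n) fun n => ?_
    simp only [hitY0_iff]
    exact MeasurableSet.inter (s₁ := {ω | S.T k ω < n}) (ih measurableSet_Iio)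
      (S.measurableSet_hist (History.hit v) n)

lemma measurable_tau (k : ℕ) : Measurable (S.tau k) :=
  (S.measurable_T k).sub (S.measurable_T (k - 1))

lemma measurable_zeta (k : ℕ) : Measurable (S.zeta k) := by
  have h : Measurable fun q : (ℕ × ℕ) × S.Ω =>
      ∑ n ∈ Finset.Ioc q.1.1 q.1.2, (S.X n q.2).toNat :=
    measurable_from_prod_countable_right fun q => by
      dsimp only
      exact Finset.measurable_fun_sum _ fun n _ =>
        (Measurable.of_discrete (f := Bool.toNat)).comp (S.hXmeas n)
  exact h.comp (((S.measurable_T (k - 1)).prodMk (S.measurable_T k)).prodMk measurable_id)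

lemma zeta_le_tau (k : ℕ) (ω : S.Ω) : S.zeta k ω ≤ S.tau k ω := by
  refine (Finset.sum_le_card_nsmul _ _ 1 fun i _ => Bool.toNat_le _).trans ?_
  simp [tau]

/-- The first two regenerations take place at the times `t` and `t + k`. -/
def regenerate (k t : ℕ) : Set S.Ω :=
  {ω | S.hist t ω ∈ History.firstHit v t ∧ S.hist (t + k) ω ∈ History.firstHit v k}

lemma measurableSet_regenerate (k t : ℕ) : MeasurableSet (S.regenerate k t) :=
  (S.measurableSet_hist (History.firstHit v t) t).inter
    (S.measurableSet_hist (History.firstHit v k) (t + k))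

/-- A first regeneration within `k` steps after time `t` in terms of hitting times. -/
lemma sInf_eq_of_firstHit {t k : ℕ} {ω : S.Ω} (h : S.hist (t + k) ω ∈ History.firstHit v k) :
    sInf {n | t < n ∧ S.hitY0 ω n} = t + k := by
  obtain ⟨hk, h1, h2⟩ := h
  have hmem : t + k ∈ {n | t < n ∧ S.hitY0 ω n} := ⟨by omega, (S.hitY0_iff ω _).2 h1⟩
  refine le_antisymm (Nat.sInf_le hmem) (le_csInf ⟨_, hmem⟩ fun n hn => not_lt.1 fun hlt => ?_)
  obtain ⟨hn1, hn2⟩ := hn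
  refine h2 (t + k - n) (by omega) (by omega) ?_
  have e := S.shift_hist n (t + k - n) ω
  rw [show n + (t + k - n) = t + k by omega] at e
  rw [e]
  exact (S.hitY0_iff ω n).1 hn2

lemma firstHit_of_nonempty {t : ℕ} {ω : S.Ω} (h : {n | t < n ∧ S.hitY0 ω n}.Nonempty) :
    ∃ k, sInf {n | t < n ∧ S.hitY0 ω n} = t + k ∧ S.hist (t + k) ω ∈ History.firstHit v k := by
  obtain ⟨h1, h2⟩ := Nat.sInf_mem h
  obtain ⟨k, hk⟩ := Nat.exists_eq_add_of_lt h1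
  refine ⟨k + 1, by omega, by omega, ?_, fun i hi hik hs => ?_⟩
  · rw [← add_assoc, ← hk]
    exact (S.hitY0_iff ω _).1 h2
  · rw [show t + (k + 1) = (t + (k + 1) - i) + i by omega, shift_hist, ← hitY0_iff] at hs
    exact Nat.notMem_of_lt_sInf (s := {n | t < n ∧ S.hitY0 ω n})
      (show t + (k + 1) - i < _ by omega) ⟨by omega, hs⟩

lemma T_of_mem_regenerate {k t : ℕ} {ω : S.Ω} (h : ω ∈ S.regenerate k t) :
    S.T 1 ω = t ∧ S.T 2 ω = t + k := by
  have h1 : S.T 1 ω = t := by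
    have := S.sInf_eq_of_firstHit (t := 0) (k := t) (ω := ω) (by simpa using h.1)
    rwa [zero_add] at this
  refine ⟨h1, ?_⟩
  rw [T, h1]
  exact S.sInf_eq_of_firstHit h.2

lemma zeta_of_mem_regenerate {k t : ℕ} {ω : S.Ω} (h : ω ∈ S.regenerate k t) :
    S.zeta 2 ω = History.count k (S.hist (t + k) ω) := by
  obtain ⟨h1, h2⟩ := S.T_of_mem_regenerate h
  rw [zeta, show 2 - 1 = 1 from rfl, h1, h2, sum_Ioc_eq_count]

lemma setOf_tau_eq {k : ℕ} (hk : 0 < k) : {ω | S.tau 2 ω = k} = ⋃ t, S.regenerate k t := by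
  ext ω
  simp only [Set.mem_ofPred_eq, Set.mem_iUnion]
  constructor
  · intro h
    have h2 : 0 < S.T 2 ω := by
      rw [tau] at h
      omega
    have hne := Nat.nonempty_of_pos_sInf h2
    obtain ⟨m, hm1, hm2⟩ := S.firstHit_of_nonempty hne
    have hne1 : {n | 0 < n ∧ S.hitY0 ω n}.Nonempty :=
      hne.mono fun n hn => ⟨by have := hn.1; omega, hn.2⟩
    obtain ⟨t, ht1, ht2⟩ := S.firstHit_of_nonempty hne1
    rw [zero_add] at ht1 ht2
    have e1 : S.T 1 ω = t := ht1
    have e2 : S.T 2 ω = S.T 1 ω + m := hm1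
    have e3 : m = k := by
      rw [tau, show 2 - 1 = 1 from rfl] at h
      omega
    refine ⟨t, ht2, ?_⟩
    rw [← e3, ← e1]
    exact hm2
  · rintro ⟨t, ht⟩
    obtain ⟨h1, h2⟩ := S.T_of_mem_regenerate ht
    rw [tau, show 2 - 1 = 1 from rfl, h1, h2, add_tsub_cancel_left]

lemma pairwise_disjoint_regenerate (k : ℕ) : Pairwise (Function.onFun Disjoint (S.regenerate k)) :=
  fun _ _ hne => Set.disjoint_left.2 fun _ h h' =>
    hne ((S.T_of_mem_regenerate h).1.symm.trans (S.T_of_mem_regenerate h').1)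

lemma integrableOn_comp_zeta {𝕜 : Type*} [RCLike 𝕜] (k : ℕ) (g : ℕ → 𝕜) :
    IntegrableOn (fun ω => g (S.zeta 2 ω)) {ω | S.tau 2 ω = k} S.P := by
  refine Measure.integrableOn_of_bounded (M := ∑ j ∈ Finset.range (k + 1), ‖g j‖)
    (measure_ne_top _ _)
    (measurable_from_nat.comp (S.measurable_zeta 2)).aestronglyMeasurable ?_
  refine (ae_restrict_mem (S.measurable_tau 2 (measurableSet_singleton k))).mono fun ω hω => ?_
  refine Finset.single_le_sum (f := fun j => ‖g j‖) (fun _ _ => norm_nonneg _)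
    (Finset.mem_range.2 (Nat.lt_succ_of_le ?_))
  exact (S.zeta_le_tau 2 ω).trans (le_of_eq hω)

lemma setIntegral_regenerate (hp : ∀ k w, 0 ≤ p k w ∧ p k w ≤ 1) {𝕜 : Type*} [RCLike 𝕜]
    (k t : ℕ) (g : ℕ → 𝕜) :
    ∫ ω in S.regenerate k t, g (S.zeta 2 ω) ∂S.P =
      (History.firstMass p t S.start : 𝕜) * History.avg p k
        ((History.firstHit v k).indicator fun d => g (History.count k d)) History.base := by
  classical
  have e : (S.regenerate k t).indicator (fun ω => g (S.zeta 2 ω)) = fun ω =>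
      (fun d => (History.firstHit v t).indicator (fun _ => (1 : 𝕜)) (History.shift k d) *
        (History.firstHit v k).indicator (fun d => g (History.count k d)) d)
        (S.hist (t + k) ω) := by
    funext ω
    dsimp only
    rw [shift_hist]
    by_cases h : ω ∈ S.regenerate k t
    · rw [Set.indicator_of_mem h, Set.indicator_of_mem h.1, Set.indicator_of_mem h.2, one_mul,
        S.zeta_of_mem_regenerate h]
    · rw [Set.indicator_of_notMem h]
      by_cases h1 : S.hist t ω ∈ History.firstHit v t
      · rw [Set.indicator_of_notMem (s := History.firstHit v k) fun h2 => h ⟨h1, h2⟩, mul_zero]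
      · rw [Set.indicator_of_notMem h1, zero_mul]
  rw [← integral_indicator (S.measurableSet_regenerate k t), e,
    S.integral_comp_hist fun k w => (hp k w).1, History.avg_indicator_firstHit_mul p S.hv]
  · congr 1
    rw [History.firstMass, History.ofReal_avg]
    congr 1
    funext d
    simp only [Set.indicator_apply, Pi.one_apply]
    split_ifs <;> simp
  · intro d d' h
    simp only [Set.indicator_apply, History.mem_firstHit_congr S.hv h,
      History.count_congr fun i (hi : i < k) => h i (by omega)]

variable {η : ℝ}

/-- The law of the regeneration vector. -/
lemma setIntegral_tau_eq (hp : ∀ k w, 0 ≤ p k w ∧ p k w ≤ 1) (hη0 : 0 < η)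
    (hη : ∀ c, η ≤ History.avg p v ((History.hit v).indicator 1) c) {𝕜 : Type*} [RCLike 𝕜]
    {k : ℕ} (hk : 0 < k) (g : ℕ → 𝕜) :
    ∫ ω in {ω | S.tau 2 ω = k}, g (S.zeta 2 ω) ∂S.P = History.avg p k
        ((History.firstHit v k).indicator fun d => g (History.count k d)) History.base := by
  have hInt := S.integrableOn_comp_zeta k g
  rw [S.setOf_tau_eq hk] at hInt ⊢
  have h1 := hasSum_integral_iUnion (S.measurableSet_regenerate k)
    (S.pairwise_disjoint_regenerate k) hInt
  simp only [S.setIntegral_regenerate hp] at h1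
  have h2 := ((RCLike.hasSum_ofReal (𝕜 := 𝕜)).2
    (History.hasSum_firstMass hp hη0 hη S.hv S.start)).mul_right (History.avg p k
      ((History.firstHit v k).indicator fun d => g (History.count k d)) History.base)
  rw [RCLike.ofReal_one, one_mul] at h2
  exact h1.unique h2

lemma real_tau_eq (hp : ∀ k w, 0 ≤ p k w ∧ p k w ≤ 1) (hη0 : 0 < η)
    (hη : ∀ c, η ≤ History.avg p v ((History.hit v).indicator 1) c) (k : ℕ) :
    S.P.real {ω | S.tau 2 ω = k} = History.firstMass p k History.base := by
  have hpos : ∀ k, S.P.real {ω | S.tau 2 ω = k + 1} =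
      History.firstMass p (k + 1) History.base := fun k => by
    have := S.setIntegral_tau_eq hp hη0 hη (Nat.succ_pos k) fun _ => (1 : ℝ)
    rwa [setIntegral_const, smul_eq_mul, mul_one] at this
  cases k with
  | succ k => exact hpos k
  | zero =>
    have h1 : HasSum (fun k => S.P.real {ω | S.tau 2 ω = k}) 1 := by
      have := hasSum_integral_iUnion (μ := S.P) (f := fun _ => (1 : ℝ))
        (s := fun k : ℕ => {ω | S.tau 2 ω = k})
        (fun k => S.measurable_tau 2 (measurableSet_singleton k))
        (fun i j hij => Set.disjoint_left.2 fun ω hi hj => hij (hi.symm.trans hj))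
        (integrable_const _).integrableOn
      rw [show ⋃ k : ℕ, {ω | S.tau 2 ω = k} = Set.univ from Set.eq_univ_of_forall fun ω =>
        Set.mem_iUnion.2 ⟨_, rfl⟩] at this
      simpa using this
    have h2 := History.hasSum_firstMass hp hη0 hη S.hv History.base
    have h3 := (h1.sub h2).unique (hasSum_single 0 fun k hk => by
      obtain ⟨k, rfl⟩ := Nat.exists_eq_succ_of_ne_zero hk
      exact sub_eq_zero.2 (hpos k))
    linarith

lemma measure_tau_and_zeta_ne_zero {δ ε : ℝ} (hp : ∀ k w, 0 ≤ p k w ∧ p k w ≤ 1) (hη0 : 0 < η)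
    (hη : ∀ c, η ≤ History.avg p v ((History.hit v).indicator 1) c) (hδ : ∀ k w, p k w ≤ δ)
    (hδ1 : δ < 1) (hε0 : 0 < ε) (hε : ∀ k w, ε ≤ p k w) {n : ℕ} (hvn : v ≤ n + 1) :
    S.P {ω | S.tau 2 ω = n + 1 ∧ S.zeta 2 ω = 1} ≠ 0 := by
  classical
  intro h
  have h1 := S.setIntegral_tau_eq hp hη0 hη (Nat.succ_pos n) fun j => if j = 1 then (1 : ℝ) else 0
  have h2 : ∫ ω in {ω | S.tau 2 ω = n + 1}, (if S.zeta 2 ω = 1 then (1 : ℝ) else 0) ∂S.P = 0 := by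
    refine setIntegral_eq_zero_of_ae_eq_zero ?_
    refine (measure_eq_zero_iff_ae_notMem.1 h).mono fun ω hω hτ => if_neg fun hz => hω ⟨hτ, hz⟩
  have h3 := History.le_avg_indicator_hit hp hδ hδ1.le hε0.le hε n History.base
  have h4 : 0 < ε * (1 - δ) ^ n := mul_pos hε0 (pow_pos (by linarith) n)
  have h5 : History.avg p (n + 1) ((History.hit (n + 1)).indicator 1) History.base ≤
      History.avg p (n + 1) ((History.firstHit v (n + 1)).indicator fun d =>
        if History.count (n + 1) d = 1 then (1 : ℝ) else 0) History.base := by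
    refine History.avg_mono hp (fun d => ?_) _
    by_cases hd : d ∈ History.hit (n + 1)
    · obtain ⟨h6, h7⟩ := History.hit_subset_firstHit n.succ_pos hvn hd
      rw [Set.indicator_of_mem hd, Set.indicator_of_mem h6, if_pos h7, Pi.one_apply]
    · rw [Set.indicator_of_notMem hd]
      exact Set.indicator_nonneg (fun _ _ => by positivity) _
  have h6 := h1.symm.trans h2
  linarith

lemma integrable_exp_tau (hp : ∀ k w, 0 ≤ p k w ∧ p k w ≤ 1) (hη0 : 0 < η)
    (hη : ∀ c, η ≤ History.avg p v ((History.hit v).indicator 1) c) :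
    Integrable (fun ω => Real.exp (η / (2 * v) * S.tau 2 ω)) S.P := by
  have hv : (0 : ℝ) < v := by exact_mod_cast S.hv
  have hm : ∀ k : ℕ, MeasurableSet {ω | S.tau 2 ω = k} := fun k =>
    S.measurable_tau 2 (measurableSet_singleton k)
  have hc : ∀ k : ℕ, Set.EqOn (fun ω => Real.exp (η / (2 * v) * S.tau 2 ω))
      (fun _ => Real.exp (η / (2 * v) * k)) {ω | S.tau 2 ω = k} := fun k ω hω => by
    dsimp only
    rw [show S.tau 2 ω = k from hω]
  rw [← integrableOn_univ, ← show ⋃ k : ℕ, {ω | S.tau 2 ω = k} = Set.univ from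
    Set.eq_univ_of_forall fun ω => Set.mem_iUnion.2 ⟨_, rfl⟩]
  refine integrableOn_iUnion_of_summable_integral_norm
    (fun k => (integrableOn_congr_fun (hc k) (hm k)).2 (integrable_const _).integrableOn) ?_
  have hsum : Summable fun k : ℕ => Real.exp (2 * η) * Real.exp (k * -(η / (2 * v))) :=
    (Real.summable_exp_nat_mul_iff.2 (neg_lt_zero.2 (by positivity))).mul_left _
  refine hsum.of_nonneg_of_le (fun k => integral_nonneg fun _ => norm_nonneg _) fun k => ?_
  simp only [Real.norm_of_nonneg (Real.exp_pos _).le]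
  rw [setIntegral_congr_fun (hm k) (hc k), setIntegral_const, smul_eq_mul,
    S.real_tau_eq hp hη0 hη]
  refine (mul_le_mul_of_nonneg_right (History.firstMass_le_exp hp hη0.le hη S.hv k _)
    (Real.exp_pos _).le).trans (le_of_eq ?_)
  rw [mul_assoc, ← Real.exp_add]
  congr 2
  field_simp
  ring

/-- The span and the reward between two successive regenerations of the chain. -/
def rewardedSpan {δ ε : ℝ} (hp : ∀ k w, 0 ≤ p k w ∧ p k w ≤ 1) (hη0 : 0 < η) (hη1 : η ≤ 1)
    (hη : ∀ c, η ≤ History.avg p v ((History.hit v).indicator 1) c) (hδ : ∀ k w, p k w ≤ δ)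
    (hδ1 : δ < 1) (hε0 : 0 < ε) (hε : ∀ k w, ε ≤ p k w) : RewardedSpan S.P where
  τ := S.tau 2
  ζ := S.zeta 2
  measurable_τ := S.measurable_tau 2
  measurable_ζ := S.measurable_zeta 2
  ζ_le := S.zeta_le_tau 2
  τ_pos := by
    have h := S.real_tau_eq hp hη0 hη 0
    rw [History.firstMass_zero, measureReal_eq_zero_iff] at h
    exact (measure_eq_zero_iff_ae_notMem.1 h).mono fun ω hω => Nat.pos_of_ne_zero hω
  s := η / (2 * v)
  s_pos := div_pos hη0 (by have := S.hv; positivity)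
  s_le_one := by
    have : (1 : ℝ) ≤ v := by exact_mod_cast S.hv
    exact (div_le_one (by linarith)).2 (by linarith)
  integrable_exp := S.integrable_exp_tau hp hη0 hη
  m := v
  pos_m := by
    have h := S.measure_tau_and_zeta_ne_zero hp hη0 hη hδ hδ1 hε0 hε (n := v - 1) (by omega)
    rwa [Nat.sub_add_cancel S.hv] at h
  pos_m_succ := S.measure_tau_and_zeta_ne_zero hp hη0 hη hδ hδ1 hε0 hε (Nat.le_succ v)

lemma sum_real_R_mul {𝕜 : Type*} [RCLike 𝕜] (hp : ∀ k w, 0 ≤ p k w ∧ p k w ≤ 1) (n : ℕ)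
    (g : ℕ → 𝕜) : ∑ j ∈ Finset.range (n + 1), (S.P.real {ω | S.R n ω = j} : 𝕜) * g j =
      History.avg p n (fun d => g (History.count n d)) S.start := by
  classical
  rw [← S.integral_comp_hist fun k w => (hp k w).1]
  have e : ∀ ω, g (History.count n (S.hist n ω)) = ∑ j ∈ Finset.range (n + 1),
      {ω | S.R n ω = j}.indicator (fun _ => g j) ω := fun ω => by
    rw [Finset.sum_eq_single (S.R n ω)]
    · rw [Set.indicator_of_mem (by rfl), R_eq_count]
    · exact fun j _ hj => Set.indicator_of_notMem (fun h => hj h.symm) _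
    · intro h
      exact absurd (Finset.mem_range.2 (Nat.lt_succ_of_le
        ((S.R_eq_count n ω).trans_le (History.count_le n _)))) h
  have hm : ∀ j, MeasurableSet {ω | S.R n ω = j} := fun j => by
    simp only [R_eq_count]
    exact S.measurableSet_hist {d | History.count n d = j} n
  simp only [e]
  rw [integral_finsetSum _ fun j _ => (integrable_const _).indicator (hm j)]
  refine Finset.sum_congr rfl fun j _ => ?_
  rw [integral_indicator (hm j), setIntegral_const, RCLike.real_smul_eq_coe_mul]

lemma real_R_eq_zero {n j : ℕ} (h : n < j) : S.P.real {ω | S.R n ω = j} = 0 := by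
  rw [show {ω | S.R n ω = j} = ∅ from Set.eq_empty_of_forall_notMem fun ω hω => ?_,
    measureReal_empty]
  have h1 := (S.R_eq_count n ω).trans_le (History.count_le n _)
  have h2 : S.R n ω = j := hω
  omega

lemma coeff_rewardedSpan {δ ε : ℝ} (hp : ∀ k w, 0 ≤ p k w ∧ p k w ≤ 1) (hη0 : 0 < η) (hη1 : η ≤ 1)
    (hη : ∀ c, η ≤ History.avg p v ((History.hit v).indicator 1) c) (hδ : ∀ k w, p k w ≤ δ)
    (hδ1 : δ < 1) (hε0 : 0 < ε) (hε : ∀ k w, ε ≤ p k w) (k : ℕ) (u : ℂ) :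
    (S.rewardedSpan hp hη0 hη1 hη hδ hδ1 hε0 hε).coeff k u =
      History.first p k u History.base := by
  rcases Nat.eq_zero_or_pos k with rfl | hk
  · have h := S.real_tau_eq hp hη0 hη 0
    rw [History.firstMass_zero, measureReal_eq_zero_iff] at h
    rw [RewardedSpan.coeff]
    refine (setIntegral_measure_zero _ h).trans ?_
    simp [History.first, History.firstHit]
  · exact S.setIntegral_tau_eq hp hη0 hη hk fun j => Complex.exp (u * j)

/-- The renewal structure of the number of appended ones. -/
def renewalFamily {δ ε : ℝ} (hp : ∀ k w, 0 ≤ p k w ∧ p k w ≤ 1) (hη0 : 0 < η) (hη1 : η ≤ 1)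
    (hη : ∀ c, η ≤ History.avg p v ((History.hit v).indicator 1) c) (hδ : ∀ k w, p k w ≤ δ)
    (hδ1 : δ < 1) (hε0 : 0 < ε) (hε : ∀ k w, ε ≤ p k w) :
    RenewalFamily (S.rewardedSpan hp hη0 hη1 hη hδ hδ1 hε0 hε) :=
  have hs : ∀ n : ℕ, Real.exp (-(η / v * n)) ≤ Real.exp (-(η / (2 * v) * n)) := fun n => by
    have hv : (0 : ℝ) < v := by exact_mod_cast S.hv
    rw [Real.exp_le_exp, neg_le_neg_iff]
    gcongr
    linarith
  have hF : ∀ n u c, ‖History.first p n u c‖ ≤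
      Real.exp (2 * η) * Real.exp (-(η / (2 * v) * n)) * Real.exp (n * |u.re|) := fun n u c =>
    (History.norm_avg_indicator_exp_le hp n u _ c).trans <| mul_le_mul_of_nonneg_right
      ((History.firstMass_le_exp hp hη0.le hη S.hv n c).trans
        (mul_le_mul_of_nonneg_left (hs n) (Real.exp_pos _).le)) (Real.exp_pos _).le
  have hH : ∀ n u c, ‖History.rest p n u c‖ ≤
      Real.exp (2 * η) * Real.exp (-(η / (2 * v) * n)) * Real.exp (n * |u.re|) := fun n u c =>
    (History.norm_avg_indicator_exp_le hp n u _ c).trans <| mul_le_mul_of_nonneg_right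
      ((History.survival_le_exp hp hη0.le hη S.hv n c).trans
        (mul_le_mul (Real.exp_le_exp.2 (by linarith)) (hs n) (Real.exp_pos _).le
          (Real.exp_pos _).le)) (Real.exp_pos _).le
  { prob := fun n j => S.P.real {ω | S.R n ω = j}
    sum_prob := fun n => by
      simpa [History.avg_const] using S.sum_real_R_mul hp n fun _ => (1 : ℝ)
    prob_nonneg := fun _ _ => measureReal_nonneg
    prob_eq_zero := fun _ _ h => S.real_R_eq_zero h
    G₀ := fun n u => History.gen p n u History.base
    H := fun n u => History.rest p n u S.start
    H₀ := fun n u => History.rest p n u History.base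
    F₁ := fun n u => History.first p n u S.start
    C := Real.exp (2 * η)
    norm_G₀_le := fun n u => History.norm_gen_le hp n u _
    norm_H_le := fun n u => hH n u _
    norm_H₀_le := fun n u => hH n u _
    norm_F₁_le := fun n u => hF n u _
    G_eq := fun n u => (S.sum_real_R_mul hp n fun j => Complex.exp (u * j)).trans
      (History.gen_eq p S.hv n u S.start)
    G₀_eq := fun n u => by
      simp only [coeff_rewardedSpan]
      exact History.gen_eq p S.hv n u History.base }

end VLMC

namespace VLMC

/-- Theorem 1.5(4): the local theorem in the regions of normal and
moderate deviations: if `x_n/n → a` then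
`P(R(n) = x_n) = (σ √(2πn))⁻¹ e^{-n D(x_n/n)} (1 + o(1))`, expressed as convergence
of the ratio to `1`. -/
theorem statement3 {v : ℕ} {p : ℕ → (Fin (v - 1) → Bool) → ℝ} (S : VLMC v p)
    (hA : ∃ δ1 δ2 : ℝ, S.CondA δ1 δ2)
    (x : ℕ → ℕ)
    (hx : Filter.Tendsto (fun n : ℕ => (x n : ℝ) / n) Filter.atTop (nhds S.a)) :
    Filter.Tendsto
      (fun n : ℕ =>
        (S.P {ω | S.R n ω = x n}).toReal /
          (Real.exp (-(n : ℝ) * S.D ((x n : ℝ) / n)) /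
            (Real.sqrt S.sigma2 * Real.sqrt (2 * Real.pi * n))))
      Filter.atTop (nhds 1) := by
  obtain ⟨δ, ε, -, hε0, hεδ, hδ1, h⟩ := hA
  have hp : ∀ k w, 0 ≤ p k w ∧ p k w ≤ 1 := fun k w =>
    ⟨hε0.le.trans (h k w).1, (h k w).2.trans hδ1.le⟩
  have hη0 : 0 < ε * (1 - δ) ^ (v - 1) := mul_pos hε0 (pow_pos (by linarith) _)
  have hη1 : ε * (1 - δ) ^ (v - 1) ≤ 1 :=
    mul_le_one₀ (by linarith) (pow_nonneg (by linarith) _)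
      (pow_le_one₀ (by linarith) (by linarith))
  have hη : ∀ c, ε * (1 - δ) ^ (v - 1) ≤ History.avg p v ((History.hit v).indicator 1) c :=
    fun c => by
      have := History.le_avg_indicator_hit hp (fun k w => (h k w).2) hδ1.le hε0.le
        (fun k w => (h k w).1) (v - 1) c
      rwa [Nat.sub_add_cancel S.hv] at this
  exact (S.renewalFamily hp hη0 hη1 hη (fun k w => (h k w).2) hδ1 hε0
    fun k w => (h k w).1).tendsto_prob_div hx

end VLMC
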